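/- (Analytic continuation in the squared distances.) Let G be a Feynman graph with edges labelled 1,…,E (E ≥ 1) which is ultraviolet convergent and infrared convergent, such that M_G > 0, every connected component of G contains an external vertex, and some two external vertices lie in the same connected component; choose n_e ∈ ℕ with n_e + λν_e > 0 for every edge e. For a complex vector s = (s_{ij}) indexed by unordered pairs {i,j} of external vertices, define Φ̃_G(α, s) = Σ_{i<j} s_{ij}·Ψ̃_G^{p(i,j)}(α), and on the domain Ω = { s : Re s_{ij} > 0 for all i < j } (where Re Φ̃_G(α,s) > 0 for all α in the open orthant, so principal complex powers are defined) set F(s) = ((−1)^{Σ_e n_e} · Γ(M_G) / ∏_e Γ(n_e + λν_e)) · ∫_{(0,∞)^{E−1}} [ (∏_e α_e^{n_e + λν_e − 1}) · (∏_e ∂_{α_e}^{n_e})( Φ̃_G(α,s)^{−M_G} · Ψ̃_G(α)^{−(d/2 − M_G)} ) ] restricted to α_1 = 1, dα_2 ⋯ dα_E. Then F is a well-defined (absolutely convergent) holomorphic function of s on Ω, and F(s) = f_G(x) whenever x = (x_v)_{v ∈ V_ext} are pairwise distinct points of ℝ^d with s_{ij} = ‖x_i − x_j‖² for all pairs. In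 particular f_G(x) extends to a single-valued analytic function on Ω. -/

import Mathlib

open scoped Classical ENNReal
open MeasureTheory

noncomputable section

/-- A Feynman graph with vertices `Fin nV`, edges `Fin nE` (each edge has two
distinct endpoints, multiple edges allowed), a set of external vertices and
real edge weights. -/
structure FeynmanGraph (nV nE : ℕ) where
  ends : Fin nE → Fin nV × Fin nV
  ends_ne : ∀ e, (ends e).1 ≠ (ends e).2
  ext : Finset (Fin nV)
  ν : Fin nE → ℝ

/-- `λ = d/2 - 1`. -/
def lam (d : ℕ) : ℝ := (d : ℝ) / 2 - 1

namespace FeynmanGraph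

variable {nV nE : ℕ} (G : FeynmanGraph nV nE)

/-- The edge `e` is incident to the vertex `v`. -/
def Incident (e : Fin nE) (v : Fin nV) : Prop :=
  (G.ends e).1 = v ∨ (G.ends e).2 = v

/-- The edge `e` joins the vertices `u` and `v`. -/
def Joins (e : Fin nE) (u v : Fin nV) : Prop :=
  G.ends e = (u, v) ∨ G.ends e = (v, u)

/-- The internal vertices of `G`. -/
def intVerts : Finset (Fin nV) := Finset.univ.filter (fun v => v ∉ G.ext)

/-- The simple graph on the vertices of `G` induced by a subset `F` of the edges. -/
def edgeGraph (F : Finset (Fin nE)) : SimpleGraph (Fin nV) :=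
  SimpleGraph.fromRel (fun u v => ∃ e ∈ F, G.Joins e u v)

/-- `F` is a spanning forest of `G` compatible with the collection `p` of pairwise
disjoint vertex sets: `F` is acyclic (as a set of multigraph edges), the graph
`(V, F)` has exactly `p.card` connected components, and distinct parts of `p` lie in
distinct components.  (Acyclicity together with the component count is expressed by
the edge count `F.card + p.card = nV`.) -/
def IsForest (p : Finset (Finset (Fin nV))) (F : Finset (Fin nE)) : Prop :=
  F.card + p.card = nV ∧
  Nat.card (G.edgeGraph F).ConnectedComponent = p.card ∧
  (∀ P ∈ p, ∀ u ∈ P, ∀ v ∈ P, (G.edgeGraph F).Reachable u v) ∧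
  (∀ P ∈ p, ∀ Q ∈ p, P ≠ Q → ∀ u ∈ P, ∀ v ∈ Q, ¬ (G.edgeGraph F).Reachable u v)

/-- The set `𝓕_G^p` of spanning forests compatible with `p`. -/
def forests (p : Finset (Finset (Fin nV))) : Finset (Finset (Fin nE)) :=
  Finset.univ.filter (fun F => G.IsForest p F)

/-- The dual spanning forest polynomial `Ψ̃_G^p`, evaluated at `α`. -/
def dualForestPoly (p : Finset (Finset (Fin nV))) (α : Fin nE → ℝ) : ℝ :=
  ∑ F ∈ G.forests p, ∏ e ∈ F, α e

/-- The spanning forest polynomial `Ψ_G^p`, evaluated at `α`. -/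
def forestPoly (p : Finset (Finset (Fin nV))) (α : Fin nE → ℝ) : ℝ :=
  ∑ F ∈ G.forests p, ∏ e ∈ Finset.univ \ F, α e

/-- The partition of the external vertices into singletons. -/
def singlePart : Finset (Finset (Fin nV)) := G.ext.image (fun v => {v})

/-- The collection `p(i,j)` consisting of `{i, j}` together with the singletons of the
remaining external vertices. -/
def pairPart (i j : Fin nV) : Finset (Finset (Fin nV)) :=
  insert ({i, j} : Finset (Fin nV)) (((G.ext.erase i).erase j).image (fun v => {v}))

/-- `Ψ̃_G`, evaluated at `α`. -/
def psiTilde (α : Fin nE → ℝ) : ℝ := G.dualForestPoly G.singlePart α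

/-- `Φ̃_G(α, x) = Σ_{i<j external} ‖x_i - x_j‖² Ψ̃_G^{p(i,j)}(α)`. -/
def phiTilde {d : ℕ} (x : Fin nV → EuclideanSpace ℝ (Fin d)) (α : Fin nE → ℝ) : ℝ :=
  ∑ i ∈ G.ext, ∑ j ∈ G.ext.filter (fun j => i < j),
    ‖x i - x j‖ ^ 2 * G.dualForestPoly (G.pairPart i j) α

/-- Positions of all vertices: external vertices are placed according to `x`,
internal vertices according to `y`. -/
def assemble {E : Type*} (x : Fin nV → E) (y : {v : Fin nV // v ∉ G.ext} → E) :
    Fin nV → E :=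
  fun v => if h : v ∉ G.ext then y ⟨v, h⟩ else x v

/-- The position space Feynman integral
`f_G(x) = ∫ ∏_{v internal} d^d x_v/π^{d/2} ∏_e ‖x_{u(e)} - x_{w(e)}‖^{-2λν_e}`,
a Lebesgue integral of a nonnegative function, with values in `[0,∞]`.  Only the
external components of `x` matter. -/
def posIntegral (d : ℕ) (x : Fin nV → EuclideanSpace ℝ (Fin d)) : ℝ≥0∞ :=
  (∫⁻ y : {v : Fin nV // v ∉ G.ext} → EuclideanSpace ℝ (Fin d),
      ENNReal.ofReal (∏ e,
        ‖G.assemble x y (G.ends e).1 - G.assemble x y (G.ends e).2‖ ^ (-(2 * lam d * G.ν e)))) /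
    ENNReal.ofReal (Real.pi ^ ((d : ℝ) / 2 * (G.intVerts.card : ℝ)))

/-- The standard positions of the three external vertices `0`, `1`, `z`. -/
def extPos (d : ℕ) (v0 v1 vz : Fin nV) (z : ℂ) : Fin nV → EuclideanSpace ℝ (Fin d) :=
  fun v =>
    if v = v0 then 0
    else if v = v1 then WithLp.toLp 2 (fun i : Fin d => if (i : ℕ) = 0 then 1 else 0)
    else if v = vz then
      WithLp.toLp 2 (fun i : Fin d => if (i : ℕ) = 0 then z.re else if (i : ℕ) = 1 then z.im else 0)
    else 0

/-- The graphical function `f_G(z)` of a graph with the three external vertices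
`v0`, `v1`, `vz`. -/
def graphicalFn (d : ℕ) (v0 v1 vz : Fin nV) (z : ℂ) : ℝ≥0∞ :=
  G.posIntegral d (extPos d v0 v1 vz z)

/-- The edges of `G` having both endpoints in `Vg`. -/
def edgesWithin (Vg : Finset (Fin nV)) : Finset (Fin nE) :=
  Finset.univ.filter (fun e => (G.ends e).1 ∈ Vg ∧ (G.ends e).2 ∈ Vg)

/-- Ultraviolet convergence. -/
def UVConvergent (d : ℕ) : Prop :=
  ∀ Vg : Finset (Fin nV), 2 ≤ Vg.card → (Vg ∩ G.ext).card ≤ 1 →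
    lam d * ∑ e ∈ G.edgesWithin Vg, G.ν e < (d : ℝ) / 2 * ((Vg.card : ℝ) - 1)

/-- `(Vg, Eg)` is a subgraph of `G`. -/
def IsSubgraph (Vg : Finset (Fin nV)) (Eg : Finset (Fin nE)) : Prop :=
  ∀ e ∈ Eg, (G.ends e).1 ∈ Vg ∧ (G.ends e).2 ∈ Vg

/-- `v` is a `g`-internal vertex of the subgraph `g = (Vg, Eg)`. -/
def GInternal (Vg : Finset (Fin nV)) (Eg : Finset (Fin nE)) (v : Fin nV) : Prop :=
  v ∉ G.ext ∧ v ∈ Vg ∧ ∀ e, G.Incident e v → e ∈ Eg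

/-- The set of `g`-internal vertices of the subgraph `g = (Vg, Eg)`. -/
def gInternalSet (Vg : Finset (Fin nV)) (Eg : Finset (Fin nE)) : Finset (Fin nV) :=
  Finset.univ.filter (fun v => G.GInternal Vg Eg v)

/-- Infrared convergence. -/
def IRConvergent (d : ℕ) : Prop :=
  ∀ Vg : Finset (Fin nV), ∀ Eg : Finset (Fin nE), G.IsSubgraph Vg Eg →
    0 < (G.gInternalSet Vg Eg).card →
    (∀ e ∈ Eg, G.GInternal Vg Eg (G.ends e).1 ∨ G.GInternal Vg Eg (G.ends e).2) →
    (d : ℝ) / 2 * ((G.gInternalSet Vg Eg).card : ℝ) < lam d * ∑ e ∈ Eg, G.ν e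

/-- The superficial degree of divergence `M_G = λ ν_G - (d/2)·V_int`. -/
def Mdeg (d : ℕ) : ℝ := lam d * ∑ e, G.ν e - (d : ℝ) / 2 * (G.intVerts.card : ℝ)

end FeynmanGraph

/-- The affine chart `α_1 = 1`: the first Schwinger parameter (edge `0`) is set to `1`,
the remaining ones are given by `β`. -/
def chart {m : ℕ} (β : {e : Fin (m + 1) // e ≠ 0} → ℝ) : Fin (m + 1) → ℝ :=
  fun e => if h : e = 0 then 1 else β ⟨e, h⟩

/-- The partial derivative `∂_{α_e}` of a complex-valued function of the Schwinger
parameters. -/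
def pderivEC {m : ℕ} (e : Fin (m + 1)) (f : (Fin (m + 1) → ℝ) → ℂ) :
    (Fin (m + 1) → ℝ) → ℂ :=
  fun α => deriv (fun t => f (Function.update α e t)) (α e)

/-- The iterated partial derivative `∏_e ∂_{α_e}^{n_e}` (complex-valued). -/
def multiDerivC {m : ℕ} (n : Fin (m + 1) → ℕ) (f : (Fin (m + 1) → ℝ) → ℂ) :
    (Fin (m + 1) → ℝ) → ℂ :=
  (Finset.univ : Finset (Fin (m + 1))).toList.foldr (fun e g => (pderivEC e)^[n e] g) f

namespace FeynmanGraph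

/-- `Φ̃_G(α, s) = Σ_{i<j external} s_{ij} Ψ̃_G^{p(i,j)}(α)` for a complex vector `s`
of squared distances, indexed by (ordered representatives of unordered) pairs of
external vertices. -/
def phiTildeS {nV nE : ℕ} (G : FeynmanGraph nV nE)
    (s : Fin nV → Fin nV → ℂ) (α : Fin nE → ℝ) : ℂ :=
  ∑ i ∈ G.ext, ∑ j ∈ G.ext.filter (fun j => i < j),
    s i j * (G.dualForestPoly (G.pairPart i j) α : ℂ)

end FeynmanGraph

/-- The complex integrand of the dual parametric representation, in the affine chart
`α_1 = 1`, as a function of the squared-distance vector `s`. -/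
def dualIntegrandC (d : ℕ) {nV m : ℕ} (G : FeynmanGraph nV (m + 1))
    (n : Fin (m + 1) → ℕ) (s : Fin nV → Fin nV → ℂ)
    (β : {e : Fin (m + 1) // e ≠ 0} → ℝ) : ℂ :=
  ((∏ e, chart β e ^ ((n e : ℝ) + lam d * G.ν e - 1) : ℝ) : ℂ) *
    multiDerivC n
      (fun α => G.phiTildeS s α ^ (-(G.Mdeg d : ℂ)) *
        ((G.psiTilde α : ℝ) : ℂ) ^ (-((((d : ℝ) / 2 - G.Mdeg d : ℝ)) : ℂ)))
      (chart β)

/-- The analytic continuation `F(s)` of the graphical function in the squared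
distances `s`:
`F(s) = ((-1)^{Σ n_e} Γ(M_G)/∏_e Γ(n_e + λν_e)) ∫_{(0,∞)^{E-1}} dualIntegrandC`. -/
def Fcont (d : ℕ) {nV m : ℕ} (G : FeynmanGraph nV (m + 1))
    (n : Fin (m + 1) → ℕ) (s : Fin nV → Fin nV → ℂ) : ℂ :=
  ((((-1 : ℝ) ^ (∑ e, n e) * Real.Gamma (G.Mdeg d) /
      ∏ e, Real.Gamma ((n e : ℝ) + lam d * G.ν e)) : ℝ) : ℂ) *
    ∫ β in {β : {e : Fin (m + 1) // e ≠ 0} → ℝ | ∀ e, 0 < β e},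
      dualIntegrandC d G n s β

namespace FeynmanGraph
variable {nV nE : ℕ} (G : FeynmanGraph nV nE)

/-- The signed incidence vector of an edge. -/
def inc (e : Fin nE) : Fin nV → ℝ :=
  Pi.single (G.ends e).1 1 - Pi.single (G.ends e).2 1

/-- Restriction of a function on the vertices to the complement of the root set `R`. -/
def offRoots (R : Finset (Fin nV)) : (Fin nV → ℝ) →ₗ[ℝ] ({v // v ∉ R} → ℝ) :=
  LinearMap.funLeft ℝ ℝ Subtype.val

/-- The incidence vector of an edge relative to the root set `R`. -/
def incOff (R : Finset (Fin nV)) (e : Fin nE) : {v // v ∉ R} → ℝ := offRoots R (G.inc e)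

/-- `F` is a spanning forest in which every component contains exactly one vertex of `R`. -/
def IsRootedForest (R : Finset (Fin nV)) (F : Finset (Fin nE)) : Prop :=
  F.card + R.card = nV ∧ ∀ v, ∃ r ∈ R, (G.edgeGraph F).Reachable v r

variable {G}

lemma offRoots_single_of_mem {R : Finset (Fin nV)} {r : Fin nV} (hr : r ∈ R) :
    offRoots R (Pi.single r 1) = 0 := by
  ext ⟨v, hv⟩
  have : v ≠ r := fun h => hv (h ▸ hr)
  simp [offRoots, LinearMap.funLeft, this]

lemma offRoots_single {R : Finset (Fin nV)} (v : {v // v ∉ R}) :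
    offRoots R (Pi.single (v : Fin nV) 1) = Pi.single v 1 := by
  ext w
  simp [offRoots, LinearMap.funLeft, Pi.single_apply, Subtype.ext_iff]

lemma edgeGraph_adj {F : Finset (Fin nE)} {u v : Fin nV} :
    (G.edgeGraph F).Adj u v ↔ ∃ e ∈ F, G.Joins e u v := by
  simp only [edgeGraph, SimpleGraph.fromRel_adj]
  constructor
  · rintro ⟨-, ⟨e, he, h⟩ | ⟨e, he, h⟩⟩
    · exact ⟨e, he, h⟩
    · exact ⟨e, he, h.symm⟩
  · rintro ⟨e, he, h⟩
    refine ⟨?_, Or.inl ⟨e, he, h⟩⟩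
    rintro rfl
    apply G.ends_ne e
    rcases h with h | h <;> rw [h]

lemma reachable_ends {F : Finset (Fin nE)} {e : Fin nE} (he : e ∈ F) :
    (G.edgeGraph F).Reachable (G.ends e).1 (G.ends e).2 :=
  (edgeGraph_adj.2 ⟨e, he, Or.inl rfl⟩).reachable

lemma reachable_mono {F F' : Finset (Fin nE)} (h : F ⊆ F') {u v : Fin nV}
    (huv : (G.edgeGraph F).Reachable u v) : (G.edgeGraph F').Reachable u v := by
  refine huv.mono fun a b hab => ?_
  obtain ⟨e, he, h'⟩ := edgeGraph_adj.1 hab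
  exact edgeGraph_adj.2 ⟨e, h he, h'⟩

/-- A relation that is reflexive, transitive, symmetric and holds along the edges of `F` holds
between any two vertices connected by `F`. -/
lemma rel_of_reachable {F : Finset (Fin nE)} {r : Fin nV → Fin nV → Prop} (hr : Equivalence r)
    (h : ∀ e ∈ F, r (G.ends e).1 (G.ends e).2) {u v : Fin nV}
    (huv : (G.edgeGraph F).Reachable u v) : r u v := by
  obtain ⟨p⟩ := huv
  induction p with
  | nil => exact hr.refl _
  | cons hab _ ih =>
    obtain ⟨e, he, h'⟩ := edgeGraph_adj.1 hab
    refine hr.trans ?_ ih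
    have := h e he
    rcases h' with h' | h' <;> rw [h'] at this
    · exact this
    · exact hr.symm this

lemma eq_of_reachable {β : Type*} {φ : Fin nV → β} {F : Finset (Fin nE)}
    (h : ∀ e ∈ F, φ (G.ends e).1 = φ (G.ends e).2) {u v : Fin nV}
    (huv : (G.edgeGraph F).Reachable u v) : φ u = φ v :=
  rel_of_reachable (r := fun u v => φ u = φ v) ⟨fun _ => rfl, Eq.symm, Eq.trans⟩ h huv

lemma single_sub_single_mem_span {F : Finset (Fin nE)} {u v : Fin nV}
    (huv : (G.edgeGraph F).Reachable u v) :
    (Pi.single u 1 - Pi.single v 1 : Fin nV → ℝ) ∈ Submodule.span ℝ (G.inc '' F) := by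
  refine rel_of_reachable
    (r := fun u v => (Pi.single u 1 - Pi.single v 1 : Fin nV → ℝ) ∈ Submodule.span ℝ (G.inc '' F))
    ⟨fun _ => by simp, fun h => ?_, fun h h' => ?_⟩ (fun e he => ?_) huv
  · rw [← neg_sub]; exact neg_mem h
  · simpa using add_mem h h'
  · exact Submodule.subset_span ⟨e, he, rfl⟩

lemma offRoots_mem_span {R : Finset (Fin nV)} {F : Finset (Fin nE)} {y : Fin nV → ℝ}
    (h : y ∈ Submodule.span ℝ (G.inc '' F)) :
    offRoots R y ∈ Submodule.span ℝ (G.incOff R '' F) := by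
  have := Submodule.mem_map_of_mem (f := offRoots R) h
  rwa [Submodule.map_span, ← Set.image_comp] at this

lemma single_mem_span_of_reachable_root {R : Finset (Fin nV)} {F : Finset (Fin nE)}
    (v : {v // v ∉ R}) {r : Fin nV} (hr : r ∈ R) (h : (G.edgeGraph F).Reachable v r) :
    (Pi.single v 1 : {v // v ∉ R} → ℝ) ∈ Submodule.span ℝ (G.incOff R '' F) := by
  have := offRoots_mem_span (R := R) (single_sub_single_mem_span h)
  rwa [map_sub, offRoots_single_of_mem hr, offRoots_single, sub_zero] at this

lemma sum_inc_mul (e : Fin nE) (φ : Fin nV → ℝ) :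
    ∑ v, G.inc e v * φ v = φ (G.ends e).1 - φ (G.ends e).2 := by
  simp [inc, sub_mul, Finset.sum_sub_distrib, Pi.single_apply]

lemma sum_off_add_sum {M : Type*} [AddCommMonoid M] (R : Finset (Fin nV)) (f : Fin nV → M) :
    ∑ v : {v // v ∉ R}, f v + ∑ r ∈ R, f r = ∑ v, f v := by
  rw [← Finset.sum_subtype Rᶜ (by simp), add_comm, Finset.sum_add_sum_compl]

lemma sum_incOff_mul (R : Finset (Fin nV)) (e : Fin nE) (φ : Fin nV → ℝ) (hφ : ∀ r ∈ R, φ r = 0) :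
    ∑ v, G.incOff R e v * φ v = φ (G.ends e).1 - φ (G.ends e).2 := by
  rw [← sum_inc_mul, ← sum_off_add_sum R,
    Finset.sum_eq_zero (s := R) (fun r hr => by rw [hφ r hr, mul_zero]), add_zero]
  rfl

lemma card_off (R : Finset (Fin nV)) : Fintype.card {v // v ∉ R} + R.card = nV := by
  have h := sum_off_add_sum R (fun _ => 1)
  simpa using h

lemma IsRootedForest.span_eq_top {R : Finset (Fin nV)} {F : Finset (Fin nE)}
    (h : ∀ v, ∃ r ∈ R, (G.edgeGraph F).Reachable v r) :
    Submodule.span ℝ (G.incOff R '' F) = ⊤ := by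
  rw [eq_top_iff, ← (Pi.basisFun ℝ {v // v ∉ R}).span_eq, Submodule.span_le]
  rintro _ ⟨v, rfl⟩
  obtain ⟨r, hr, hvr⟩ := h v
  simpa using single_mem_span_of_reachable_root v hr hvr

lemma reachable_root_of_span_eq_top {R : Finset (Fin nV)} {F : Finset (Fin nE)}
    (h : Submodule.span ℝ (G.incOff R '' F) = ⊤) (v : Fin nV) :
    ∃ r ∈ R, (G.edgeGraph F).Reachable v r := by
  by_contra! hv
  have hvR : v ∉ R := fun hr => hv v hr (SimpleGraph.Reachable.refl _)
  let φ : Fin nV → ℝ := fun w => if (G.edgeGraph F).Reachable v w then 1 else 0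
  have hφ : ∀ r ∈ R, φ r = 0 := fun r hr => by simp [φ, hv r hr]
  let ℓ : ({v // v ∉ R} → ℝ) →ₗ[ℝ] ℝ := ∑ w : {v // v ∉ R}, φ w • LinearMap.proj (R := ℝ) (φ := fun _ => ℝ) w
  have hℓ : ∀ y, ℓ y = ∑ w, y w * φ w := fun y => by simp [ℓ, mul_comm]
  have hle : Submodule.span ℝ (G.incOff R '' F) ≤ LinearMap.ker ℓ := by
    rw [Submodule.span_le]
    rintro _ ⟨e, he, rfl⟩
    rw [SetLike.mem_coe, LinearMap.mem_ker, hℓ, sum_incOff_mul R e φ hφ, sub_eq_zero]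
    have h1 := reachable_ends (G := G) he
    have : (G.edgeGraph F).Reachable v (G.ends e).1 ↔ (G.edgeGraph F).Reachable v (G.ends e).2 :=
      ⟨fun h => h.trans h1, fun h => h.trans h1.symm⟩
    simp [φ, this]
  have h1 : (Pi.single ⟨v, hvR⟩ 1 : {v // v ∉ R} → ℝ) ∈ LinearMap.ker ℓ := hle (h ▸ trivial)
  rw [LinearMap.mem_ker, hℓ] at h1
  rw [Finset.sum_eq_single ⟨v, hvR⟩ (fun w _ hw => by simp [hw]) (by simp)] at h1
  simp [φ] at h1

lemma IsRootedForest.linearIndepOn {R : Finset (Fin nV)} {F : Finset (Fin nE)}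
    (h : G.IsRootedForest R F) : LinearIndepOn ℝ (G.incOff R) (F : Set (Fin nE)) := by
  refine linearIndependent_of_top_le_span_of_card_eq_finrank ?_ ?_
  · rw [← IsRootedForest.span_eq_top h.2, Set.image_eq_range]
  · have := card_off R
    have := h.1
    simp
    omega

lemma isRootedForest_of_linearIndepOn {R : Finset (Fin nV)} {F : Finset (Fin nE)}
    (hF : F.card + R.card = nV) (h : LinearIndepOn ℝ (G.incOff R) (F : Set (Fin nE))) :
    G.IsRootedForest R F := by
  refine ⟨hF, reachable_root_of_span_eq_top ?_⟩
  have := LinearIndependent.span_eq_top_of_card_eq_finrank' h (by have := card_off R; simp; omega)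
  rwa [Set.image_eq_range]

lemma isRootedForest_of_span_eq_top {R : Finset (Fin nV)} {F : Finset (Fin nE)}
    (hF : F.card + R.card = nV) (h : Submodule.span ℝ (G.incOff R '' F) = ⊤) :
    G.IsRootedForest R F :=
  ⟨hF, reachable_root_of_span_eq_top h⟩

lemma IsRootedForest.not_reachable {R : Finset (Fin nV)} {F : Finset (Fin nE)}
    (h : G.IsRootedForest R F) {r r' : Fin nV} (hr : r ∈ R) (hr' : r' ∈ R) (hne : r ≠ r') :
    ¬ (G.edgeGraph F).Reachable r r' := by
  intro hreach
  have h1 := single_sub_single_mem_span hreach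
  rw [Finsupp.mem_span_image_iff_linearCombination] at h1
  obtain ⟨l, hl, hlc⟩ := h1
  have h2 : Finsupp.linearCombination ℝ (G.incOff R) l = 0 := by
    have := congrArg (offRoots R) hlc
    rw [map_sub, offRoots_single_of_mem hr, offRoots_single_of_mem hr', sub_zero,
      Finsupp.apply_linearCombination] at this
    exact this
  have h3 := linearIndepOn_iff.1 h.linearIndepOn l hl h2
  rw [h3, map_zero] at hlc
  have := congrFun hlc r
  simp [hne] at this

lemma IsRootedForest.card_components {R : Finset (Fin nV)} {F : Finset (Fin nE)}
    (h : G.IsRootedForest R F) : Nat.card (G.edgeGraph F).ConnectedComponent = R.card := by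
  have hbij : Function.Bijective
      (fun r : R => (G.edgeGraph F).connectedComponentMk (r : Fin nV)) := by
    constructor
    · rintro ⟨r, hr⟩ ⟨r', hr'⟩ hrr
      by_contra hne
      exact h.not_reachable hr hr' (fun h' => hne (Subtype.ext h'))
        (SimpleGraph.ConnectedComponent.eq.1 hrr)
    · intro C
      induction C using SimpleGraph.ConnectedComponent.ind with
      | h v =>
        obtain ⟨r, hr, hv⟩ := h.2 v
        exact ⟨⟨r, hr⟩, SimpleGraph.ConnectedComponent.eq.2 hv.symm⟩
  rw [← Nat.card_eq_of_bijective _ hbij]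
  simp

lemma isRootedForest_of_not_reachable {R : Finset (Fin nV)} {F : Finset (Fin nE)}
    (hF : F.card + R.card = nV)
    (hcard : Nat.card (G.edgeGraph F).ConnectedComponent = R.card)
    (h : ∀ r ∈ R, ∀ r' ∈ R, r ≠ r' → ¬ (G.edgeGraph F).Reachable r r') :
    G.IsRootedForest R F := by
  refine ⟨hF, fun v => ?_⟩
  let f : R → (G.edgeGraph F).ConnectedComponent :=
    fun r => (G.edgeGraph F).connectedComponentMk (r : Fin nV)
  have hinj : Function.Injective f := by
    rintro ⟨r, hr⟩ ⟨r', hr'⟩ hrr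
    by_contra hne
    exact h r hr r' hr' (fun h' => hne (Subtype.ext h')) (SimpleGraph.ConnectedComponent.eq.1 hrr)
  have hbij : Function.Bijective f :=
    (Nat.bijective_iff_injective_and_card f).2 ⟨hinj, by rw [hcard]; simp⟩
  obtain ⟨⟨r, hr⟩, hv⟩ := hbij.2 ((G.edgeGraph F).connectedComponentMk v)
  exact ⟨r, hr, (SimpleGraph.ConnectedComponent.eq.1 hv).symm⟩

lemma card_singlePart : G.singlePart.card = G.ext.card :=
  Finset.card_image_of_injective _ Finset.singleton_injective

lemma mem_forests_singlePart {F : Finset (Fin nE)} :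
    F ∈ G.forests G.singlePart ↔ G.IsRootedForest G.ext F := by
  simp only [forests, Finset.mem_filter, Finset.mem_univ, true_and, IsForest, card_singlePart]
  constructor
  · rintro ⟨h1, h2, -, h4⟩
    refine isRootedForest_of_not_reachable h1 h2 fun r hr r' hr' hne => ?_
    exact h4 {r} (Finset.mem_image_of_mem _ hr) {r'} (Finset.mem_image_of_mem _ hr')
      (by simpa using hne) r (by simp) r' (by simp)
  · intro h
    refine ⟨h.1, h.card_components, ?_, ?_⟩
    · rintro P hP u hu v hv
      obtain ⟨w, -, rfl⟩ := Finset.mem_image.1 hP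
      rw [Finset.mem_singleton] at hu hv
      rw [hu, hv]
    · rintro P hP Q hQ hne u hu v hv
      obtain ⟨w, hw, rfl⟩ := Finset.mem_image.1 hP
      obtain ⟨w', hw', rfl⟩ := Finset.mem_image.1 hQ
      rw [Finset.mem_singleton] at hu hv
      subst hu hv
      exact h.not_reachable hw hw' (fun h => hne (by rw [h]))

lemma card_pairPart {i j : Fin nV} (hj : j ∈ G.ext) (hij : i ≠ j) :
    (G.pairPart i j).card = (G.ext.erase i).card := by
  have hj' : j ∈ G.ext.erase i := Finset.mem_erase.2 ⟨hij.symm, hj⟩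
  rw [pairPart, Finset.card_insert_of_notMem, Finset.card_image_of_injective _
    Finset.singleton_injective, Finset.card_erase_add_one hj']
  intro h
  obtain ⟨w, -, hw⟩ := Finset.mem_image.1 h
  have hi' : i ∈ ({w} : Finset (Fin nV)) := hw ▸ Finset.mem_insert_self _ _
  have hj' : j ∈ ({w} : Finset (Fin nV)) := hw ▸ (by simp)
  rw [Finset.mem_singleton] at hi' hj'
  exact hij (hi'.trans hj'.symm)

lemma mem_forests_pairPart {F : Finset (Fin nE)} {i j : Fin nV} (hi : i ∈ G.ext)
    (hj : j ∈ G.ext) (hij : i ≠ j) :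
    F ∈ G.forests (G.pairPart i j) ↔
      G.IsRootedForest (G.ext.erase i) F ∧ (G.edgeGraph F).Reachable i j := by
  have hpart : ∀ r ∈ G.ext.erase i, r ≠ j → {r} ∈ G.pairPart i j := fun r hr hrj =>
    Finset.mem_insert_of_mem (Finset.mem_image_of_mem _ (Finset.mem_erase.2 ⟨hrj, hr⟩))
  have hpart' : {i, j} ∈ G.pairPart i j := Finset.mem_insert_self _ _
  have hne' : ∀ r, r ≠ j → ({r} : Finset (Fin nV)) ≠ {i, j} := by
    intro r hrj h
    have : j ∈ ({r} : Finset (Fin nV)) := h ▸ (by simp)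
    exact hrj (Finset.mem_singleton.1 this).symm
  simp only [forests, Finset.mem_filter, Finset.mem_univ, true_and, IsForest,
    card_pairPart hj hij]
  constructor
  · rintro ⟨h1, h2, h3, h4⟩
    refine ⟨isRootedForest_of_not_reachable h1 h2 fun r hr r' hr' hne => ?_,
      h3 _ hpart' i (by simp) j (by simp)⟩
    by_cases hrj : r = j
    · subst hrj
      exact h4 _ hpart' _ (hpart r' hr' hne.symm) (hne' r' hne.symm).symm _ (by simp) _ (by simp)
    by_cases hrj' : r' = j
    · subst hrj'
      exact h4 _ (hpart r hr hne) _ hpart' (hne' r hne) _ (by simp) _ (by simp)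
    exact h4 _ (hpart r hr hrj) _ (hpart r' hr' hrj') (by simpa using hne) _ (by simp) _ (by simp)
  · rintro ⟨h, hreach⟩
    have hjm : j ∈ G.ext.erase i := Finset.mem_erase.2 ⟨hij.symm, hj⟩
    -- every element of a part is connected to a root, and roots of distinct parts are distinct
    have key : ∀ P ∈ G.pairPart i j, ∃ r ∈ G.ext.erase i, r ∈ P ∧
        (∀ u ∈ P, (G.edgeGraph F).Reachable u r) ∧ (r = j → P = {i, j}) ∧ (r ≠ j → P = {r}) := by
      intro P hP
      rcases Finset.mem_insert.1 hP with rfl | hP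
      · refine ⟨j, hjm, by simp, ?_, by simp, by simp⟩
        intro u hu
        rcases Finset.mem_insert.1 hu with rfl | hu
        · exact hreach
        · rw [Finset.mem_singleton.1 hu]
      · obtain ⟨w, hw, rfl⟩ := Finset.mem_image.1 hP
        obtain ⟨hw1, hw2⟩ := Finset.mem_erase.1 hw
        exact ⟨w, hw2, by simp, fun u hu => by rw [Finset.mem_singleton.1 hu],
          fun h => absurd h hw1, fun _ => rfl⟩
    refine ⟨h.1, h.card_components, ?_, ?_⟩
    · intro P hP u hu v hv
      obtain ⟨r, -, -, hr, -⟩ := key P hP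
      exact (hr u hu).trans (hr v hv).symm
    · intro P hP Q hQ hne u hu v hv huv
      obtain ⟨r, hr, -, hrP, h1, h2⟩ := key P hP
      obtain ⟨r', hr', -, hrQ, h1', h2'⟩ := key Q hQ
      refine h.not_reachable hr hr' ?_ ((hrP u hu).symm.trans (huv.trans (hrQ v hv)))
      rintro rfl
      by_cases hrj : r = j
      · exact hne ((h1 hrj).trans (h1' hrj).symm)
      · exact hne ((h2 hrj).trans (h2' hrj).symm)

end FeynmanGraph

lemma integral_threshold {lo hi z : ℝ} (hz : z ∈ Set.Icc lo hi) :
    ∫ τ in Set.Ioc lo hi, (if z < τ then (1 : ℝ) else 0) = hi - z := by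
  have : (fun τ => if z < τ then (1 : ℝ) else 0) = Set.indicator (Set.Ioi z) (fun _ => 1) := by
    ext τ; simp [Set.indicator]
  rw [this, integral_indicator measurableSet_Ioi, Measure.restrict_restrict measurableSet_Ioi]
  have h2 : Set.Ioi z ∩ Set.Ioc lo hi = Set.Ioc z hi := by
    ext τ
    simp only [Set.mem_inter_iff, Set.mem_Ioi, Set.mem_Ioc]
    exact ⟨fun h => ⟨h.1, h.2.2⟩, fun h => ⟨h.1, hz.1.trans_lt h.1, h.2⟩⟩
  rw [h2]
  simp [hz.2]

/-- Layer-cake estimate: a weighted sum of total weight zero is bounded by its threshold sums. -/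
lemma sum_mul_le_of_threshold {ι : Type*} [Fintype ι] {c z : ι → ℝ} {lo hi δ : ℝ} (hle : lo ≤ hi)
    (hz : ∀ k, z k ∈ Set.Icc lo hi) (hc : ∑ k, c k = 0)
    (h : ∀ τ ∈ Set.Ioc lo hi, δ ≤ ∑ k, if z k < τ then c k else 0) :
    ∑ k, c k * z k ≤ -δ * (hi - lo) := by
  have hint : ∀ k, IntegrableOn (fun τ => c k * if z k < τ then (1 : ℝ) else 0)
      (Set.Ioc lo hi) := by
    intro k
    have : (fun τ => c k * if z k < τ then (1 : ℝ) else 0)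
        = Set.indicator (Set.Ioi (z k)) (fun _ => c k) := by
      ext τ; simp [Set.indicator]
    rw [this]
    exact IntegrableOn.indicator (by simp) measurableSet_Ioi
  have h1 : ∑ k, c k * (hi - z k)
      = ∫ τ in Set.Ioc lo hi, ∑ k, c k * if z k < τ then (1 : ℝ) else 0 := by
    rw [integral_finsetSum _ fun k _ => hint k]
    exact Finset.sum_congr rfl fun k _ => by
      rw [integral_const_mul, integral_threshold (hz k)]
  have h2 : δ * (hi - lo) ≤ ∑ k, c k * (hi - z k) := by
    rw [h1]
    have : δ * (hi - lo) = ∫ τ in Set.Ioc lo hi, δ := by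
      simp [hle, mul_comm]
    rw [this]
    refine setIntegral_mono_on (by simp) (integrable_finsetSum _ fun k _ => hint k)
      measurableSet_Ioc fun τ hτ => ?_
    simpa using h τ hτ
  have h3 : ∑ k, c k * (hi - z k) = - ∑ k, c k * z k := by
    simp only [mul_sub, Finset.sum_sub_distrib, ← Finset.sum_mul, hc]
    ring
  linarith

namespace FeynmanGraph
variable {nV nE : ℕ} {G : FeynmanGraph nV nE}

/-- The edges of weight at least `τ`. -/
def upper (a : Fin nE → ℝ) (τ : ℝ) : Finset (Fin nE) := Finset.univ.filter (fun e => τ ≤ a e)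

lemma mem_upper {a : Fin nE → ℝ} {τ : ℝ} {e : Fin nE} : e ∈ upper a τ ↔ τ ≤ a e := by
  simp [upper]

/-- The largest threshold at which a monotone property of edge sets holds. -/
lemma exists_level (a : Fin nE → ℝ) {P : Finset (Fin nE) → Prop}
    (hmono : ∀ H H', H ⊆ H' → P H → P H') (h0 : ¬ P ∅) (h1 : P Finset.univ) :
    ∃ f, ∀ τ, τ ≤ a f ↔ P (upper a τ) := by
  have hne : (Finset.univ : Finset (Fin nE)).Nonempty := by
    rw [Finset.nonempty_iff_ne_empty]
    intro h
    exact h0 (h ▸ h1)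
  obtain ⟨f₀, -, hf₀⟩ := Finset.exists_min_image Finset.univ a hne
  let S := Finset.univ.filter (fun f => P (upper a (a f)))
  have hS : S.Nonempty := ⟨f₀, by
    simp only [S, Finset.mem_filter, Finset.mem_univ, true_and]
    refine hmono _ _ (fun e _ => ?_) h1
    exact mem_upper.2 (hf₀ e (Finset.mem_univ _))⟩
  obtain ⟨f, hfS, hf⟩ := Finset.exists_max_image S a hS
  refine ⟨f, fun τ => ⟨fun hτ => ?_, fun hP => ?_⟩⟩
  · exact hmono _ _ (fun e he => mem_upper.2 (hτ.trans (mem_upper.1 he)))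
      (Finset.mem_filter.1 hfS).2
  · have hne' : (upper a τ).Nonempty := by
      rw [Finset.nonempty_iff_ne_empty]
      intro h
      exact h0 (h ▸ hP)
    obtain ⟨g, hgS, hg⟩ := Finset.exists_min_image _ a hne'
    refine (mem_upper.1 hgS).trans (hf g ?_)
    simp only [S, Finset.mem_filter, Finset.mem_univ, true_and]
    exact hmono _ _ (fun e he => mem_upper.2 (hg e he)) hP

/-- A maximal-weight spanning forest rooted at the external vertices. -/
lemma exists_greedy_forest (a : Fin nE → ℝ)
    (hcomp : ∀ v : Fin nV, ∃ w ∈ G.ext, (G.edgeGraph Finset.univ).Reachable v w) :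
    ∃ T, G.IsRootedForest G.ext T ∧ ∀ τ e, τ ≤ a e →
      G.incOff G.ext e ∈ Submodule.span ℝ
        (G.incOff G.ext '' (T.filter (fun t => τ ≤ a t) : Finset (Fin nE))) := by
  have hcard : ∀ b : Finset (Fin nE), LinearIndepOn ℝ (G.incOff G.ext) (b : Set (Fin nE)) →
      Submodule.span ℝ (G.incOff G.ext '' b) = ⊤ → b.card + G.ext.card = nV := by
    intro b hb hspan
    have := finrank_span_eq_card hb
    rw [← Set.image_eq_range, hspan, finrank_top] at this
    have h2 := card_off G.ext
    simp at this
    omega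
  have hne : (Finset.univ.filter (fun F => G.IsRootedForest G.ext F)).Nonempty := by
    obtain ⟨b, -, -, hb, hli⟩ := exists_linearIndepOn_extension
      (linearIndepOn_empty ℝ (G.incOff G.ext)) (Set.empty_subset Set.univ)
    have hspan : Submodule.span ℝ (G.incOff G.ext '' b) = ⊤ := by
      rw [eq_top_iff, ← IsRootedForest.span_eq_top (G := G) (R := G.ext) hcomp]
      rw [Submodule.span_le]
      simpa using hb
    have hbe : ((b.toFinset : Finset (Fin nE)) : Set (Fin nE)) = b := by simp
    rw [← hbe] at hli hspan
    exact ⟨b.toFinset, by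
      simpa using isRootedForest_of_linearIndepOn (hcard _ hli hspan) hli⟩
  obtain ⟨T, hT, hmax⟩ := Finset.exists_max_image _ (fun F => ∑ e ∈ F, a e) hne
  simp only [Finset.mem_filter, Finset.mem_univ, true_and] at hT hmax
  refine ⟨T, hT, fun τ e he => ?_⟩
  by_contra hnot
  set Tτ := T.filter (fun t => τ ≤ a t) with hTτ
  have heT : e ∉ T := fun heT => hnot (Submodule.subset_span ⟨e, by simp [hTτ, heT, he], rfl⟩)
  have hli : LinearIndepOn ℝ (G.incOff G.ext) (insert e (Tτ : Set (Fin nE))) := by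
    refine (hT.linearIndepOn.mono ?_).insert hnot
    intro t ht
    exact (Finset.mem_filter.1 ht).1
  have hsub : insert e (Tτ : Set (Fin nE)) ⊆ insert e (T : Set (Fin nE)) :=
    Set.insert_subset_insert fun t ht => (Finset.mem_filter.1 ht).1
  obtain ⟨b, hb2, hb1, hb3, hbli⟩ := exists_linearIndepOn_extension hli hsub
  have hspan : Submodule.span ℝ (G.incOff G.ext '' b) = ⊤ := by
    rw [eq_top_iff, ← IsRootedForest.span_eq_top (G := G) (R := G.ext) hT.2, Submodule.span_le]
    exact (Set.image_mono (Set.subset_insert _ _)).trans hb3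
  have hbe : ((b.toFinset : Finset (Fin nE)) : Set (Fin nE)) = b := by simp
  rw [← hbe] at hbli hspan hb1 hb2
  set B := b.toFinset
  have hBc := hcard _ hbli hspan
  have hBF := isRootedForest_of_linearIndepOn hBc hbli
  have heB : e ∈ B := by simpa using hb1 (Set.mem_insert _ _)
  have hBT : B ⊆ insert e T := by
    intro t ht
    simpa using hb2 (by simpa using ht)
  have hTB : Tτ ⊆ B := fun t ht => by
    simpa using hb1 (Set.mem_insert_of_mem _ (by simpa using ht))
  have hcardT := hT.1
  have hc1 : (insert e T \ B).card = 1 := by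
    rw [Finset.card_sdiff_of_subset hBT, Finset.card_insert_of_notMem heT]
    omega
  obtain ⟨t, ht⟩ := Finset.card_eq_one.1 hc1
  have htm : t ∈ insert e T \ B := ht ▸ Finset.mem_singleton_self t
  have htB : t ∉ B := (Finset.mem_sdiff.1 htm).2
  have htT : t ∈ T := by
    rcases Finset.mem_insert.1 (Finset.mem_sdiff.1 htm).1 with rfl | h
    · exact absurd heB htB
    · exact h
  have hat : a t < τ := by
    by_contra! h
    exact htB (hTB (by simp [hTτ, htT, h]))
  have hs1 : ∑ f ∈ insert e T \ B, a f + ∑ f ∈ B, a f = ∑ f ∈ insert e T, a f :=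
    Finset.sum_sdiff hBT
  rw [ht, Finset.sum_singleton, Finset.sum_insert heT] at hs1
  have := hmax B hBF
  linarith

/-- The vertex set of the component of `v` in `(V, H)`. -/
def cell (G : FeynmanGraph nV nE) (H : Finset (Fin nE)) (v : Fin nV) : Finset (Fin nV) :=
  Finset.univ.filter (fun w => (G.edgeGraph H).Reachable v w)

/-- The partition of the vertices into the components of `(V, H)`. -/
def cells (G : FeynmanGraph nV nE) (H : Finset (Fin nE)) : Finset (Finset (Fin nV)) :=
  Finset.univ.image (G.cell H)

/-- The components of `(V, H)` without external vertices. -/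
def intCells (G : FeynmanGraph nV nE) (H : Finset (Fin nE)) : Finset (Finset (Fin nV)) :=
  (G.cells H).filter (fun C => Disjoint C G.ext)

lemma mem_cell {H : Finset (Fin nE)} {v w : Fin nV} :
    w ∈ G.cell H v ↔ (G.edgeGraph H).Reachable v w := by simp [cell]

lemma self_mem_cell (H : Finset (Fin nE)) (v : Fin nV) : v ∈ G.cell H v :=
  mem_cell.2 (SimpleGraph.Reachable.refl _)

lemma cell_mem_cells (H : Finset (Fin nE)) (v : Fin nV) : G.cell H v ∈ G.cells H :=
  Finset.mem_image_of_mem _ (Finset.mem_univ _)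

lemma cell_eq_cell {H : Finset (Fin nE)} {v w : Fin nV} :
    G.cell H v = G.cell H w ↔ (G.edgeGraph H).Reachable v w := by
  constructor
  · intro h
    exact mem_cell.1 (h ▸ self_mem_cell H w)
  · intro h
    ext u
    rw [mem_cell, mem_cell]
    exact ⟨h.symm.trans, h.trans⟩

lemma mem_iff_cell_eq {H : Finset (Fin nE)} {C : Finset (Fin nV)} (hC : C ∈ G.cells H)
    {v : Fin nV} : v ∈ C ↔ G.cell H v = C := by
  obtain ⟨w, -, rfl⟩ := Finset.mem_image.1 hC
  rw [mem_cell, cell_eq_cell, SimpleGraph.reachable_comm]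

lemma sum_cells {M : Type*} [AddCommMonoid M] (H : Finset (Fin nE)) (f : Fin nV → M) :
    ∑ C ∈ G.cells H, ∑ v ∈ C, f v = ∑ v, f v := by
  rw [← Finset.sum_fiberwise_of_maps_to (fun v _ => cell_mem_cells (G := G) H v) f]
  refine Finset.sum_congr rfl fun C hC => Finset.sum_congr ?_ fun _ _ => rfl
  ext v
  simp [mem_iff_cell_eq hC]

lemma sum_intCells_card (H : Finset (Fin nE)) :
    ∑ C ∈ G.intCells H, C.card
      = (Finset.univ.filter (fun v => G.cell H v ∈ G.intCells H)).card := by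
  rw [Finset.card_eq_sum_card_fiberwise (f := G.cell H) (t := G.intCells H)
    (fun v hv => by simpa using hv)]
  refine Finset.sum_congr rfl fun C hC => congrArg _ ?_
  ext v
  rw [mem_iff_cell_eq (Finset.mem_filter.1 hC).1]
  simp only [Finset.mem_filter, Finset.mem_univ, true_and]
  exact ⟨fun h => ⟨h ▸ hC, h⟩, fun h => h.2⟩

lemma sum_edgesWithin {M : Type*} [AddCommMonoid M] (H : Finset (Fin nE))
    {S : Finset (Finset (Fin nV))} (hS : S ⊆ G.cells H) (f : Fin nE → M) :
    ∑ C ∈ S, ∑ e ∈ G.edgesWithin C, f e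
      = ∑ e ∈ Finset.univ.filter (fun e => (G.edgeGraph H).Reachable (G.ends e).1 (G.ends e).2 ∧
          G.cell H (G.ends e).1 ∈ S), f e := by
  rw [← Finset.sum_fiberwise_of_maps_to (g := fun e => G.cell H (G.ends e).1) (t := S)
    (fun e he => (Finset.mem_filter.1 he).2.2) f]
  refine Finset.sum_congr rfl fun C hC => Finset.sum_congr ?_ fun _ _ => rfl
  ext e
  simp only [edgesWithin, Finset.mem_filter, Finset.mem_univ, true_and,
    mem_iff_cell_eq (hS hC), ← cell_eq_cell]
  constructor
  · rintro ⟨h1, h2⟩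
    exact ⟨⟨h1.trans h2.symm, h1 ▸ hC⟩, h1⟩
  · rintro ⟨⟨h1, -⟩, h2⟩
    exact ⟨h2, h1 ▸ h2⟩

end FeynmanGraph

namespace FeynmanGraph
variable {nV nE : ℕ} {G : FeynmanGraph nV nE}

/-- Two distinct external vertices are connected by `H`. -/
def ExtLinked (G : FeynmanGraph nV nE) (H : Finset (Fin nE)) : Prop :=
  ∃ i ∈ G.ext, ∃ j ∈ G.ext, i ≠ j ∧ (G.edgeGraph H).Reachable i j

/-- The vertex `v` is connected by `H` to an external vertex. -/
def ReachesExt (G : FeynmanGraph nV nE) (H : Finset (Fin nE)) (v : Fin nV) : Prop :=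
  ∃ r ∈ G.ext, (G.edgeGraph H).Reachable v r

/-- The ends of `e` are connected by `H`, possibly after identifying the external vertices
if `H` already connects two of them. -/
def Joined (G : FeynmanGraph nV nE) (H : Finset (Fin nE)) (e : Fin nE) : Prop :=
  (G.edgeGraph H).Reachable (G.ends e).1 (G.ends e).2 ∨
    (G.ExtLinked H ∧ G.ReachesExt H (G.ends e).1 ∧ G.ReachesExt H (G.ends e).2)

lemma ExtLinked.mono {H H' : Finset (Fin nE)} (h : H ⊆ H') (hl : G.ExtLinked H) :
    G.ExtLinked H' := by
  obtain ⟨i, hi, j, hj, hne, hr⟩ := hl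
  exact ⟨i, hi, j, hj, hne, reachable_mono h hr⟩

lemma ReachesExt.mono {H H' : Finset (Fin nE)} (h : H ⊆ H') {v : Fin nV}
    (hl : G.ReachesExt H v) : G.ReachesExt H' v := by
  obtain ⟨i, hi, hr⟩ := hl
  exact ⟨i, hi, reachable_mono h hr⟩

lemma Joined.mono {H H' : Finset (Fin nE)} (h : H ⊆ H') {e : Fin nE} (hl : G.Joined H e) :
    G.Joined H' e := by
  rcases hl with hl | ⟨h1, h2, h3⟩
  · exact Or.inl (reachable_mono h hl)
  · exact Or.inr ⟨h1.mono h, h2.mono h, h3.mono h⟩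

lemma eq_of_reachable_empty {u v : Fin nV} (h : (G.edgeGraph ∅).Reachable u v) : u = v :=
  eq_of_reachable (φ := id) (by simp) h

lemma not_extLinked_empty : ¬ G.ExtLinked ∅ := by
  rintro ⟨i, -, j, -, hne, hr⟩
  exact hne (eq_of_reachable_empty hr)

lemma not_joined_empty (e : Fin nE) : ¬ G.Joined ∅ e := by
  rintro (h | ⟨h, -⟩)
  · exact G.ends_ne e (eq_of_reachable_empty h)
  · exact not_extLinked_empty h

lemma joined_of_mem {H : Finset (Fin nE)} {e : Fin nE} (he : e ∈ H) : G.Joined H e :=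
  Or.inl (reachable_ends he)

lemma offRoots_single_mem_span {H : Finset (Fin nE)} {v : Fin nV} (h : G.ReachesExt H v) :
    offRoots G.ext (Pi.single v 1) ∈ Submodule.span ℝ (G.incOff G.ext '' H) := by
  obtain ⟨r, hr, hreach⟩ := h
  by_cases hv : v ∈ G.ext
  · rw [offRoots_single_of_mem hv]
    exact Submodule.zero_mem _
  · have := single_mem_span_of_reachable_root ⟨v, hv⟩ hr hreach
    rwa [← offRoots_single] at this

lemma Joined.incOff_mem_span {H : Finset (Fin nE)} {e : Fin nE} (h : G.Joined H e) :
    G.incOff G.ext e ∈ Submodule.span ℝ (G.incOff G.ext '' H) := by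
  rcases h with h | ⟨-, h1, h2⟩
  · exact offRoots_mem_span (single_sub_single_mem_span h)
  · rw [incOff, inc, map_sub]
    exact Submodule.sub_mem _ (offRoots_single_mem_span h1) (offRoots_single_mem_span h2)

lemma card_le_of_mem_span {ι E : Type*} [AddCommGroup E] [Module ℝ E] {v : ι → E}
    {A B : Finset ι} (hA : LinearIndepOn ℝ v (A : Set ι))
    (h : ∀ i ∈ A, v i ∈ Submodule.span ℝ (v '' B)) : A.card ≤ B.card := by
  have h1 := finrank_span_eq_card hA
  rw [← Set.image_eq_range] at h1
  have h2 : Submodule.span ℝ (v '' A) ≤ Submodule.span ℝ (v '' B) := by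
    rw [Submodule.span_le]
    rintro _ ⟨i, hi, rfl⟩
    exact h i hi
  have hfin : Module.Finite ℝ (Submodule.span ℝ (v '' (B : Set ι))) :=
    Module.Finite.span_of_finite ℝ (B.finite_toSet.image v)
  have h3 := Submodule.finrank_mono h2
  have h4 := finrank_span_finset_le_card (R := ℝ) (B.image v)
  rw [Finset.coe_image] at h4
  have h5 := Finset.card_image_le (f := v) (s := B)
  simp at h1
  unfold Set.finrank at h4
  omega

/-- Greedy exchange: an independent set dominated levelwise by `T`. -/
lemma sum_le_sum_of_card_le {ι : Type*} [Fintype ι] {A B : Finset ι} {f g : ι → ℝ}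
    (hcard : A.card = B.card)
    (h : ∀ τ, (A.filter (fun i => τ ≤ f i)).card ≤ (B.filter (fun i => τ ≤ g i)).card) :
    ∑ i ∈ A, f i ≤ ∑ i ∈ B, g i := by
  obtain ⟨lo, hlo⟩ : ∃ lo : ℝ, ∀ i, lo ≤ f i ∧ lo ≤ g i := by
    obtain ⟨a, ha⟩ := (Set.finite_range f).bddBelow
    obtain ⟨b, hb⟩ := (Set.finite_range g).bddBelow
    exact ⟨min a b, fun i => ⟨(min_le_left _ _).trans (ha ⟨i, rfl⟩),
      (min_le_right _ _).trans (hb ⟨i, rfl⟩)⟩⟩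
  obtain ⟨hi, hhi⟩ : ∃ hi : ℝ, lo ≤ hi ∧ ∀ i, f i ≤ hi ∧ g i ≤ hi := by
    obtain ⟨a, ha⟩ := (Set.finite_range f).bddAbove
    obtain ⟨b, hb⟩ := (Set.finite_range g).bddAbove
    exact ⟨max lo (max a b), le_max_left _ _, fun i =>
      ⟨(ha ⟨i, rfl⟩).trans ((le_max_left _ _).trans (le_max_right _ _)),
      (hb ⟨i, rfl⟩).trans ((le_max_right _ _).trans (le_max_right _ _))⟩⟩
  have key := sum_mul_le_of_threshold (ι := A ⊕ B) (c := Sum.elim (fun _ => 1) (fun _ => -1))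
    (z := Sum.elim (fun i => f i) (fun i => g i)) (δ := 0) hhi.1
    (by rintro (i | i)
        · exact ⟨(hlo i).1, (hhi.2 i).1⟩
        · exact ⟨(hlo i).2, (hhi.2 i).2⟩)
    (by simp [hcard]) (fun τ _ => by
      rw [Fintype.sum_sum_type]
      have e1 : ∑ i : A, (if f i < τ then (1 : ℝ) else 0) = (A.filter (fun i => f i < τ)).card := by
        rw [Finset.sum_coe_sort A (fun i => if f i < τ then (1 : ℝ) else 0)]
        simp
      have e2 : ∑ i : B, (if g i < τ then (-1 : ℝ) else 0)
          = -(B.filter (fun i => g i < τ)).card := by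
        rw [Finset.sum_coe_sort B (fun i => if g i < τ then (-1 : ℝ) else 0)]
        simp [Finset.sum_ite]
      refine le_of_le_of_eq ?_ (congrArg₂ (· + ·) e1 e2).symm
      have h1 := Finset.card_filter_add_card_filter_not (s := A) (fun i => τ ≤ f i)
      have h2 := Finset.card_filter_add_card_filter_not (s := B) (fun i => τ ≤ g i)
      simp only [not_le] at h1 h2
      have h3 := h τ
      have : (B.filter (fun i => g i < τ)).card ≤ (A.filter (fun i => f i < τ)).card := by omega
      have : ((B.filter (fun i => g i < τ)).card : ℝ) ≤ (A.filter (fun i => f i < τ)).card := by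
        exact_mod_cast this
      linarith)
  simp only [Fintype.sum_sum_type, Sum.elim_inl, Sum.elim_inr, one_mul, neg_mul, neg_zero,
    zero_mul, Finset.sum_neg_distrib, Finset.sum_coe_sort A f, Finset.sum_coe_sort B g] at key
  linarith

lemma not_mem_ext_of_mem_intCells {H : Finset (Fin nE)} {v : Fin nV} :
    G.cell H v ∈ G.intCells H ↔ ¬ G.ReachesExt H v := by
  simp only [intCells, Finset.mem_filter, cell_mem_cells, true_and, Finset.disjoint_left,
    mem_cell, ReachesExt, not_exists, not_and]
  exact ⟨fun h r hr hv => h hv hr, fun h r hv hr => h r hr hv⟩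

/-- The light edges of a forest rooted at the external vertices are at most as many as
the components of the heavy edges without external vertices. -/
lemma card_light_le {T H L : Finset (Fin nE)}
    (hspan : ∀ e ∈ H, G.incOff G.ext e ∈ Submodule.span ℝ (G.incOff G.ext '' L))
    (hLT : L ⊆ T) (hT : G.IsRootedForest G.ext T) :
    (T \ L).card ≤ (G.intCells H).card := by
  have hex : ∀ C : {C // C ∈ G.intCells H}, ∃ v : {v // v ∉ G.ext}, G.cell H v = C.1 := by
    rintro ⟨C, hC⟩
    obtain ⟨hC1, hC2⟩ := Finset.mem_filter.1 hC
    obtain ⟨v, -, rfl⟩ := Finset.mem_image.1 hC1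
    exact ⟨⟨v, fun hv => Finset.disjoint_left.1 hC2 (self_mem_cell H v) hv⟩, rfl⟩
  choose rep hrep using hex
  let K : Finset ({v // v ∉ G.ext} → ℝ) :=
    L.image (G.incOff G.ext) ∪ Finset.univ.image (fun C => Pi.single (rep C) (1 : ℝ))
  have hHK : Submodule.span ℝ (G.incOff G.ext '' H) ≤ Submodule.span ℝ (K : Set _) := by
    have h1 : Submodule.span ℝ (G.incOff G.ext '' H)
        ≤ Submodule.span ℝ (G.incOff G.ext '' L) := by
      rw [Submodule.span_le]
      rintro _ ⟨e, he, rfl⟩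
      exact hspan e he
    refine h1.trans (Submodule.span_mono ?_)
    simp [K]
  have htop : Submodule.span ℝ (K : Set ({v // v ∉ G.ext} → ℝ)) = ⊤ := by
    rw [eq_top_iff, ← (Pi.basisFun ℝ {v // v ∉ G.ext}).span_eq, Submodule.span_le]
    rintro _ ⟨v, rfl⟩
    rw [Pi.basisFun_apply, ← offRoots_single v]
    by_cases hv : G.ReachesExt H v
    · exact hHK (offRoots_single_mem_span hv)
    · have hC := not_mem_ext_of_mem_intCells.2 hv
      have hreach : (G.edgeGraph H).Reachable v (rep ⟨_, hC⟩) :=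
        (cell_eq_cell.1 (hrep ⟨_, hC⟩)).symm
      have h1 := hHK (offRoots_mem_span (R := G.ext) (single_sub_single_mem_span hreach))
      rw [map_sub] at h1
      have h2 : offRoots G.ext (Pi.single (rep ⟨_, hC⟩ : Fin nV) 1)
          ∈ Submodule.span ℝ (K : Set ({v // v ∉ G.ext} → ℝ)) := by
        rw [offRoots_single]
        refine Submodule.subset_span ?_
        simp only [K, Finset.coe_union, Finset.coe_image, Finset.coe_univ, Set.image_univ]
        exact Or.inr ⟨_, rfl⟩
      simpa using Submodule.add_mem _ h1 h2
  have h1 : Fintype.card {v // v ∉ G.ext} ≤ K.card := by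
    have := finrank_span_finset_le_card (R := ℝ) K
    unfold Set.finrank at this
    rw [htop, finrank_top] at this
    simpa using this
  have h2 : K.card ≤ L.card + (G.intCells H).card := by
    refine (Finset.card_union_le _ _).trans (Nat.add_le_add Finset.card_image_le ?_)
    refine Finset.card_image_le.trans ?_
    simp
  have h3 := card_off G.ext
  have h4 := hT.1
  rw [Finset.card_sdiff_of_subset hLT]
  omega

end FeynmanGraph

namespace FeynmanGraph
variable {nV nE : ℕ} {G : FeynmanGraph nV nE}

/-- The margin by which power counting converges when the edges outside `H` are scaled to zero. -/
def slack (G : FeynmanGraph nV nE) (d : ℕ) (n : Fin nE → ℕ) (H : Finset (Fin nE)) : ℝ :=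
  ∑ e ∈ Finset.univ.filter (fun e => e ∉ H), ((n e : ℝ) + lam d * G.ν e)
    - ∑ e ∈ Finset.univ.filter (fun e => ¬ G.Joined H e), (n e : ℝ)
    - (d : ℝ) / 2 * (G.intCells H).card - if G.ExtLinked H then 0 else G.Mdeg d

lemma nonempty_of_mem_cells {H : Finset (Fin nE)} {C : Finset (Fin nV)} (hC : C ∈ G.cells H) :
    C.Nonempty := by
  obtain ⟨v, -, rfl⟩ := Finset.mem_image.1 hC
  exact ⟨v, self_mem_cell H v⟩

lemma UVConvergent.excess_nonneg {d : ℕ} (hUV : G.UVConvergent d) {C : Finset (Fin nV)}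
    (hC : C.Nonempty) (hext : (C ∩ G.ext).card ≤ 1) :
    0 ≤ (d : ℝ) / 2 * ((C.card : ℝ) - 1) - lam d * ∑ e ∈ G.edgesWithin C, G.ν e := by
  rcases Nat.lt_or_ge C.card 2 with h | h
  · have h1 : C.card = 1 := by have := hC.card_pos; omega
    obtain ⟨v, rfl⟩ := Finset.card_eq_one.1 h1
    have : G.edgesWithin {v} = ∅ := by
      ext e
      simp only [edgesWithin, Finset.mem_filter, Finset.mem_univ, true_and,
        Finset.mem_singleton, Finset.notMem_empty, iff_false]
      rintro ⟨h1, h2⟩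
      exact G.ends_ne e (h1.trans h2.symm)
    simp [this]
  · exact (sub_pos.2 (hUV C h hext)).le

lemma slack_split {d : ℕ} {n : Fin nE → ℕ} {H : Finset (Fin nE)} :
    ∑ e ∈ Finset.univ.filter (fun e => e ∉ H), ((n e : ℝ) + lam d * G.ν e)
    - ∑ e ∈ Finset.univ.filter (fun e => ¬ G.Joined H e), (n e : ℝ)
    = ∑ e ∈ Finset.univ.filter (fun e => e ∉ H ∧ G.Joined H e), ((n e : ℝ) + lam d * G.ν e)
      + lam d * ∑ e ∈ Finset.univ.filter (fun e => ¬ G.Joined H e), G.ν e := by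
  have h1 := Finset.sum_filter_add_sum_filter_not
    (Finset.univ.filter (fun e => e ∉ H)) (fun e => G.Joined H e)
    (fun e => (n e : ℝ) + lam d * G.ν e)
  rw [Finset.filter_filter, Finset.filter_filter] at h1
  have h2 : Finset.univ.filter (fun e => e ∉ H ∧ ¬ G.Joined H e)
      = Finset.univ.filter (fun e => ¬ G.Joined H e) := by
    ext e
    simp only [Finset.mem_filter, Finset.mem_univ, true_and, and_iff_right_iff_imp]
    exact fun h he => h (joined_of_mem he)
  rw [h2] at h1
  rw [← h1, Finset.sum_add_distrib (s := Finset.univ.filter (fun e => ¬ G.Joined H e)),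
    ← Finset.mul_sum]
  ring

lemma joined_of_no_intCells {H : Finset (Fin nE)} (hl : G.ExtLinked H)
    (h : G.intCells H = ∅) (e : Fin nE) : G.Joined H e := by
  have : ∀ v, G.ReachesExt H v := fun v => by
    by_contra hv
    have := not_mem_ext_of_mem_intCells.2 hv
    simp [h] at this
  exact Or.inr ⟨hl, this _, this _⟩

lemma slack_pos_of_linked {d : ℕ} {n : Fin nE → ℕ} (hUV : G.UVConvergent d)
    (hIR : G.IRConvergent d) (hn : ∀ e, 0 < (n e : ℝ) + lam d * G.ν e)
    {H : Finset (Fin nE)} (hl : G.ExtLinked H) (hH : H ≠ Finset.univ) :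
    0 < G.slack d n H := by
  rw [slack, slack_split, if_pos hl, sub_zero]
  have hnonneg : ∀ S : Finset (Fin nE), 0 ≤ ∑ e ∈ S, ((n e : ℝ) + lam d * G.ν e) :=
    fun S => Finset.sum_nonneg fun e _ => (hn e).le
  rcases (G.intCells H).eq_empty_or_nonempty with h0 | h0
  · have hj := joined_of_no_intCells hl h0
    simp only [hj, not_true_eq_false, Finset.filter_false, Finset.sum_empty, mul_zero, h0,
      Finset.card_empty, Nat.cast_zero, sub_zero, and_true, add_zero]
    refine Finset.sum_pos (fun e _ => hn e) ?_
    by_contra hne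
    rw [Finset.not_nonempty_iff_eq_empty, Finset.filter_eq_empty_iff] at hne
    exact hH (Finset.eq_univ_iff_forall.2 fun e => by simpa using hne (Finset.mem_univ e))
  · set W := Finset.univ.filter (fun v => G.cell H v ∈ G.intCells H) with hW
    have hWmem : ∀ v, v ∈ W ↔ ¬ G.ReachesExt H v := fun v => by
      simp [hW, not_mem_ext_of_mem_intCells]
    have hWne : W.Nonempty := by
      obtain ⟨C, hC⟩ := h0
      obtain ⟨v, -, rfl⟩ := Finset.mem_image.1 (Finset.mem_filter.1 hC).1
      exact ⟨v, by simp [hW, hC]⟩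
    set Eg := Finset.univ.filter (fun e => (G.ends e).1 ∈ W ∨ (G.ends e).2 ∈ W) with hEg
    have hWext : ∀ v ∈ W, v ∉ G.ext := fun v hv hext =>
      (hWmem v).1 hv ⟨v, hext, SimpleGraph.Reachable.refl _⟩
    have hWint : ∀ v ∈ W, G.GInternal Finset.univ Eg v := fun v hv => by
      refine ⟨hWext v hv, Finset.mem_univ _, fun e he => ?_⟩
      simp only [hEg, Finset.mem_filter, Finset.mem_univ, true_and]
      rcases he with rfl | rfl
      · exact Or.inl hv
      · exact Or.inr hv
    have hsub : W ⊆ G.gInternalSet Finset.univ Eg := fun v hv => by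
      simpa [gInternalSet] using hWint v hv
    have hcardle : (W.card : ℝ) ≤ (G.gInternalSet Finset.univ Eg).card := by
      exact_mod_cast Finset.card_le_card hsub
    have hir := hIR Finset.univ Eg (fun e _ => by simp)
      (hWne.card_pos.trans_le (Finset.card_le_card hsub)) (fun e he => by
        simp only [hEg, Finset.mem_filter, Finset.mem_univ, true_and] at he
        exact he.imp (hWint _) (hWint _))
    have hsplit : ∑ e ∈ Eg, G.ν e
        = ∑ e ∈ Finset.univ.filter (fun e => ¬ G.Joined H e), G.ν e
          + ∑ C ∈ G.intCells H, ∑ e ∈ G.edgesWithin C, G.ν e := by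
      rw [sum_edgesWithin H (S := G.intCells H) (Finset.filter_subset _ _) G.ν,
        ← Finset.sum_filter_add_sum_filter_not Eg (fun e => ¬ G.Joined H e)]
      congr 1
      · refine Finset.sum_congr ?_ fun _ _ => rfl
        ext e
        simp only [hEg, Finset.mem_filter, Finset.mem_univ, true_and, and_iff_right_iff_imp]
        intro h
        by_contra! hc
        rw [hWmem, hWmem, not_not, not_not] at hc
        exact h (Or.inr ⟨hl, hc⟩)
      · refine Finset.sum_congr ?_ fun _ _ => rfl
        ext e
        simp only [hEg, Finset.mem_filter, Finset.mem_univ, true_and, not_not,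
          not_mem_ext_of_mem_intCells, hWmem]
        constructor
        · rintro ⟨h1, h2 | ⟨-, h2, h3⟩⟩
          · refine ⟨h2, ?_⟩
            rcases h1 with h1 | h1
            · exact h1
            · rintro ⟨r, hr, hr'⟩
              exact h1 ⟨r, hr, h2.symm.trans hr'⟩
          · rcases h1 with h1 | h1
            · exact absurd h2 h1
            · exact absurd h3 h1
        · rintro ⟨h1, h2⟩
          exact ⟨Or.inl h2, Or.inl h1⟩
    have huv : 0 ≤ ∑ C ∈ G.intCells H,
        ((d : ℝ) / 2 * ((C.card : ℝ) - 1) - lam d * ∑ e ∈ G.edgesWithin C, G.ν e) := by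
      refine Finset.sum_nonneg fun C hC => ?_
      obtain ⟨hC1, hC2⟩ := Finset.mem_filter.1 hC
      refine hUV.excess_nonneg (nonempty_of_mem_cells hC1) ?_
      rw [Finset.disjoint_iff_inter_eq_empty.1 hC2]
      simp
    have hcardW : ∑ C ∈ G.intCells H, (C.card : ℝ) = W.card := by
      exact_mod_cast sum_intCells_card (G := G) H
    rw [Finset.sum_sub_distrib, ← Finset.mul_sum, ← Finset.mul_sum, Finset.sum_sub_distrib,
      hcardW] at huv
    simp only [Finset.sum_const, nsmul_eq_mul, mul_one] at huv
    rw [hsplit] at hir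
    have h3 := hnonneg (Finset.univ.filter (fun e => e ∉ H ∧ G.Joined H e))
    have h4 : (d : ℝ) / 2 * W.card ≤ (d : ℝ) / 2 * (G.gInternalSet Finset.univ Eg).card :=
      mul_le_mul_of_nonneg_left hcardle (by positivity)
    linarith

lemma card_cells_of_not_linked {H : Finset (Fin nE)} (hl : ¬ G.ExtLinked H) :
    (G.cells H).card = (G.intCells H).card + G.ext.card := by
  have h1 := Finset.card_filter_add_card_filter_not (s := G.cells H) (fun C => Disjoint C G.ext)
  rw [← h1]
  congr 1
  have : (G.cells H).filter (fun C => ¬ Disjoint C G.ext) = G.ext.image (G.cell H) := by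
    ext C
    simp only [Finset.mem_filter, Finset.mem_image, Finset.not_disjoint_iff]
    constructor
    · rintro ⟨hC, v, hv, hve⟩
      exact ⟨v, hve, (mem_iff_cell_eq hC).1 hv⟩
    · rintro ⟨v, hve, rfl⟩
      exact ⟨cell_mem_cells _ _, v, self_mem_cell _ _, hve⟩
  rw [this, Finset.card_image_of_injOn]
  intro i hi j hj hij
  by_contra hne
  exact hl ⟨i, hi, j, hj, hne, cell_eq_cell.1 hij⟩

lemma slack_pos_of_not_linked {d : ℕ} {n : Fin nE → ℕ} (hUV : G.UVConvergent d)
    (hn : ∀ e, 0 < (n e : ℝ) + lam d * G.ν e)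
    {H : Finset (Fin nE)} (hl : ¬ G.ExtLinked H) (hH : H.Nonempty) :
    0 < G.slack d n H := by
  rw [slack, slack_split, if_neg hl]
  have hnonneg : 0 ≤ ∑ e ∈ Finset.univ.filter (fun e => e ∉ H ∧ G.Joined H e),
      ((n e : ℝ) + lam d * G.ν e) := Finset.sum_nonneg fun e _ => (hn e).le
  have hextle : ∀ C ∈ G.cells H, (C ∩ G.ext).card ≤ 1 := by
    intro C hC
    rw [Finset.card_le_one]
    intro i hi j hj
    simp only [Finset.mem_inter, mem_iff_cell_eq hC] at hi hj
    by_contra hne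
    exact hl ⟨i, hi.2, j, hj.2, hne, cell_eq_cell.1 (hi.1.trans hj.1.symm)⟩
  have huv : 0 < ∑ C ∈ G.cells H,
      ((d : ℝ) / 2 * ((C.card : ℝ) - 1) - lam d * ∑ e ∈ G.edgesWithin C, G.ν e) := by
    obtain ⟨e, he⟩ := hH
    refine Finset.sum_pos' (fun C hC => hUV.excess_nonneg (nonempty_of_mem_cells hC) (hextle C hC))
      ⟨_, cell_mem_cells H (G.ends e).1, sub_pos.2 (hUV _ ?_ (hextle _ (cell_mem_cells _ _)))⟩
    rw [← Finset.card_pair (G.ends_ne e)]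
    refine Finset.card_le_card ?_
    intro v hv
    rw [mem_cell]
    rcases Finset.mem_insert.1 hv with rfl | hv
    · exact SimpleGraph.Reachable.refl _
    · rw [Finset.mem_singleton.1 hv]
      exact reachable_ends he
  have hcard : ∑ C ∈ G.cells H, (C.card : ℝ) = nV := by
    have := sum_cells (G := G) H (fun _ => (1 : ℝ))
    simpa using this
  rw [Finset.sum_sub_distrib, ← Finset.mul_sum, ← Finset.mul_sum, Finset.sum_sub_distrib,
      hcard, sum_edgesWithin H subset_rfl G.ν] at huv
  simp only [Finset.sum_const, nsmul_eq_mul, mul_one, card_cells_of_not_linked hl,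
    cell_mem_cells, and_true] at huv
  have hj : ∀ e, G.Joined H e ↔ (G.edgeGraph H).Reachable (G.ends e).1 (G.ends e).2 :=
    fun e => ⟨fun h => h.resolve_right fun h' => hl h'.1, Or.inl⟩
  simp only [← hj] at huv
  have hs := Finset.sum_filter_add_sum_filter_not Finset.univ (fun e => G.Joined H e) G.ν
  have hint : (G.intVerts.card : ℝ) = nV - G.ext.card := by
    have h1 := card_off G.ext
    have h2 : G.intVerts.card = Fintype.card {v // v ∉ G.ext} := by
      rw [Fintype.card_subtype]; rfl
    rw [h2, eq_sub_iff_add_eq]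
    exact_mod_cast h1
  rw [Mdeg, ← hs, hint]
  push_cast at huv
  linarith

lemma slack_pos {d : ℕ} {n : Fin nE → ℕ} (hUV : G.UVConvergent d)
    (hIR : G.IRConvergent d) (hn : ∀ e, 0 < (n e : ℝ) + lam d * G.ν e)
    {H : Finset (Fin nE)} (hH : H.Nonempty) (hH' : H ≠ Finset.univ) :
    0 < G.slack d n H := by
  by_cases hl : G.ExtLinked H
  · exact slack_pos_of_linked hUV hIR hn hl hH'
  · exact slack_pos_of_not_linked hUV hn hl hH

end FeynmanGraph

namespace FeynmanGraph
variable {nV nE : ℕ} {G : FeynmanGraph nV nE}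

/-- In a forest connecting the external vertices `i` and `j`, some edge on the path between
them is not heavier than the level `astar` at which external vertices get connected. -/
lemma exists_removable_edge {a b : Fin nE → ℝ} {astar : ℝ}
    (hb : ∀ e τ, τ ≤ b e ↔ G.Joined (upper a τ) e)
    (hstar : ∀ τ, τ ≤ astar ↔ G.ExtLinked (upper a τ))
    {i j : Fin nV} (hi : i ∈ G.ext) (hj : j ∈ G.ext) (hij : i ≠ j) {F : Finset (Fin nE)}
    (hF : G.IsRootedForest (G.ext.erase i) F) (hreach : (G.edgeGraph F).Reachable i j) :
    ∃ f ∈ F, b f ≤ astar ∧ G.IsRootedForest G.ext (F.erase f) := by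
  obtain ⟨x, hx⟩ : ∃ x : Fin nE → ℝ, (Pi.single i 1 - Pi.single j 1 : Fin nV → ℝ)
      = ∑ e ∈ F, x e • G.inc e := by
    have := single_sub_single_mem_span hreach
    rw [Submodule.mem_span_image_finset_iff_exists_fun] at this
    obtain ⟨x, hx⟩ := this
    refine ⟨fun e => if h : e ∈ F then x ⟨e, h⟩ else 0, ?_⟩
    rw [← hx, ← Finset.sum_coe_sort F]
    exact Finset.sum_congr rfl fun e _ => by simp
  have hpair : ∀ φ : Fin nV → ℝ,
      φ i - φ j = ∑ e ∈ F, x e * (φ (G.ends e).1 - φ (G.ends e).2) := by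
    intro φ
    have h1 : ∑ v, (Pi.single i 1 - Pi.single j 1 : Fin nV → ℝ) v * φ v = φ i - φ j := by
      simp [sub_mul, Finset.sum_sub_distrib, Pi.single_apply]
    rw [← h1, hx]
    simp only [Finset.sum_apply, Pi.smul_apply, smul_eq_mul, Finset.sum_mul]
    rw [Finset.sum_comm]
    refine Finset.sum_congr rfl fun e _ => ?_
    rw [← sum_inc_mul, Finset.mul_sum]
    exact Finset.sum_congr rfl fun v _ => by ring
  obtain ⟨f, hfF, hxf, hbf⟩ : ∃ f ∈ F, x f ≠ 0 ∧ b f ≤ astar := by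
    by_contra! hall
    have hne : (F.filter (fun e => x e ≠ 0)).Nonempty := by
      by_contra hempty
      rw [Finset.not_nonempty_iff_eq_empty, Finset.filter_eq_empty_iff] at hempty
      have h1 := hpair (Pi.single i 1)
      rw [Finset.sum_eq_zero fun e he => by
        rw [not_not.1 (hempty he), zero_mul]] at h1
      simp [hij.symm] at h1
    obtain ⟨g, hg, hgmin⟩ := Finset.exists_min_image _ b hne
    rw [Finset.mem_filter] at hg
    have hnl : ¬ G.ExtLinked (upper a (b g)) := by
      rw [← hstar, not_le]
      exact hall g hg.1 hg.2
    have hjr : ∀ e ∈ F, x e ≠ 0 →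
        (G.edgeGraph (upper a (b g))).Reachable (G.ends e).1 (G.ends e).2 := fun e he hxe =>
      ((hb e _).1 (hgmin e (Finset.mem_filter.2 ⟨he, hxe⟩))).resolve_right fun h => hnl h.1
    have h1 := hpair (fun v => if G.cell (upper a (b g)) v = G.cell (upper a (b g)) i
      then 1 else 0)
    rw [Finset.sum_eq_zero] at h1
    · have h2 : G.cell (upper a (b g)) j = G.cell (upper a (b g)) i := by
        by_contra h
        simp [h] at h1
      exact hnl ⟨i, hi, j, hj, hij, (cell_eq_cell.1 h2).symm⟩
    · intro e he
      by_cases hxe : x e = 0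
      · rw [hxe, zero_mul]
      · rw [cell_eq_cell.2 (hjr e he hxe), sub_self, mul_zero]
  refine ⟨f, hfF, hbf, isRootedForest_of_span_eq_top ?_ ?_⟩
  · have h1 := hF.1
    rw [Finset.card_erase_of_mem hi] at h1
    rw [Finset.card_erase_of_mem hfF]
    have := Finset.card_pos.2 ⟨_, hi⟩
    have := Finset.card_pos.2 ⟨_, hfF⟩
    omega
  · have htop : Submodule.span ℝ (G.incOff G.ext '' F) = ⊤ :=
      IsRootedForest.span_eq_top fun v => by
        obtain ⟨r, hr, h⟩ := hF.2 v
        exact ⟨r, Finset.mem_of_mem_erase hr, h⟩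
    rw [eq_top_iff, ← htop, Submodule.span_le]
    rintro _ ⟨e, he, rfl⟩
    by_cases hef : e = f
    · subst hef
      have h0 := congrArg (offRoots G.ext) hx
      rw [map_sub, offRoots_single_of_mem hi, offRoots_single_of_mem hj, sub_zero, map_sum,
        ← Finset.add_sum_erase _ _ hfF, map_smul] at h0
      have h1 : G.incOff G.ext e
          = (x e)⁻¹ • -(∑ g ∈ F.erase e, offRoots G.ext (x g • G.inc g)) := by
        rw [← eq_neg_of_add_eq_zero_left h0.symm, smul_smul, inv_mul_cancel₀ hxf, one_smul]
        rfl
      rw [h1]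
      refine Submodule.smul_mem _ _ (Submodule.neg_mem _ (Submodule.sum_mem _ fun g hg => ?_))
      rw [map_smul]
      exact Submodule.smul_mem _ _ (Submodule.subset_span ⟨g, Finset.mem_coe.2 hg, rfl⟩)
    · exact Submodule.subset_span ⟨e, by simpa [hef] using he, rfl⟩

/-- Extending a forest rooted at the external vertices by a heavy edge that connects two roots. -/
lemma exists_pair_forest {T H : Finset (Fin nE)} (hT : G.IsRootedForest G.ext T)
    (hl : G.ExtLinked H) :
    ∃ f ∈ H, f ∉ T ∧ ∃ i ∈ G.ext, ∃ j ∈ G.ext, i < j ∧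
      insert f T ∈ G.forests (G.pairPart i j) := by
  choose ρ hρ hρr using hT.2
  have hρeq : ∀ {u v}, (G.edgeGraph T).Reachable u v → ρ u = ρ v := fun {u v} h => by
    by_contra hne
    exact hT.not_reachable (hρ u) (hρ v) hne ((hρr u).symm.trans (h.trans (hρr v)))
  have hρext : ∀ r ∈ G.ext, ρ r = r := fun r hr => by
    by_contra hne
    exact hT.not_reachable (hρ r) hr hne (hρr r).symm
  obtain ⟨i₀, hi₀, j₀, hj₀, hne, hreach⟩ := hl
  obtain ⟨f, hfH, hf⟩ : ∃ f ∈ H, ρ (G.ends f).1 ≠ ρ (G.ends f).2 := by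
    by_contra! h
    have := eq_of_reachable h hreach
    rw [hρext _ hi₀, hρext _ hj₀] at this
    exact hne this
  have hfT : f ∉ T := fun h => hf (hρeq (reachable_ends h))
  refine ⟨f, hfH, hfT, ?_⟩
  have hsub : T ⊆ insert f T := Finset.subset_insert _ _
  have key : ∀ i j, i ∈ G.ext → j ∈ G.ext → i ≠ j →
      (G.edgeGraph (insert f T)).Reachable i j →
      insert f T ∈ G.forests (G.pairPart i j) := by
    intro i j hi hj hij hr
    rw [mem_forests_pairPart hi hj hij]
    refine ⟨⟨?_, fun v => ?_⟩, hr⟩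
    · rw [Finset.card_insert_of_notMem hfT, Finset.card_erase_of_mem hi]
      have := hT.1
      have := Finset.card_pos.2 ⟨_, hi⟩
      omega
    · by_cases hv : ρ v = i
      · exact ⟨j, Finset.mem_erase.2 ⟨hij.symm, hj⟩,
          (hv ▸ reachable_mono hsub (hρr v)).trans hr⟩
      · exact ⟨ρ v, Finset.mem_erase.2 ⟨hv, hρ v⟩, reachable_mono hsub (hρr v)⟩
  have hr : (G.edgeGraph (insert f T)).Reachable (ρ (G.ends f).1) (ρ (G.ends f).2) :=
    (reachable_mono hsub (hρr _)).symm.trans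
      ((reachable_ends (Finset.mem_insert_self _ _)).trans (reachable_mono hsub (hρr _)))
  rcases lt_or_gt_of_ne hf with h | h
  · exact ⟨_, hρ _, _, hρ _, h, key _ _ (hρ _) (hρ _) hf hr⟩
  · exact ⟨_, hρ _, _, hρ _, h, key _ _ (hρ _) (hρ _) hf.symm hr.symm⟩

lemma exists_slack_bound {d : ℕ} {n : Fin nE → ℕ} (hUV : G.UVConvergent d)
    (hIR : G.IRConvergent d) (hn : ∀ e, 0 < (n e : ℝ) + lam d * G.ν e) :
    ∃ δ > 0, ∀ H : Finset (Fin nE), H.Nonempty → H ≠ Finset.univ → δ ≤ G.slack d n H := by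
  let P := Finset.univ.filter (fun H : Finset (Fin nE) => H.Nonempty ∧ H ≠ Finset.univ)
  rcases P.eq_empty_or_nonempty with h | h
  · refine ⟨1, one_pos, fun H h1 h2 => ?_⟩
    have : H ∈ P := by simp [P, h1, h2]
    simp [h] at this
  · obtain ⟨H₀, hH₀, hmin⟩ := Finset.exists_min_image P (G.slack d n) h
    simp only [P, Finset.mem_filter, Finset.mem_univ, true_and] at hH₀ hmin
    exact ⟨_, slack_pos hUV hIR hn hH₀.1 hH₀.2, fun H h1 h2 => hmin H ⟨h1, h2⟩⟩

/-- Tropical power counting: the exponents of the leading monomials of the forest polynomials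
in the sector described by the logarithms `a` of the Schwinger parameters. -/
theorem exists_tropical_bound {d : ℕ} {n : Fin nE → ℕ} (hUV : G.UVConvergent d)
    (hIR : G.IRConvergent d) (hn : ∀ e, 0 < (n e : ℝ) + lam d * G.ν e)
    (hcomp : ∀ v : Fin nV, ∃ w ∈ G.ext, (G.edgeGraph Finset.univ).Reachable v w)
    (hconn : G.ExtLinked Finset.univ) :
    ∃ δ > 0, ∀ a : Fin nE → ℝ, ∃ (T : Finset (Fin nE)) (astar : ℝ) (b : Fin nE → ℝ),
      (∀ e, a e ≤ b e) ∧ T ∈ G.forests G.singlePart ∧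
      (∀ F ∈ G.forests G.singlePart, ∑ e ∈ F, b e ≤ ∑ e ∈ T, a e) ∧
      (∀ i ∈ G.ext, ∀ j ∈ G.ext, i < j → ∀ F ∈ G.forests (G.pairPart i j),
        ∑ e ∈ F, b e ≤ ∑ e ∈ T, a e + astar) ∧
      (∃ i ∈ G.ext, ∃ j ∈ G.ext, i < j ∧ ∃ F ∈ G.forests (G.pairPart i j),
        ∑ e ∈ T, a e + astar ≤ ∑ e ∈ F, a e) ∧
      ∀ e₁ e₂, ∑ e, ((n e : ℝ) + lam d * G.ν e) * a e - (d : ℝ) / 2 * ∑ e ∈ T, a e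
        - G.Mdeg d * astar - ∑ e, (n e : ℝ) * b e ≤ -δ * (a e₁ - a e₂) := by
  obtain ⟨δ, hδ, hslack⟩ := exists_slack_bound hUV hIR hn
  refine ⟨δ, hδ, fun a => ?_⟩
  obtain ⟨T, hT, hgreedy⟩ := exists_greedy_forest a hcomp
  obtain ⟨fs, hstar⟩ := exists_level a (P := G.ExtLinked) (fun H H' h => ExtLinked.mono h)
    not_extLinked_empty hconn
  have hex : ∀ e, ∃ f, ∀ τ, τ ≤ a f ↔ G.Joined (upper a τ) e := fun e =>
    exists_level a (P := fun H => G.Joined H e) (fun H H' h => Joined.mono h)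
      (not_joined_empty e) (joined_of_mem (Finset.mem_univ e))
  choose g hg using hex
  have hT1 : ∀ F, G.IsRootedForest G.ext F → ∑ e ∈ F, a (g e) ≤ ∑ e ∈ T, a e := by
    intro F hF
    refine sum_le_sum_of_card_le (by have := hF.1; have := hT.1; omega) fun τ => ?_
    refine card_le_of_mem_span (v := G.incOff G.ext)
      (hF.linearIndepOn.mono fun e he => (Finset.mem_filter.1 he).1) fun e he => ?_
    have h1 := ((hg e τ).1 (Finset.mem_filter.1 he).2).incOff_mem_span
    refine (Submodule.span_le.2 ?_) h1
    rintro _ ⟨t, ht, rfl⟩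
    exact hgreedy τ t (mem_upper.1 ht)
  refine ⟨T, a fs, fun e => a (g e), fun e => (hg e _).2 (joined_of_mem (mem_upper.2 le_rfl)),
    mem_forests_singlePart.2 hT, fun F hF => hT1 F (mem_forests_singlePart.1 hF), ?_, ?_, ?_⟩
  · intro i hi j hj hij F hF
    obtain ⟨hF1, hF2⟩ := (mem_forests_pairPart hi hj hij.ne).1 hF
    obtain ⟨f, hfF, hfb, hf⟩ :=
      exists_removable_edge (b := fun e => a (g e)) hg hstar hi hj hij.ne hF1 hF2
    have := hT1 _ hf
    rw [← Finset.add_sum_erase _ _ hfF]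
    linarith
  · obtain ⟨f, hfH, hfT, i, hi, j, hj, hij, hF⟩ :=
      exists_pair_forest hT ((hstar (a fs)).1 le_rfl)
    refine ⟨i, hi, j, hj, hij, _, hF, ?_⟩
    rw [Finset.sum_insert hfT, add_comm]
    have := mem_upper.1 hfH
    linarith
  · intro e₁ e₂
    have hne : (Finset.univ : Finset (Fin nE)).Nonempty := ⟨e₁, Finset.mem_univ _⟩
    obtain ⟨emax, -, hmax⟩ := Finset.exists_max_image _ a hne
    obtain ⟨emin, -, hmin⟩ := Finset.exists_min_image _ a hne
    have hz : ∀ e, a e ∈ Set.Icc (a emin) (a emax) := fun e =>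
      ⟨hmin e (Finset.mem_univ _), hmax e (Finset.mem_univ _)⟩
    have key := sum_mul_le_of_threshold (ι := (Fin nE ⊕ T) ⊕ (Unit ⊕ Fin nE))
      (c := Sum.elim (Sum.elim (fun e => (n e : ℝ) + lam d * G.ν e) (fun _ => -((d : ℝ) / 2)))
        (Sum.elim (fun _ => -G.Mdeg d) (fun e => -(n e : ℝ))))
      (z := Sum.elim (Sum.elim a (fun t => a t)) (Sum.elim (fun _ => a fs) (fun e => a (g e))))
      (δ := δ) (hmin emax (Finset.mem_univ _))
      (by rintro ((e | e) | (e | e)) <;> exact hz _)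
      (by
        simp only [Fintype.sum_sum_type, Sum.elim_inl, Sum.elim_inr]
        have h1 := card_off G.ext
        have h2 : G.intVerts.card = Fintype.card {v // v ∉ G.ext} := by
          rw [Fintype.card_subtype]; rfl
        have h3 : (T.card : ℝ) = G.intVerts.card := by
          have := hT.1
          exact_mod_cast (by omega : T.card = G.intVerts.card)
        simp [Finset.sum_add_distrib, Mdeg, h3, ← Finset.mul_sum]
        ring)
      (fun τ hτ => by
        set H := upper a τ with hH
        have hHne : H.Nonempty := ⟨emax, mem_upper.2 hτ.2⟩
        have hHu : H ≠ Finset.univ := fun h => by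
          have : emin ∈ H := h ▸ Finset.mem_univ _
          exact absurd (mem_upper.1 this) (not_le.2 hτ.1)
        refine (hslack H hHne hHu).trans ?_
        rw [Fintype.sum_sum_type, Fintype.sum_sum_type, Fintype.sum_sum_type]
        have e1 : ∑ e : Fin nE, (if a e < τ then (n e : ℝ) + lam d * G.ν e else 0)
            = ∑ e ∈ Finset.univ.filter (fun e => e ∉ H), ((n e : ℝ) + lam d * G.ν e) := by
          rw [Finset.sum_filter]
          simp [hH, mem_upper]
        have e2 : ∑ t : T, (if a t < τ then -((d : ℝ) / 2) else 0)
            = -((d : ℝ) / 2) * (T.filter (fun t => a t < τ)).card := by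
          rw [Finset.sum_coe_sort T (fun t => if a t < τ then -((d : ℝ) / 2) else 0)]
          simp [Finset.sum_ite]
          ring
        have e3 : ∑ t : Unit, (if a fs < τ then -G.Mdeg d else 0)
            = - if G.ExtLinked H then 0 else G.Mdeg d := by
          simp only [Finset.univ_unique, Finset.sum_const, Finset.card_singleton, one_smul,
            ← not_le, hstar, ← hH]
          split_ifs <;> simp_all
        have e4 : ∑ e : Fin nE, (if a (g e) < τ then -(n e : ℝ) else 0)
            = - ∑ e ∈ Finset.univ.filter (fun e => ¬ G.Joined H e), (n e : ℝ) := by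
          rw [Finset.sum_filter, ← Finset.sum_neg_distrib]
          refine Finset.sum_congr rfl fun e _ => ?_
          simp only [← not_le, hg, ← hH]
          split_ifs <;> simp_all
        refine le_of_le_of_eq ?_
          (congrArg₂ (· + ·) (congrArg₂ (· + ·) e1 e2) (congrArg₂ (· + ·) e3 e4)).symm
        have hcl := card_light_le (H := H) (L := T.filter (fun t => τ ≤ a t))
          (fun e he => hgreedy τ e (mem_upper.1 he)) (Finset.filter_subset _ _) hT
        have hsd : T \ T.filter (fun t => τ ≤ a t) = T.filter (fun t => a t < τ) := by
          ext t; simp; tauto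
        rw [hsd] at hcl
        have hcl' : ((T.filter (fun t => a t < τ)).card : ℝ) ≤ (G.intCells H).card := by
          exact_mod_cast hcl
        have : (d : ℝ) / 2 * (T.filter (fun t => a t < τ)).card
            ≤ (d : ℝ) / 2 * (G.intCells H).card :=
          mul_le_mul_of_nonneg_left hcl' (by positivity)
        rw [slack]
        linarith)
    simp only [Fintype.sum_sum_type, Sum.elim_inl, Sum.elim_inr, neg_mul,
      Finset.sum_neg_distrib, ← Finset.mul_sum, Finset.sum_coe_sort T a, Finset.univ_unique,
      Finset.sum_singleton] at key
    have h1 := (hz e₁).2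
    have h2 := (hz e₂).1
    have : δ * (a e₁ - a e₂) ≤ δ * (a emax - a emin) :=
      mul_le_mul_of_nonneg_left (by linarith) hδ.le
    linarith

end FeynmanGraph

namespace FeynmanGraph
variable {nV nE : ℕ} {G : FeynmanGraph nV nE}

/-- The dual spanning forest polynomial at complex arguments. -/
def forestC (G : FeynmanGraph nV nE) (p : Finset (Finset (Fin nV))) (ζ : Fin nE → ℂ) : ℂ :=
  ∑ F ∈ G.forests p, ∏ e ∈ F, ζ e

/-- `Φ̃_G(ζ, s)` at complex Schwinger parameters. -/
def phiC (G : FeynmanGraph nV nE) (s : Fin nV → Fin nV → ℂ) (ζ : Fin nE → ℂ) : ℂ :=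
  ∑ i ∈ G.ext, ∑ j ∈ G.ext.filter (fun j => i < j), s i j * G.forestC (G.pairPart i j) ζ

/-- The function `Φ̃^{-M} Ψ̃^{-(d/2-M)}` at complex Schwinger parameters. -/
def kernelC (G : FeynmanGraph nV nE) (d : ℕ) (s : Fin nV → Fin nV → ℂ) (ζ : Fin nE → ℂ) : ℂ :=
  G.phiC s ζ ^ (-(G.Mdeg d : ℂ)) *
    G.forestC G.singlePart ζ ^ (-((((d : ℝ) / 2 - G.Mdeg d : ℝ)) : ℂ))

lemma forestC_ofReal (p : Finset (Finset (Fin nV))) (α : Fin nE → ℝ) :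
    G.forestC p (fun e => (α e : ℂ)) = (G.dualForestPoly p α : ℂ) := by
  simp [forestC, dualForestPoly]

lemma phiC_ofReal (s : Fin nV → Fin nV → ℂ) (α : Fin nE → ℝ) :
    G.phiC s (fun e => (α e : ℂ)) = G.phiTildeS s α := by
  simp [phiC, phiTildeS, forestC_ofReal]

lemma norm_prod_sub_prod_le {α B : Fin nE → ℝ} {ζ : Fin nE → ℂ} {c : ℝ} (hc : c ≤ 1)
    (hα : ∀ e, 0 < α e) (hB : ∀ e, α e ≤ B e) (hζ : ∀ e, ‖ζ e - α e‖ ≤ c * B e)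
    (F : Finset (Fin nE)) :
    ‖∏ e ∈ F, ζ e‖ ≤ 2 ^ F.card * ∏ e ∈ F, B e ∧
    ‖∏ e ∈ F, ζ e - ((∏ e ∈ F, α e : ℝ) : ℂ)‖ ≤ c * (2 ^ F.card - 1) * ∏ e ∈ F, B e := by
  have hBpos : ∀ e, 0 < B e := fun e => (hα e).trans_le (hB e)
  have hζB : ∀ e, ‖ζ e‖ ≤ 2 * B e := fun e => by
    have h1 : ‖ζ e‖ ≤ ‖ζ e - α e‖ + ‖(α e : ℂ)‖ := by
      simpa using norm_add_le (ζ e - α e) (α e : ℂ)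
    rw [Complex.norm_real, Real.norm_of_nonneg (hα e).le] at h1
    have h2 := mul_le_mul_of_nonneg_right hc (hBpos e).le
    linarith [hζ e, hB e]
  induction F using Finset.induction_on with
  | empty => simp
  | insert e F he ih =>
    obtain ⟨ih1, ih2⟩ := ih
    have hP : 0 < ∏ e ∈ F, B e := Finset.prod_pos fun e _ => hBpos e
    rw [Finset.prod_insert he, Finset.prod_insert he, Finset.prod_insert he,
      Finset.card_insert_of_notMem he]
    constructor
    · rw [norm_mul]
      calc ‖ζ e‖ * ‖∏ e ∈ F, ζ e‖ ≤ (2 * B e) * (2 ^ F.card * ∏ e ∈ F, B e) :=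
            mul_le_mul (hζB e) ih1 (norm_nonneg _) (by linarith [hBpos e])
        _ = _ := by ring
    · have h1 : ζ e * ∏ e ∈ F, ζ e - ((α e * ∏ e ∈ F, α e : ℝ) : ℂ)
          = (ζ e - α e) * ∏ e ∈ F, ζ e
            + α e * (∏ e ∈ F, ζ e - ((∏ e ∈ F, α e : ℝ) : ℂ)) := by
        push_cast; ring
      rw [h1]
      refine (norm_add_le _ _).trans ?_
      rw [norm_mul, norm_mul, Complex.norm_real, Real.norm_of_nonneg (hα e).le]
      have h2 := mul_le_mul (hζ e) ih1 (norm_nonneg _) ((norm_nonneg _).trans (hζ e))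
      have h3 := mul_le_mul (hB e) ih2 (norm_nonneg _) (hBpos e).le
      calc _ ≤ c * B e * (2 ^ F.card * ∏ e ∈ F, B e)
            + B e * (c * (2 ^ F.card - 1) * ∏ e ∈ F, B e) := add_le_add h2 h3
        _ = _ := by ring

lemma norm_forestC_sub_le {α B : Fin nE → ℝ} {ζ : Fin nE → ℂ} {c X : ℝ} (hc0 : 0 ≤ c) (hc : c ≤ 1)
    (hα : ∀ e, 0 < α e) (hB : ∀ e, α e ≤ B e) (hζ : ∀ e, ‖ζ e - α e‖ ≤ c * B e)
    (p : Finset (Finset (Fin nV))) (hX : ∀ F ∈ G.forests p, ∏ e ∈ F, B e ≤ X) (hX0 : 0 ≤ X) :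
    ‖G.forestC p ζ‖ ≤ 4 ^ nE * X ∧
    ‖G.forestC p ζ - (G.dualForestPoly p α : ℂ)‖ ≤ c * 4 ^ nE * X := by
  have hcard : ((G.forests p).card : ℝ) ≤ 2 ^ nE := by
    have := Finset.card_le_univ (G.forests p)
    simp at this
    exact_mod_cast this
  have hpow : ∀ F : Finset (Fin nE), (2 : ℝ) ^ F.card ≤ 2 ^ nE := fun F =>
    pow_le_pow_right₀ (by norm_num) (by simpa using Finset.card_le_univ F)
  have h4 : (4 : ℝ) ^ nE = 2 ^ nE * 2 ^ nE := by
    rw [← mul_pow]; norm_num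
  have hBpos : ∀ e, 0 < B e := fun e => (hα e).trans_le (hB e)
  have key : ∀ F ∈ G.forests p, ∀ y : ℝ, 0 ≤ y → y ≤ 1 →
      y * 2 ^ F.card * ∏ e ∈ F, B e ≤ y * 2 ^ nE * X := fun F hF y hy _ =>
    mul_le_mul (mul_le_mul_of_nonneg_left (hpow F) hy) (hX F hF)
      (Finset.prod_nonneg fun e _ => (hBpos e).le) (by positivity)
  constructor
  · calc ‖G.forestC p ζ‖ ≤ ∑ F ∈ G.forests p, ‖∏ e ∈ F, ζ e‖ := norm_sum_le _ _
      _ ≤ ∑ F ∈ G.forests p, 2 ^ nE * X := Finset.sum_le_sum fun F hF => by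
          have := (norm_prod_sub_prod_le hc hα hB hζ F).1
          have h2 := key F hF 1 zero_le_one le_rfl
          linarith
      _ = (G.forests p).card * (2 ^ nE * X) := by simp
      _ ≤ 2 ^ nE * (2 ^ nE * X) := mul_le_mul_of_nonneg_right hcard (by positivity)
      _ = _ := by rw [h4]; ring
  · have h1 : G.forestC p ζ - (G.dualForestPoly p α : ℂ)
        = ∑ F ∈ G.forests p, (∏ e ∈ F, ζ e - ((∏ e ∈ F, α e : ℝ) : ℂ)) := by
      simp [forestC, dualForestPoly, Finset.sum_sub_distrib]
    rw [h1]
    calc _ ≤ ∑ F ∈ G.forests p, ‖∏ e ∈ F, ζ e - ((∏ e ∈ F, α e : ℝ) : ℂ)‖ := norm_sum_le _ _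
      _ ≤ ∑ F ∈ G.forests p, c * 2 ^ nE * X := Finset.sum_le_sum fun F hF => by
          have h0 := (norm_prod_sub_prod_le hc hα hB hζ F).2
          have h2 := key F hF c hc0 hc
          have h3 : 0 ≤ c * ∏ e ∈ F, B e :=
            mul_nonneg hc0 (Finset.prod_nonneg fun e _ => (hBpos e).le)
          linarith
      _ = (G.forests p).card * (c * 2 ^ nE * X) := by simp
      _ ≤ 2 ^ nE * (c * 2 ^ nE * X) := mul_le_mul_of_nonneg_right hcard (by positivity)
      _ = _ := by rw [h4]; ring

lemma dualForestPoly_nonneg (p : Finset (Finset (Fin nV))) {α : Fin nE → ℝ}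
    (hα : ∀ e, 0 < α e) : 0 ≤ G.dualForestPoly p α :=
  Finset.sum_nonneg fun _ _ => Finset.prod_nonneg fun e _ => (hα e).le

lemma prod_le_dualForestPoly {p : Finset (Finset (Fin nV))} {α : Fin nE → ℝ}
    (hα : ∀ e, 0 < α e) {F : Finset (Fin nE)} (hF : F ∈ G.forests p) :
    ∏ e ∈ F, α e ≤ G.dualForestPoly p α :=
  Finset.single_le_sum (f := fun F => ∏ e ∈ F, α e)
    (fun _ _ => Finset.prod_nonneg fun e _ => (hα e).le) hF

lemma norm_cpow_ofReal {z : ℂ} (hz : z ≠ 0) (r : ℝ) : ‖z ^ (r : ℂ)‖ = ‖z‖ ^ r := by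
  rw [Complex.norm_cpow_of_ne_zero hz]
  simp

/-- Uniform bounds for the kernel on a polydisc adapted to the sector of `α`. -/
theorem exists_kernel_bound {d : ℕ} {n : Fin nE → ℕ} (hUV : G.UVConvergent d)
    (hIR : G.IRConvergent d) (hM : 0 < G.Mdeg d) (hn : ∀ e, 0 < (n e : ℝ) + lam d * G.ν e)
    (hcomp : ∀ v : Fin nV, ∃ w ∈ G.ext, (G.edgeGraph Finset.univ).Reachable v w)
    (hconn : G.ExtLinked Finset.univ) :
    ∃ δ > (0 : ℝ), ∀ κ > (0 : ℝ), ∀ K : ℝ, ∃ C > (0 : ℝ), ∃ c > (0 : ℝ), ∀ α : Fin nE → ℝ, (∀ e, 0 < α e) →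
      ∃ (B : Fin nE → ℝ) (Q : ℝ), (∀ e, 0 < B e) ∧
      (∀ s : Fin nV → Fin nV → ℂ, (∀ i ∈ G.ext, ∀ j ∈ G.ext, i < j → κ ≤ (s i j).re) →
        (∀ i j, ‖s i j‖ ≤ K) → ∀ ζ : Fin nE → ℂ, (∀ e, ‖ζ e - α e‖ ≤ c * B e) →
        0 < (G.phiC s ζ).re ∧ 0 < (G.forestC G.singlePart ζ).re ∧ ‖G.kernelC d s ζ‖ ≤ Q) ∧
      ∀ e₁ e₂, (∏ e, α e ^ ((n e : ℝ) + lam d * G.ν e)) * (∏ e, (B e ^ n e)⁻¹) * Q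
        ≤ C * (α e₂ / α e₁) ^ δ := by
  obtain ⟨δ, hδ, htrop⟩ := exists_tropical_bound hUV hIR hn hcomp hconn
  refine ⟨δ, hδ, fun κ hκ K => ?_⟩
  set N : ℝ := 4 ^ nE with hN
  have hN1 : 1 ≤ N := one_le_pow₀ (by norm_num)
  set L : ℝ := (nV : ℝ) ^ 2 * |K| * N with hL
  have hL0 : 0 ≤ L := by positivity
  set c : ℝ := min (1 / (2 * N)) (κ / (2 * (L + κ))) with hc
  have hc0 : 0 < c := by positivity
  have hcN : c * N ≤ 1 / 2 := by
    calc c * N ≤ 1 / (2 * N) * N := mul_le_mul_of_nonneg_right (min_le_left _ _) (by positivity)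
      _ = 1 / 2 := by field_simp
  have hc1 : c ≤ 1 := by nlinarith
  have hcL : c * L ≤ κ / 2 := by
    calc c * L ≤ κ / (2 * (L + κ)) * (L + κ) :=
          mul_le_mul (min_le_right _ _) (by linarith) hL0 (by positivity)
      _ = κ / 2 := by field_simp
  set r : ℝ := (d : ℝ) / 2 - G.Mdeg d with hr
  set C : ℝ := (κ / 2) ^ (-G.Mdeg d) * ((1 / 2) ^ (-r) + N ^ (-r)) with hC
  refine ⟨C, by positivity, c, hc0, fun α hα => ?_⟩
  obtain ⟨T, astar, b, hab, hT, h1, h2, ⟨i₀, hi₀, j₀, hj₀, hij₀, F₀, hF₀, h3⟩, h4⟩ :=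
    htrop (fun e => Real.log (α e))
  have hexpα : ∀ S : Finset (Fin nE), Real.exp (∑ e ∈ S, Real.log (α e)) = ∏ e ∈ S, α e := by
    intro S
    rw [Real.exp_sum]
    exact Finset.prod_congr rfl fun e _ => Real.exp_log (hα e)
  set B : Fin nE → ℝ := fun e => Real.exp (b e) with hBdef
  have hexpB : ∀ S : Finset (Fin nE), ∏ e ∈ S, B e = Real.exp (∑ e ∈ S, b e) := by
    intro S
    rw [Real.exp_sum]
  have hαB : ∀ e, α e ≤ B e := fun e => by
    rw [← Real.exp_log (hα e)]
    exact Real.exp_le_exp.2 (hab e)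
  set X : ℝ := Real.exp (∑ e ∈ T, Real.log (α e)) with hX
  have hX0 : 0 < X := Real.exp_pos _
  set A : ℝ := Real.exp astar with hA
  have hA0 : 0 < A := Real.exp_pos _
  refine ⟨B, C * A ^ (-G.Mdeg d) * X ^ (-((d : ℝ) / 2)), fun e => Real.exp_pos _, ?_, ?_⟩
  · intro s hs hsK ζ hζ
    have hψ := norm_forestC_sub_le hc0.le hc1 hα hαB hζ G.singlePart (X := X)
      (fun F hF => by rw [hexpB]; exact Real.exp_le_exp.2 (h1 F hF)) hX0.le
    have hψX : X ≤ G.dualForestPoly G.singlePart α := by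
      rw [hX, hexpα]
      exact prod_le_dualForestPoly hα hT
    have hψre : X / 2 ≤ (G.forestC G.singlePart ζ).re := by
      have h5 := Complex.abs_re_le_norm (G.forestC G.singlePart ζ -
        (G.dualForestPoly G.singlePart α : ℂ))
      rw [Complex.sub_re, Complex.ofReal_re] at h5
      have h6 := (abs_le.1 (h5.trans hψ.2)).1
      have h7 := mul_le_mul_of_nonneg_right hcN hX0.le
      linarith
    have hpair : ∀ i ∈ G.ext, ∀ j ∈ G.ext.filter (fun j => i < j),
        ‖G.forestC (G.pairPart i j) ζ - (G.dualForestPoly (G.pairPart i j) α : ℂ)‖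
          ≤ c * N * (X * A) := by
      intro i hi j hj
      obtain ⟨hj, hij⟩ := Finset.mem_filter.1 hj
      exact (norm_forestC_sub_le hc0.le hc1 hα hαB hζ (G.pairPart i j) (X := X * A)
        (fun F hF => by
          rw [hexpB, hX, hA, ← Real.exp_add]
          exact Real.exp_le_exp.2 (h2 i hi j hj hij F hF)) (by positivity)).2
    have hφre : κ / 2 * (X * A) ≤ (G.phiC s ζ).re := by
      have h5 : ‖G.phiC s ζ - G.phiTildeS s α‖ ≤ c * L * (X * A) := by
        have h6 : G.phiC s ζ - G.phiTildeS s α = ∑ i ∈ G.ext, ∑ j ∈ G.ext.filter (fun j => i < j),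
            s i j * (G.forestC (G.pairPart i j) ζ - (G.dualForestPoly (G.pairPart i j) α : ℂ)) := by
          simp only [phiC, phiTildeS, ← Finset.sum_sub_distrib, mul_sub]
        have hcards : ∀ S : Finset (Fin nV), (S.card : ℝ) ≤ nV := fun S => by
          have := Finset.card_le_univ S
          simp at this
          exact_mod_cast this
        rw [h6]
        have hb0 : 0 ≤ |K| * (c * N * (X * A)) := by positivity
        calc _ ≤ ∑ i ∈ G.ext, ∑ j ∈ G.ext.filter (fun j => i < j), |K| * (c * N * (X * A)) := by
              refine norm_sum_le_of_le _ fun i hi => norm_sum_le_of_le _ fun j hj => ?_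
              rw [norm_mul]
              exact mul_le_mul ((hsK i j).trans (le_abs_self K)) (hpair i hi j hj)
                (norm_nonneg _) (abs_nonneg _)
          _ ≤ ∑ i ∈ G.ext, (nV : ℝ) * (|K| * (c * N * (X * A))) := by
              refine Finset.sum_le_sum fun i _ => ?_
              rw [Finset.sum_const, nsmul_eq_mul]
              exact mul_le_mul_of_nonneg_right (hcards _) hb0
          _ ≤ (nV : ℝ) * ((nV : ℝ) * (|K| * (c * N * (X * A)))) := by
              rw [Finset.sum_const, nsmul_eq_mul]
              exact mul_le_mul_of_nonneg_right (hcards _) (by positivity)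
          _ = _ := by rw [hL]; ring
      have h6 : κ * (X * A) ≤ (G.phiTildeS s α).re := by
        have h7 : (G.phiTildeS s α).re = ∑ i ∈ G.ext, ∑ j ∈ G.ext.filter (fun j => i < j),
            (s i j).re * G.dualForestPoly (G.pairPart i j) α := by
          simp [phiTildeS, Complex.re_sum]
        have h0 : ∀ i ∈ G.ext, ∀ j ∈ G.ext.filter (fun j => i < j),
            0 ≤ (s i j).re * G.dualForestPoly (G.pairPart i j) α := fun i hi j hj =>
          mul_nonneg (hκ.le.trans (hs i hi j (Finset.mem_filter.1 hj).1 (Finset.mem_filter.1 hj).2))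
            (dualForestPoly_nonneg _ hα)
        rw [h7]
        calc κ * (X * A) ≤ (s i₀ j₀).re * G.dualForestPoly (G.pairPart i₀ j₀) α := by
              refine mul_le_mul (hs i₀ hi₀ j₀ hj₀ hij₀) ?_ (by positivity)
                (hκ.le.trans (hs i₀ hi₀ j₀ hj₀ hij₀))
              refine le_trans ?_ (prod_le_dualForestPoly hα hF₀)
              rw [hX, hA, ← Real.exp_add, ← hexpα]
              exact Real.exp_le_exp.2 h3
          _ ≤ ∑ j ∈ G.ext.filter (fun j => i₀ < j),
                (s i₀ j).re * G.dualForestPoly (G.pairPart i₀ j) α :=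
              Finset.single_le_sum (f := fun j =>
                (s i₀ j).re * G.dualForestPoly (G.pairPart i₀ j) α) (fun j hj => h0 i₀ hi₀ j hj)
                (Finset.mem_filter.2 ⟨hj₀, hij₀⟩)
          _ ≤ _ := Finset.single_le_sum (f := fun i => ∑ j ∈ G.ext.filter (fun j => i < j),
                (s i j).re * G.dualForestPoly (G.pairPart i j) α)
                (fun i hi => Finset.sum_nonneg fun j hj => h0 i hi j hj) hi₀
      have h7 := Complex.abs_re_le_norm (G.phiC s ζ - G.phiTildeS s α)
      rw [Complex.sub_re] at h7
      have h8 := (abs_le.1 (h7.trans h5)).1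
      have h9 := mul_le_mul_of_nonneg_right hcL (mul_pos hX0 hA0).le
      linarith
    have hφ0 : 0 < (G.phiC s ζ).re := lt_of_lt_of_le (by positivity) hφre
    have hψ0 : 0 < (G.forestC G.singlePart ζ).re := lt_of_lt_of_le (by positivity) hψre
    refine ⟨hφ0, hψ0, ?_⟩
    have hφne : G.phiC s ζ ≠ 0 := fun h => by simp [h] at hφ0
    have hψne : G.forestC G.singlePart ζ ≠ 0 := fun h => by simp [h] at hψ0
    rw [kernelC, norm_mul, ← Complex.ofReal_neg, ← Complex.ofReal_neg, norm_cpow_ofReal hφne,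
      norm_cpow_ofReal hψne]
    have hφn : κ / 2 * (X * A) ≤ ‖G.phiC s ζ‖ := hφre.trans (Complex.re_le_norm _)
    have hψn : 1 / 2 * X ≤ ‖G.forestC G.singlePart ζ‖ := by
      have := hψre.trans (Complex.re_le_norm _)
      linarith
    have h5 : ‖G.phiC s ζ‖ ^ (-G.Mdeg d) ≤ (κ / 2) ^ (-G.Mdeg d) * (X * A) ^ (-G.Mdeg d) := by
      rw [← Real.mul_rpow (by positivity) (by positivity)]
      exact Real.rpow_le_rpow_of_nonpos (by positivity) hφn (by linarith)
    have h6 : ‖G.forestC G.singlePart ζ‖ ^ (-r) ≤ ((1 / 2) ^ (-r) + N ^ (-r)) * X ^ (-r) := by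
      rcases le_total 0 r with h | h
      · calc _ ≤ (1 / 2 * X) ^ (-r) :=
              Real.rpow_le_rpow_of_nonpos (by positivity) hψn (by linarith)
          _ = (1 / 2) ^ (-r) * X ^ (-r) := Real.mul_rpow (by positivity) hX0.le
          _ ≤ _ := mul_le_mul_of_nonneg_right (le_add_of_nonneg_right (by positivity))
              (by positivity)
      · calc _ ≤ (N * X) ^ (-r) :=
              Real.rpow_le_rpow (norm_nonneg _) hψ.1 (by linarith)
          _ = N ^ (-r) * X ^ (-r) := Real.mul_rpow (by positivity) hX0.le
          _ ≤ _ := mul_le_mul_of_nonneg_right (le_add_of_nonneg_left (by positivity))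
              (by positivity)
    refine (mul_le_mul h5 h6 (by positivity) (by positivity)).trans (le_of_eq ?_)
    have h7 : X ^ (-((d : ℝ) / 2)) = X ^ (-G.Mdeg d) * X ^ (-r) := by
      rw [← Real.rpow_add hX0, hr]; congr 1; ring
    rw [h7, Real.mul_rpow hX0.le hA0.le, hC]
    ring
  · intro e₁ e₂
    have h5 := h4 e₁ e₂
    have hl : (∏ e, α e ^ ((n e : ℝ) + lam d * G.ν e)) * (∏ e, (B e ^ n e)⁻¹)
        * (A ^ (-G.Mdeg d) * X ^ (-((d : ℝ) / 2)))
        = Real.exp (∑ e, ((n e : ℝ) + lam d * G.ν e) * Real.log (α e)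
          - (d : ℝ) / 2 * ∑ e ∈ T, Real.log (α e) - G.Mdeg d * astar - ∑ e, (n e : ℝ) * b e) := by
      have e1 : (∏ e, α e ^ ((n e : ℝ) + lam d * G.ν e))
          = Real.exp (∑ e, ((n e : ℝ) + lam d * G.ν e) * Real.log (α e)) := by
        rw [Real.exp_sum]
        exact Finset.prod_congr rfl fun e _ => by
          rw [Real.rpow_def_of_pos (hα e), mul_comm]
      have e2 : (∏ e, (B e ^ n e)⁻¹) = Real.exp (-∑ e, (n e : ℝ) * b e) := by
        rw [← Finset.sum_neg_distrib, Real.exp_sum]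
        exact Finset.prod_congr rfl fun e _ => by
          rw [Real.exp_neg, Real.exp_nat_mul]
      have e3 : A ^ (-G.Mdeg d) = Real.exp (-(G.Mdeg d * astar)) := by
        rw [hA, ← Real.exp_mul]; congr 1; ring
      have e4 : X ^ (-((d : ℝ) / 2)) = Real.exp (-((d : ℝ) / 2 * ∑ e ∈ T, Real.log (α e))) := by
        rw [hX, ← Real.exp_mul]; congr 1; ring
      rw [e1, e2, e3, e4, ← Real.exp_add, ← Real.exp_add, ← Real.exp_add]
      congr 1; ring
    have hrr : (α e₂ / α e₁) ^ δ = Real.exp (-δ * (Real.log (α e₁) - Real.log (α e₂))) := by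
      rw [Real.rpow_def_of_pos (div_pos (hα _) (hα _)), Real.log_div (hα _).ne' (hα _).ne']
      congr 1; ring
    rw [hrr]
    calc _ = C * ((∏ e, α e ^ ((n e : ℝ) + lam d * G.ν e)) * (∏ e, (B e ^ n e)⁻¹)
        * (A ^ (-G.Mdeg d) * X ^ (-((d : ℝ) / 2)))) := by ring
      _ ≤ _ := by
        rw [hl]
        exact mul_le_mul_of_nonneg_left (Real.exp_le_exp.2 h5) (by positivity)

end FeynmanGraph

section CauchyEstimates

variable {S ι : Type*} [NormedAddCommGroup S] [NormedSpace ℂ S] [Fintype ι]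

/-- The operator `D` preserves analyticity on `U` and satisfies Cauchy estimates of order `k`
on polydiscs contained in `U`. -/
def IsCauchyOp (U : Set (S × (ι → ℂ))) (D : (S × (ι → ℂ) → ℂ) → S × (ι → ℂ) → ℂ)
    (k : ι → ℕ) : Prop :=
  (∀ g, AnalyticOnNhd ℂ g U → AnalyticOnNhd ℂ (D g) U) ∧
  ∃ C > (0 : ℝ), ∃ θ > (0 : ℝ), θ ≤ 1 ∧ ∀ g, AnalyticOnNhd ℂ g U →
    ∀ (s : S) (c : ι → ℂ) (r : ι → ℝ) (A : ℝ), (∀ e, 0 < r e) →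
    (∀ ζ : ι → ℂ, (∀ e, ‖ζ e - c e‖ ≤ r e) → (s, ζ) ∈ U ∧ ‖g (s, ζ)‖ ≤ A) →
    ∀ ζ : ι → ℂ, (∀ e, ‖ζ e - c e‖ ≤ θ * r e) → ‖D g (s, ζ)‖ ≤ C * A * ∏ e, (r e ^ k e)⁻¹

variable {U : Set (S × (ι → ℂ))}

lemma isCauchyOp_id : IsCauchyOp U id 0 := by
  refine ⟨fun g hg => hg, 1, one_pos, 1, one_pos, le_rfl, fun g _ s c r A _ h ζ hζ => ?_⟩
  simpa using (h ζ (by simpa using hζ)).2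

lemma IsCauchyOp.comp {D₁ D₂ : (S × (ι → ℂ) → ℂ) → S × (ι → ℂ) → ℂ} {k₁ k₂ : ι → ℕ}
    (h₁ : IsCauchyOp U D₁ k₁) (h₂ : IsCauchyOp U D₂ k₂) :
    IsCauchyOp U (fun g => D₁ (D₂ g)) (k₁ + k₂) := by
  obtain ⟨ha₁, C₁, hC₁, θ₁, hθ₁, hθ₁', hb₁⟩ := h₁
  obtain ⟨ha₂, C₂, hC₂, θ₂, hθ₂, hθ₂', hb₂⟩ := h₂
  refine ⟨fun g hg => ha₁ _ (ha₂ g hg), C₁ * C₂ * ∏ e, (θ₂ ^ k₁ e)⁻¹, by positivity,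
    θ₁ * θ₂, by positivity, by nlinarith, fun g hg s c r A hr h ζ hζ => ?_⟩
  have h2 := hb₂ g hg s c r A hr h
  have hle : ∀ ζ : ι → ℂ, (∀ e, ‖ζ e - c e‖ ≤ θ₂ * r e) → ∀ e, ‖ζ e - c e‖ ≤ r e :=
    fun ζ hζ e => (hζ e).trans (mul_le_of_le_one_left (hr e).le hθ₂')
  have h1 := hb₁ _ (ha₂ g hg) s c (fun e => θ₂ * r e) _ (fun e => mul_pos hθ₂ (hr e))
    (fun ζ hζ => ⟨(h ζ (hle ζ hζ)).1, h2 ζ hζ⟩) ζ (fun e => by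
      rw [← mul_assoc]; exact hζ e)
  refine h1.trans (le_of_eq ?_)
  simp only [mul_pow, mul_inv, Finset.prod_mul_distrib, Pi.add_apply, pow_add]
  ring

variable [DecidableEq ι]

/-- The complex partial derivative in the direction of the coordinate `e`. -/
def dirD (e : ι) (g : S × (ι → ℂ) → ℂ) : S × (ι → ℂ) → ℂ :=
  fun p => fderiv ℂ g p (0, Pi.single e 1)

lemma isCauchyOp_dirD (e : ι) : IsCauchyOp U (dirD e) (Pi.single e 1) := by
  refine ⟨fun g hg => ?_, 2, two_pos, 1 / 2, by norm_num, by norm_num,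
    fun g hg s c r A hr h ζ hζ => ?_⟩
  · have h1 := hg.fderiv
    exact fun p hp => (((ContinuousLinearMap.apply ℂ ℂ
      ((0, Pi.single e 1) : S × (ι → ℂ))).analyticAt _).comp (h1 p hp))
  · have hpt : ∀ t : ℂ, ‖t‖ ≤ r e / 2 → ∀ e', 
      ‖(ζ + t • Pi.single e (1 : ℂ) : ι → ℂ) e' - c e'‖ ≤ r e' := by
      intro t ht e'
      by_cases he : e' = e
      · subst he
        have h1 : (ζ + t • Pi.single e' (1 : ℂ) : ι → ℂ) e' - c e' = (ζ e' - c e') + t := by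
          simp; ring
        rw [h1]
        refine (norm_add_le _ _).trans ?_
        linarith [hζ e']
      · have h1 : (ζ + t • Pi.single e (1 : ℂ) : ι → ℂ) e' - c e' = (ζ e' - c e') := by
          simp [he]
        rw [h1]
        linarith [hζ e', hr e']
    set γ : ℂ → S × (ι → ℂ) := fun t => (s, ζ + t • Pi.single e (1 : ℂ)) with hγ
    have hγd : ∀ t, HasDerivAt γ (0, Pi.single e 1) t := fun t => by
      have h1 : HasDerivAt (fun t : ℂ => ζ + t • Pi.single e (1 : ℂ)) (Pi.single e (1 : ℂ)) t := by
        simpa using ((hasDerivAt_id t).smul_const (Pi.single e (1 : ℂ) : ι → ℂ)).const_add ζ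
      exact (hasDerivAt_const t s).prodMk h1
    have hcomp : ∀ t : ℂ, ‖t‖ ≤ r e / 2 →
        HasDerivAt (fun t => g (γ t)) (fderiv ℂ g (γ t) (0, Pi.single e 1)) t := fun t ht =>
      (hg _ (h _ (hpt t ht)).1).differentiableAt.hasFDerivAt.comp_hasDerivAt t (hγd t)
    have h0 : deriv (fun t => g (γ t)) 0 = dirD e g (s, ζ) := by
      rw [(hcomp 0 (by simpa using (half_pos (hr e)).le)).deriv]
      simp [hγ, dirD]
    have hcl : DiffContOnCl ℂ (fun t => g (γ t)) (Metric.ball 0 (r e / 2)) := by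
      refine DifferentiableOn.diffContOnCl fun t ht => ?_
      have ht' : ‖t‖ ≤ r e / 2 := by
        have := Metric.closure_ball_subset_closedBall ht
        simpa using this
      exact (hcomp t ht').differentiableAt.differentiableWithinAt
    have h1 := Complex.norm_deriv_le_of_forall_mem_sphere_norm_le (half_pos (hr e)) hcl
      (C := A) (fun t ht => (h _ (hpt t (by
        have : ‖t‖ = r e / 2 := by simpa using ht
        exact this.le))).2)
    rw [h0] at h1
    refine h1.trans (le_of_eq ?_)
    have h2 : ∏ e', (r e' ^ (Pi.single e 1 : ι → ℕ) e')⁻¹ = (r e)⁻¹ := by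
      rw [Finset.prod_eq_single e (fun e' _ he => by simp [he]) (by simp)]
      simp
    rw [h2]
    field_simp

lemma isCauchyOp_iterate (e : ι) (j : ℕ) :
    IsCauchyOp U ((dirD e)^[j]) (Pi.single e j) := by
  induction j with
  | zero => simpa using isCauchyOp_id
  | succ j ih =>
    have h := (isCauchyOp_dirD e).comp ih
    rw [← Pi.single_add] at h
    rw [Function.iterate_succ', add_comm]
    exact h

lemma isCauchyOp_foldr (n : ι → ℕ) (l : List ι) :
    IsCauchyOp U (fun f => l.foldr (fun e g => (dirD e)^[n e] g) f)
      ((l.map (fun e => Pi.single e (n e))).sum) := by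
  induction l with
  | nil => exact isCauchyOp_id
  | cons e l ih =>
    simpa using (isCauchyOp_iterate e (n e)).comp ih

end CauchyEstimates

section RealRestriction

variable {S : Type*} [NormedAddCommGroup S] [NormedSpace ℂ S] {m : ℕ}
  {U : Set (S × (Fin (m + 1) → ℂ))} {s : S}

/-- The real function `h` of the Schwinger parameters is the restriction of the analytic
function `g` to the open orthant. -/
def IsRestriction (U : Set (S × (Fin (m + 1) → ℂ))) (s : S) (h : (Fin (m + 1) → ℝ) → ℂ)
    (g : S × (Fin (m + 1) → ℂ) → ℂ) : Prop :=
  AnalyticOnNhd ℂ g U ∧ ∀ α : Fin (m + 1) → ℝ, (∀ e, 0 < α e) → h α = g (s, fun e => (α e : ℂ))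

lemma IsRestriction.pderiv {h : (Fin (m + 1) → ℝ) → ℂ} {g : S × (Fin (m + 1) → ℂ) → ℂ}
    (hs : ∀ α : Fin (m + 1) → ℝ, (∀ e, 0 < α e) → (s, fun e => (α e : ℂ)) ∈ U)
    (hr : IsRestriction U s h g) (e : Fin (m + 1)) :
    IsRestriction U s (pderivEC e h) (dirD e g) := by
  refine ⟨(isCauchyOp_dirD e).1 g hr.1, fun α hα => ?_⟩
  rw [pderivEC]
  have hev : (fun t => h (Function.update α e t)) =ᶠ[nhds (α e)]
      fun t : ℝ => g (s, fun e' => ((Function.update α e t e' : ℝ) : ℂ)) := by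
    filter_upwards [lt_mem_nhds (hα e)] with t ht
    refine hr.2 _ fun e' => ?_
    by_cases he : e' = e
    · subst he; simpa using ht
    · simpa [he] using hα e'
  rw [hev.deriv_eq]
  have hγ : HasDerivAt (fun t : ℝ => ((s, fun e' => ((Function.update α e t e' : ℝ) : ℂ)) :
      S × (Fin (m + 1) → ℂ))) (0, Pi.single e 1) (α e) := by
    refine (hasDerivAt_const _ s).prodMk (hasDerivAt_pi.2 fun e' => ?_)
    by_cases he : e' = e
    · subst he
      simpa using (hasDerivAt_id (α e')).ofReal_comp
    · simpa [he] using hasDerivAt_const (α e) ((α e' : ℝ) : ℂ)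
  have hg := ((hr.1 _ (hs α hα)).differentiableAt.hasFDerivAt.restrictScalars ℝ)
  have h2 : (fun e' => ((Function.update α e (α e) e' : ℝ) : ℂ)) = fun e' => (α e' : ℂ) := by simp
  rw [← h2] at hg
  have h3 := (hg.comp_hasDerivAt (α e) hγ).deriv
  rw [Function.comp_def] at h3
  rw [h3, h2]
  rfl

lemma IsRestriction.multiDeriv {h : (Fin (m + 1) → ℝ) → ℂ} {g : S × (Fin (m + 1) → ℂ) → ℂ}
    (hs : ∀ α : Fin (m + 1) → ℝ, (∀ e, 0 < α e) → (s, fun e => (α e : ℂ)) ∈ U)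
    (hr : IsRestriction U s h g) (n : Fin (m + 1) → ℕ) :
    IsRestriction U s (multiDerivC n h)
      ((Finset.univ : Finset (Fin (m + 1))).toList.foldr (fun e g => (dirD e)^[n e] g) g) := by
  rw [multiDerivC]
  generalize (Finset.univ : Finset (Fin (m + 1))).toList = l
  induction l with
  | nil => exact hr
  | cons e l ih =>
    rw [List.foldr_cons, List.foldr_cons]
    generalize n e = j
    induction j with
    | zero => exact ih
    | succ j ih' =>
      rw [Function.iterate_succ_apply', Function.iterate_succ_apply']
      exact ih'.pderiv hs e

end RealRestriction

section HolomorphicIntegral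

variable {S T : Type*} [NormedAddCommGroup S] [NormedSpace ℂ S] [MeasurableSpace T]
  {μ : Measure T}

/-- An integral depending on a parameter is holomorphic if the integrand is, with a locally
uniform integrable bound. -/
lemma differentiableAt_integral_of_dominated {F : S → T → ℂ} {F' : T → S →L[ℂ] ℂ} {b : T → ℝ}
    {s₀ : S} {r : ℝ} (hr : 0 < r)
    (hmeas : ∀ s ∈ Metric.ball s₀ r, AEStronglyMeasurable (F s) μ)
    (hmeas' : AEStronglyMeasurable F' μ)
    (hb : ∀ᵐ t ∂μ, ∀ s ∈ Metric.ball s₀ r, ‖F s t‖ ≤ b t) (hbi : Integrable b μ)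
    (hd : ∀ᵐ t ∂μ, DifferentiableOn ℂ (fun s => F s t) (Metric.ball s₀ r))
    (hd' : ∀ᵐ t ∂μ, HasFDerivAt (fun s => F s t) (F' t) s₀) :
    DifferentiableAt ℂ (fun s => ∫ t, F s t ∂μ) s₀ := by
  have hs₀ := Metric.mem_ball_self (x := s₀) hr
  have hint : Integrable (F s₀) μ :=
    hbi.mono' (hmeas s₀ hs₀) (hb.mono fun t ht => ht s₀ hs₀)
  refine (hasFDerivAt_integral_of_dominated_loc_of_lip' (bound := fun t => 2 * b t / r)
    (Metric.ball_mem_nhds s₀ hr) hmeas hint hmeas' ?_ ((hbi.const_mul 2).div_const r)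
    hd').2.differentiableAt
  filter_upwards [hb, hd] with t hbt hdt s hs
  have hmaps : Set.MapsTo (fun s => F s t) (Metric.ball s₀ r)
      (Metric.closedBall (F s₀ t) (2 * b t)) := fun s' hs' => by
    rw [Metric.mem_closedBall, dist_eq_norm]
    have := norm_sub_le (F s' t) (F s₀ t)
    linarith [hbt s' hs', hbt s₀ hs₀]
  have := Complex.dist_le_div_mul_dist_of_mapsTo_ball hdt hmaps hs
  rwa [dist_eq_norm, dist_eq_norm] at this

end HolomorphicIntegral

/-- The function `t ↦ t⁻¹ min(t, t⁻¹)^δ`, integrable on the positive half-line. -/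
def decay (δ t : ℝ) : ℝ := t⁻¹ * (min t t⁻¹) ^ δ

lemma integrableOn_decay {δ : ℝ} (hδ : 0 < δ) : IntegrableOn (decay δ) (Set.Ioi 0) := by
  have h1 : IntegrableOn (decay δ) (Set.Ioc 0 1) := by
    have h := (intervalIntegral.intervalIntegrable_rpow' (a := 0) (b := 1) (r := δ - 1)
      (by linarith))
    rw [intervalIntegrable_iff_integrableOn_Ioc_of_le zero_le_one] at h
    refine h.congr_fun (fun t ht => ?_) measurableSet_Ioc
    have h2 : t ≤ t⁻¹ := ht.2.trans (one_le_inv_iff₀.2 ht)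
    simp only [decay]
    rw [min_eq_left h2, Real.rpow_sub_one ht.1.ne']
    ring
  have h2 : IntegrableOn (decay δ) (Set.Ioi 1) := by
    have h := integrableOn_Ioi_rpow_of_lt (a := -δ - 1) (by linarith) one_pos
    refine h.congr_fun (fun t ht => ?_) measurableSet_Ioi
    have h0 : (0 : ℝ) < t := one_pos.trans ht
    have h2 : t⁻¹ ≤ t := (inv_le_one_of_one_le₀ (le_of_lt ht)).trans (le_of_lt ht)
    simp only [decay]
    rw [min_eq_right h2, Real.rpow_sub_one h0.ne', Real.inv_rpow h0.le, Real.rpow_neg h0.le]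
    ring
  rw [← Set.Ioc_union_Ioi_eq_Ioi zero_le_one]
  exact h1.union h2

lemma integrableOn_prod_decay {ι : Type*} [Fintype ι] {δ : ℝ} (hδ : 0 < δ) :
    IntegrableOn (fun β : ι → ℝ => ∏ e, decay δ (β e)) {β | ∀ e, 0 < β e} := by
  have h1 : {β : ι → ℝ | ∀ e, 0 < β e} = Set.univ.pi fun _ => Set.Ioi 0 := by
    ext; simp
  rw [h1, IntegrableOn, volume_pi, Measure.restrict_pi_pi]
  exact Integrable.fintype_prod (fun e => integrableOn_decay hδ)

lemma measurableSet_orthant {ι : Type*} [Fintype ι] : MeasurableSet {β : ι → ℝ | ∀ e, 0 < β e} := by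
  have h1 : {β : ι → ℝ | ∀ e, 0 < β e} = Set.univ.pi fun _ => Set.Ioi 0 := by
    ext; simp
  rw [h1]
  exact MeasurableSet.univ_pi fun _ => measurableSet_Ioi

lemma chart_pos {m : ℕ} {β : {e : Fin (m + 1) // e ≠ 0} → ℝ} (hβ : ∀ e, 0 < β e)
    (e : Fin (m + 1)) : 0 < chart β e := by
  rw [chart]
  split_ifs with h
  exacts [one_pos, hβ _]

lemma continuous_chart {m : ℕ} :
    Continuous (chart : ({e : Fin (m + 1) // e ≠ 0} → ℝ) → Fin (m + 1) → ℝ) := by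
  refine continuous_pi fun e => ?_
  by_cases h : e = 0
  · simpa [chart, h] using continuous_const
  · simpa [chart, h] using continuous_apply _

@[simp] lemma chart_zero {m : ℕ} (β : {e : Fin (m + 1) // e ≠ 0} → ℝ) : chart β 0 = 1 := by
  simp [chart]

@[simp] lemma chart_coe {m : ℕ} (β : {e : Fin (m + 1) // e ≠ 0} → ℝ)
    (e : {e : Fin (m + 1) // e ≠ 0}) : chart β e = β e := by
  simp [chart, e.2]

lemma prod_chart {m : ℕ} (β : {e : Fin (m + 1) // e ≠ 0} → ℝ) (f : Fin (m + 1) → ℝ → ℝ) :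
    ∏ e, f e (chart β e) = f 0 1 * ∏ e : {e : Fin (m + 1) // e ≠ 0}, f e (β e) := by
  rw [Fintype.prod_eq_mul_prod_subtype_ne (fun e => f e (chart β e)) 0]
  simp

/-- A quantity bounded by `C (α_{e₂}/α_{e₁})^δ` for all pairs is dominated by the decay functions. -/
lemma le_prod_decay {m : ℕ} {δ C W : ℝ} (hC : 0 ≤ C) (hW : 0 ≤ W)
    {β : {e : Fin (m + 1) // e ≠ 0} → ℝ} (hβ : ∀ e, 0 < β e)
    (h : ∀ e₁ e₂, W ≤ C * (chart β e₂ / chart β e₁) ^ δ) :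
    W * ∏ e, (chart β e)⁻¹ ≤ C * ∏ e, decay (δ / (m + 1)) (β e) := by
  have hm : (0 : ℝ) < m + 1 := by positivity
  have hα := chart_pos hβ
  have hmin : ∀ e, 0 < min (chart β e) (chart β e)⁻¹ := fun e =>
    lt_min (hα e) (inv_pos.2 (hα e))
  have h1 : ∀ e, W ≤ C * (min (chart β e) (chart β e)⁻¹) ^ δ := fun e => by
    rcases min_choice (chart β e) (chart β e)⁻¹ with h' | h' <;> rw [h']
    · simpa using h 0 e
    · simpa using h e 0
  have h2 : W ≤ C * ∏ e, (min (chart β e) (chart β e)⁻¹) ^ (δ / (m + 1)) := by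
    have h3 : ∀ x : ℝ, 0 ≤ x → x = ∏ _e : Fin (m + 1), x ^ (1 / ((m : ℝ) + 1)) := fun x hx => by
      rw [Finset.prod_const, Finset.card_univ, Fintype.card_fin, ← Real.rpow_natCast,
        ← Real.rpow_mul hx]
      push_cast
      rw [one_div_mul_cancel hm.ne', Real.rpow_one]
    rw [h3 W hW, h3 C hC, ← Finset.prod_mul_distrib]
    refine Finset.prod_le_prod (fun e _ => by positivity) fun e _ => ?_
    refine (Real.rpow_le_rpow hW (h1 e) (by positivity)).trans (le_of_eq ?_)
    rw [Real.mul_rpow hC (Real.rpow_nonneg (hmin e).le _), ← Real.rpow_mul (hmin e).le]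
    congr 2
    ring
  have h4 : ∏ e, decay (δ / (m + 1)) (β e) = ∏ e, decay (δ / (m + 1)) (chart β e) := by
    rw [prod_chart β (fun _ => decay (δ / (m + 1)))]
    simp [decay]
  rw [h4]
  simp only [decay]
  rw [Finset.prod_mul_distrib]
  have h5 : 0 ≤ ∏ e, (chart β e)⁻¹ := Finset.prod_nonneg fun e _ => (inv_pos.2 (hα e)).le
  calc _ ≤ (C * ∏ e, (min (chart β e) (chart β e)⁻¹) ^ (δ / (m + 1))) * ∏ e, (chart β e)⁻¹ :=
        mul_le_mul_of_nonneg_right h2 h5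
    _ = _ := by ring

namespace FeynmanGraph
variable {nV m : ℕ} {G : FeynmanGraph nV (m + 1)} {d : ℕ}

/-- The domain of analyticity of the kernel. -/
def kernelDom (G : FeynmanGraph nV (m + 1)) :
    Set ((Fin nV → Fin nV → ℂ) × (Fin (m + 1) → ℂ)) :=
  {p | 0 < (G.phiC p.1 p.2).re ∧ 0 < (G.forestC G.singlePart p.2).re}

/-- The domain of squared-distance vectors with positive real parts. -/
def extDom (G : FeynmanGraph nV (m + 1)) : Set (Fin nV → Fin nV → ℂ) :=
  {s | ∀ i ∈ G.ext, ∀ j ∈ G.ext, i < j → 0 < (s i j).re}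

lemma contDiff_forestC (p : Finset (Finset (Fin nV))) :
    ContDiff ℂ ⊤ (fun q : (Fin nV → Fin nV → ℂ) × (Fin (m + 1) → ℂ) => G.forestC p q.2) := by
  unfold forestC
  fun_prop

lemma contDiff_phiC :
    ContDiff ℂ ⊤ (fun q : (Fin nV → Fin nV → ℂ) × (Fin (m + 1) → ℂ) => G.phiC q.1 q.2) := by
  unfold phiC
  refine ContDiff.sum fun i _ => ContDiff.sum fun j _ => ?_
  exact ContDiff.mul (by fun_prop) (contDiff_forestC _)

lemma analyticOnNhd_kernelC :
    AnalyticOnNhd ℂ (fun q : (Fin nV → Fin nV → ℂ) × (Fin (m + 1) → ℂ) => G.kernelC d q.1 q.2)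
      G.kernelDom := by
  intro q hq
  have h1 : AnalyticAt ℂ (fun q : (Fin nV → Fin nV → ℂ) × (Fin (m + 1) → ℂ) => G.phiC q.1 q.2) q :=
    contDiff_phiC.contDiffAt.analyticAt
  have h2 : AnalyticAt ℂ (fun q : (Fin nV → Fin nV → ℂ) × (Fin (m + 1) → ℂ) =>
      G.forestC G.singlePart q.2) q :=
    (contDiff_forestC _).contDiffAt.analyticAt
  exact (h1.cpow analyticAt_const (Or.inl hq.1)).mul (h2.cpow analyticAt_const (Or.inl hq.2))

/-- Around every point of the domain the real parts are uniformly bounded below and the norms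
uniformly bounded above. -/
lemma exists_uniform {s₀ : Fin nV → Fin nV → ℂ} (hs₀ : s₀ ∈ G.extDom) :
    ∃ κ > (0 : ℝ), ∃ K : ℝ, ∃ r > (0 : ℝ), ∀ s ∈ Metric.ball s₀ r,
      (∀ i ∈ G.ext, ∀ j ∈ G.ext, i < j → κ ≤ (s i j).re) ∧ ∀ i j, ‖s i j‖ ≤ K := by
  obtain ⟨κ, hκ, hκs⟩ : ∃ κ > (0 : ℝ), ∀ i ∈ G.ext, ∀ j ∈ G.ext, i < j → κ ≤ (s₀ i j).re := by
    let P := (Finset.univ : Finset (Fin nV × Fin nV)).filter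
      (fun p => p.1 ∈ G.ext ∧ p.2 ∈ G.ext ∧ p.1 < p.2)
    rcases P.eq_empty_or_nonempty with h | h
    · refine ⟨1, one_pos, fun i hi j hj hij => ?_⟩
      have : (i, j) ∈ P := by simp [P, hi, hj, hij]
      simp [h] at this
    · obtain ⟨p, hp, hmin⟩ := P.exists_min_image (fun p => (s₀ p.1 p.2).re) h
      have hp' := (Finset.mem_filter.1 hp).2
      exact ⟨_, hs₀ _ hp'.1 _ hp'.2.1 hp'.2.2, fun i hi j hj hij =>
        hmin (i, j) (by simp [P, hi, hj, hij])⟩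
  have hle : ∀ s : Fin nV → Fin nV → ℂ, ∀ i j, ‖s i j‖ ≤ ‖s‖ := fun s i j =>
    (norm_le_pi_norm (s i) j).trans (norm_le_pi_norm s i)
  refine ⟨κ / 2, half_pos hκ, ‖s₀‖ + κ / 2, κ / 2, half_pos hκ, fun s hs => ⟨?_, fun i j => ?_⟩⟩
  · intro i hi j hj hij
    rw [Metric.mem_ball, dist_eq_norm] at hs
    have h1 := (Complex.abs_re_le_norm ((s - s₀) i j)).trans (hle (s - s₀) i j)
    have h2 := (abs_le.1 h1).1
    simp only [Pi.sub_apply, Complex.sub_re] at h2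
    linarith [hκs i hi j hj hij]
  · rw [Metric.mem_ball, dist_eq_norm] at hs
    have h1 := hle s i j
    have h2 := norm_sub_norm_le s s₀
    linarith

/-- The iterated complex partial derivatives of the kernel. -/
def kernelD (G : FeynmanGraph nV (m + 1)) (d : ℕ) (n : Fin (m + 1) → ℕ) :
    (Fin nV → Fin nV → ℂ) × (Fin (m + 1) → ℂ) → ℂ :=
  (Finset.univ : Finset (Fin (m + 1))).toList.foldr (fun e g => (dirD e)^[n e] g)
    (fun q => G.kernelC d q.1 q.2)

lemma isCauchyOp_multi {S : Type*} [NormedAddCommGroup S] [NormedSpace ℂ S]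
    {U : Set (S × (Fin (m + 1) → ℂ))} (n : Fin (m + 1) → ℕ) :
    IsCauchyOp U (fun f => (Finset.univ : Finset (Fin (m + 1))).toList.foldr
      (fun e g => (dirD e)^[n e] g) f) n := by
  have h := isCauchyOp_foldr (U := U) n (Finset.univ : Finset (Fin (m + 1))).toList
  rwa [Finset.sum_map_toList, Finset.univ_sum_single] at h

lemma analyticOnNhd_kernelD (n : Fin (m + 1) → ℕ) :
    AnalyticOnNhd ℂ (G.kernelD d n) G.kernelDom :=
  (isCauchyOp_multi n).1 _ analyticOnNhd_kernelC

section Convergence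

/-- Locally uniform bound on the integrand of the parametric representation. -/
lemma exists_kernelD_bound (hUV : G.UVConvergent d) (hIR : G.IRConvergent d) (hM : 0 < G.Mdeg d)
    {n : Fin (m + 1) → ℕ} (hn : ∀ e, 0 < (n e : ℝ) + lam d * G.ν e)
    (hcomp : ∀ v : Fin nV, ∃ w ∈ G.ext, (G.edgeGraph Finset.univ).Reachable v w)
    (hconn : G.ExtLinked Finset.univ) :
    ∃ δ > (0 : ℝ), ∀ κ > (0 : ℝ), ∀ K : ℝ, ∃ C : ℝ,
    ∀ s : Fin nV → Fin nV → ℂ, (∀ i ∈ G.ext, ∀ j ∈ G.ext, i < j → κ ≤ (s i j).re) →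
      (∀ i j, ‖s i j‖ ≤ K) →
      (∀ α : Fin (m + 1) → ℝ, (∀ e, 0 < α e) → (s, fun e => (α e : ℂ)) ∈ G.kernelDom) ∧
      ∀ β : {e : Fin (m + 1) // e ≠ 0} → ℝ, (∀ e, 0 < β e) →
        ‖((∏ e, chart β e ^ ((n e : ℝ) + lam d * G.ν e - 1) : ℝ) : ℂ) *
          G.kernelD d n (s, fun e => (chart β e : ℂ))‖ ≤ C * ∏ e, decay δ (β e) := by
  obtain ⟨δ, hδ, H⟩ := exists_kernel_bound hUV hIR hM hn hcomp hconn
  refine ⟨δ / (m + 1), by positivity, fun κ hκ K => ?_⟩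
  obtain ⟨C, hC, c, hc, H⟩ := H κ hκ K
  obtain ⟨-, C', hC', θ, hθ, hθ', H'⟩ := isCauchyOp_multi (U := G.kernelDom) n
  refine ⟨C' * (∏ e, (c ^ n e)⁻¹) * C, fun s hsκ hsK => ⟨fun α hα => ?_, fun β hβ => ?_⟩⟩
  · obtain ⟨B, Q, hB, h1, -⟩ := H α hα
    have := h1 s hsκ hsK (fun e => (α e : ℂ)) (fun e => by simpa using (mul_pos hc (hB e)).le)
    exact ⟨this.1, this.2.1⟩
  · have hα := chart_pos hβ
    obtain ⟨B, Q, hB, h1, h2⟩ := H (chart β) hα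
    have h3 := H' _ analyticOnNhd_kernelC s (fun e => (chart β e : ℂ)) (fun e => c * B e) Q
      (fun e => mul_pos hc (hB e)) (fun ζ hζ => by
        have := h1 s hsκ hsK ζ hζ
        exact ⟨⟨this.1, this.2.1⟩, this.2.2⟩) (fun e => (chart β e : ℂ))
        (fun e => by simpa using (mul_pos hθ (mul_pos hc (hB e))).le)
    have hQ : 0 ≤ Q := (norm_nonneg _).trans
      (h1 s hsκ hsK (fun e => (chart β e : ℂ)) (fun e => by simpa using (mul_pos hc (hB e)).le)).2.2
    set W : ℝ := (∏ e, chart β e ^ ((n e : ℝ) + lam d * G.ν e)) * (∏ e, (B e ^ n e)⁻¹) * Q with hWdef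
    have hW0 : 0 ≤ W := mul_nonneg (mul_nonneg
      (Finset.prod_nonneg fun e _ => Real.rpow_nonneg (hα e).le _)
      (Finset.prod_nonneg fun e _ => inv_nonneg.2 (pow_nonneg (hB e).le _))) hQ
    have h4 := le_prod_decay hC.le hW0 hβ h2
    rw [norm_mul, Complex.norm_real, Real.norm_of_nonneg
      (Finset.prod_nonneg fun e _ => Real.rpow_nonneg (hα e).le _)]
    have hP : 0 ≤ ∏ e, (c ^ n e)⁻¹ := Finset.prod_nonneg fun e _ => by positivity
    calc _ ≤ (∏ e, chart β e ^ ((n e : ℝ) + lam d * G.ν e - 1)) *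
          (C' * Q * ∏ e, ((c * B e) ^ n e)⁻¹) :=
          mul_le_mul_of_nonneg_left h3
            (Finset.prod_nonneg fun e _ => Real.rpow_nonneg (hα e).le _)
      _ = C' * (∏ e, (c ^ n e)⁻¹) * (W * ∏ e, (chart β e)⁻¹) := by
          have h5 : ∏ e, chart β e ^ ((n e : ℝ) + lam d * G.ν e - 1)
              = (∏ e, chart β e ^ ((n e : ℝ) + lam d * G.ν e)) * ∏ e, (chart β e)⁻¹ := by
            rw [← Finset.prod_mul_distrib]
            exact Finset.prod_congr rfl fun e _ => by rw [Real.rpow_sub_one (hα e).ne']; rfl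
          rw [h5, hWdef]
          simp only [mul_pow, mul_inv, Finset.prod_mul_distrib]
          ring
      _ ≤ C' * (∏ e, (c ^ n e)⁻¹) * (C * ∏ e, decay (δ / (m + 1)) (β e)) := by gcongr
      _ = _ := by ring

lemma mem_kernelDom (hUV : G.UVConvergent d) (hIR : G.IRConvergent d) (hM : 0 < G.Mdeg d)
    {n : Fin (m + 1) → ℕ} (hn : ∀ e, 0 < (n e : ℝ) + lam d * G.ν e)
    (hcomp : ∀ v : Fin nV, ∃ w ∈ G.ext, (G.edgeGraph Finset.univ).Reachable v w)
    (hconn : G.ExtLinked Finset.univ)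
    {s : Fin nV → Fin nV → ℂ} (hs : s ∈ G.extDom) {α : Fin (m + 1) → ℝ}
    (hα : ∀ e, 0 < α e) : (s, fun e => (α e : ℂ)) ∈ G.kernelDom := by
  obtain ⟨δ, hδ, H⟩ := exists_kernelD_bound hUV hIR hM hn hcomp hconn
  obtain ⟨κ, hκ, K, r, hr, h⟩ := exists_uniform hs
  obtain ⟨C, hC⟩ := H κ hκ K
  have h' := h s (Metric.mem_ball_self hr)
  exact (hC s h'.1 h'.2).1 α hα

lemma multiDerivC_eq (hUV : G.UVConvergent d) (hIR : G.IRConvergent d) (hM : 0 < G.Mdeg d)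
    {n : Fin (m + 1) → ℕ} (hn : ∀ e, 0 < (n e : ℝ) + lam d * G.ν e)
    (hcomp : ∀ v : Fin nV, ∃ w ∈ G.ext, (G.edgeGraph Finset.univ).Reachable v w)
    (hconn : G.ExtLinked Finset.univ)
    {s : Fin nV → Fin nV → ℂ} (hs : s ∈ G.extDom) {α : Fin (m + 1) → ℝ}
    (hα : ∀ e, 0 < α e) :
    multiDerivC n (fun α => G.phiTildeS s α ^ (-(G.Mdeg d : ℂ)) *
        ((G.psiTilde α : ℝ) : ℂ) ^ (-((((d : ℝ) / 2 - G.Mdeg d : ℝ)) : ℂ))) α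
      = G.kernelD d n (s, fun e => (α e : ℂ)) := by
  refine (IsRestriction.multiDeriv (U := G.kernelDom) (s := s)
    (fun α hα => mem_kernelDom hUV hIR hM hn hcomp hconn hs hα)
    ⟨analyticOnNhd_kernelC (d := d), fun α _ => ?_⟩ n).2 α hα
  rw [kernelC, phiC_ofReal, forestC_ofReal]
  rfl

lemma dualIntegrandC_eq (hUV : G.UVConvergent d) (hIR : G.IRConvergent d) (hM : 0 < G.Mdeg d)
    {n : Fin (m + 1) → ℕ} (hn : ∀ e, 0 < (n e : ℝ) + lam d * G.ν e)
    (hcomp : ∀ v : Fin nV, ∃ w ∈ G.ext, (G.edgeGraph Finset.univ).Reachable v w)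
    (hconn : G.ExtLinked Finset.univ)
    {s : Fin nV → Fin nV → ℂ} (hs : s ∈ G.extDom)
    {β : {e : Fin (m + 1) // e ≠ 0} → ℝ} (hβ : ∀ e, 0 < β e) :
    dualIntegrandC d G n s β = ((∏ e, chart β e ^ ((n e : ℝ) + lam d * G.ν e - 1) : ℝ) : ℂ) *
      G.kernelD d n (s, fun e => (chart β e : ℂ)) := by
  rw [dualIntegrandC, multiDerivC_eq hUV hIR hM hn hcomp hconn hs (chart_pos hβ)]

lemma continuousOn_weight (a : Fin (m + 1) → ℝ) :
    ContinuousOn (fun β : {e : Fin (m + 1) // e ≠ 0} → ℝ => ∏ e, chart β e ^ a e)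
      {β | ∀ e, 0 < β e} :=
  continuousOn_finsetProd _ fun e _ => ContinuousOn.rpow_const
    ((continuous_apply e).comp continuous_chart).continuousOn fun _ hβ =>
      Or.inl (chart_pos hβ e).ne'

lemma aestronglyMeasurable_dualIntegrandC (hUV : G.UVConvergent d) (hIR : G.IRConvergent d) (hM : 0 < G.Mdeg d)
    {n : Fin (m + 1) → ℕ} (hn : ∀ e, 0 < (n e : ℝ) + lam d * G.ν e)
    (hcomp : ∀ v : Fin nV, ∃ w ∈ G.ext, (G.edgeGraph Finset.univ).Reachable v w)
    (hconn : G.ExtLinked Finset.univ)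
    {s : Fin nV → Fin nV → ℂ} (hs : s ∈ G.extDom) :
    AEStronglyMeasurable (dualIntegrandC d G n s)
      (volume.restrict {β : {e : Fin (m + 1) // e ≠ 0} → ℝ | ∀ e, 0 < β e}) := by
  refine ContinuousOn.aestronglyMeasurable ?_ measurableSet_orthant
  have hc : ContinuousOn (fun β => ((∏ e, chart β e ^ ((n e : ℝ) + lam d * G.ν e - 1) : ℝ) : ℂ) *
      G.kernelD d n (s, fun e => (chart β e : ℂ)))
      {β : {e : Fin (m + 1) // e ≠ 0} → ℝ | ∀ e, 0 < β e} := by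
    refine (Complex.continuous_ofReal.comp_continuousOn (continuousOn_weight _)).mul ?_
    refine (analyticOnNhd_kernelD n).continuousOn.comp (Continuous.continuousOn ?_)
      fun β hβ => mem_kernelDom hUV hIR hM hn hcomp hconn hs (chart_pos hβ)
    exact continuous_const.prodMk (continuous_pi fun e => Complex.continuous_ofReal.comp
      ((continuous_apply e).comp continuous_chart))
  exact hc.congr fun β hβ => dualIntegrandC_eq hUV hIR hM hn hcomp hconn hs hβ

/-- Absolute convergence of the parametric integral. -/
lemma integrableOn_dualIntegrandC (hUV : G.UVConvergent d) (hIR : G.IRConvergent d) (hM : 0 < G.Mdeg d)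
    {n : Fin (m + 1) → ℕ} (hn : ∀ e, 0 < (n e : ℝ) + lam d * G.ν e)
    (hcomp : ∀ v : Fin nV, ∃ w ∈ G.ext, (G.edgeGraph Finset.univ).Reachable v w)
    (hconn : G.ExtLinked Finset.univ)
    {s : Fin nV → Fin nV → ℂ} (hs : s ∈ G.extDom) :
    IntegrableOn (dualIntegrandC d G n s)
      {β : {e : Fin (m + 1) // e ≠ 0} → ℝ | ∀ e, 0 < β e} := by
  obtain ⟨δ, hδ, H⟩ := exists_kernelD_bound hUV hIR hM hn hcomp hconn
  obtain ⟨κ, hκ, K, r, hr, h⟩ := exists_uniform hs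
  obtain ⟨C, hC⟩ := H κ hκ K
  have h' := h s (Metric.mem_ball_self hr)
  refine ((integrableOn_prod_decay hδ).const_mul C).mono'
    (aestronglyMeasurable_dualIntegrandC hUV hIR hM hn hcomp hconn hs) ?_
  refine (ae_restrict_iff' measurableSet_orthant).2 (Filter.Eventually.of_forall fun β hβ => ?_)
  rw [dualIntegrandC_eq hUV hIR hM hn hcomp hconn hs hβ]
  exact (hC s h'.1 h'.2).2 β hβ

/-- Holomorphy of the parametric integral. -/
lemma differentiableOn_Fcont (hUV : G.UVConvergent d) (hIR : G.IRConvergent d) (hM : 0 < G.Mdeg d)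
    {n : Fin (m + 1) → ℕ} (hn : ∀ e, 0 < (n e : ℝ) + lam d * G.ν e)
    (hcomp : ∀ v : Fin nV, ∃ w ∈ G.ext, (G.edgeGraph Finset.univ).Reachable v w)
    (hconn : G.ExtLinked Finset.univ) :
    DifferentiableOn ℂ (Fcont d G n) G.extDom := by
  intro s₀ hs₀
  refine DifferentiableAt.differentiableWithinAt ?_
  unfold Fcont
  refine DifferentiableAt.const_mul ?_ _
  obtain ⟨δ, hδ, H⟩ := exists_kernelD_bound hUV hIR hM hn hcomp hconn
  obtain ⟨κ, hκ, K, r, hr, h⟩ := exists_uniform hs₀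
  obtain ⟨C, hC⟩ := H κ hκ K
  have hball : Metric.ball s₀ r ⊆ G.extDom := fun s hs i hi j hj hij =>
    hκ.trans_le ((h s hs).1 i hi j hj hij)
  have hae : ∀ {P : ({e : Fin (m + 1) // e ≠ 0} → ℝ) → Prop}, (∀ β, (∀ e, 0 < β e) → P β) →
      ∀ᵐ β ∂(volume.restrict {β : {e : Fin (m + 1) // e ≠ 0} → ℝ | ∀ e, 0 < β e}), P β :=
    fun hP => (ae_restrict_iff' measurableSet_orthant).2 (Filter.Eventually.of_forall hP)
  have hder : ∀ β : {e : Fin (m + 1) // e ≠ 0} → ℝ, (∀ e, 0 < β e) → ∀ s ∈ Metric.ball s₀ r,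
      HasFDerivAt (fun s => dualIntegrandC d G n s β)
        (((∏ e, chart β e ^ ((n e : ℝ) + lam d * G.ν e - 1) : ℝ) : ℂ) •
          (fderiv ℂ (G.kernelD d n) (s, fun e => (chart β e : ℂ))).comp
            (ContinuousLinearMap.inl ℂ (Fin nV → Fin nV → ℂ) (Fin (m + 1) → ℂ))) s := by
    intro β hβ s hs
    have hmem := mem_kernelDom hUV hIR hM hn hcomp hconn (hball hs) (chart_pos hβ)
    have h1 := (analyticOnNhd_kernelD (d := d) n _ hmem).differentiableAt.hasFDerivAt
    have h2 : HasFDerivAt (fun s : Fin nV → Fin nV → ℂ => (s, fun e => (chart β e : ℂ)))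
        (ContinuousLinearMap.inl ℂ (Fin nV → Fin nV → ℂ) (Fin (m + 1) → ℂ)) s :=
      hasFDerivAt_prodMk_left _ _
    refine ((h1.comp s h2).const_mul
      ((∏ e, chart β e ^ ((n e : ℝ) + lam d * G.ν e - 1) : ℝ) : ℂ)).congr_of_eventuallyEq ?_
    filter_upwards [Metric.isOpen_ball.mem_nhds hs] with s' hs'
    exact dualIntegrandC_eq hUV hIR hM hn hcomp hconn (hball hs') hβ
  refine differentiableAt_integral_of_dominated hr (b := fun β => C * ∏ e, decay δ (β e))
    (fun s hs => aestronglyMeasurable_dualIntegrandC hUV hIR hM hn hcomp hconn (hball hs)) ?_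
    (hae fun β hβ s hs => ?_) ((integrableOn_prod_decay hδ).const_mul C)
    (hae fun β hβ s hs => (hder β hβ s hs).differentiableAt.differentiableWithinAt)
    (hae fun β hβ => hder β hβ s₀ (Metric.mem_ball_self hr))
  · refine ContinuousOn.aestronglyMeasurable ?_ measurableSet_orthant
    refine (Complex.continuous_ofReal.comp_continuousOn (continuousOn_weight _)).smul ?_
    refine ContinuousOn.clm_comp ?_ continuousOn_const
    refine (analyticOnNhd_kernelD (d := d) n).fderiv.continuousOn.comp (Continuous.continuousOn ?_)
      fun β hβ => mem_kernelDom hUV hIR hM hn hcomp hconn hs₀ (chart_pos hβ)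
    exact continuous_const.prodMk (continuous_pi fun e => Complex.continuous_ofReal.comp
      ((continuous_apply e).comp continuous_chart))
  · rw [dualIntegrandC_eq hUV hIR hM hn hcomp hconn (hball hs) hβ]
    exact (hC s (h s hs).1 (h s hs).2).2 β hβ

end Convergence

end FeynmanGraph

section GramDeterminant

variable {ι κ : Type*} [Fintype ι] [DecidableEq ι]

/-- The weighted Gram matrix `∑ e, α e • b e (b e)ᵀ`. -/
def gram (b : ι → κ → ℝ) (α : ι → ℝ) : Matrix κ κ ℝ :=
  Matrix.of fun i j => ∑ e, α e * (b e i * b e j)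

/-- The indicator function of a finite set. -/
def indic (F : Finset ι) (e : ι) : ℝ := if e ∈ F then 1 else 0

lemma gram_indic_apply (b : ι → κ → ℝ) (F : Finset ι) (i j : κ) :
    gram b (indic F) i j = ∑ e ∈ F, b e i * b e j := by
  simp [gram, indic]

variable [Fintype κ] [DecidableEq κ]

lemma det_gram_expand (b : ι → κ → ℝ) (α : ι → ℝ) :
    (gram b α).det = ∑ F ∈ (Finset.univ : Finset (Finset ι)).filter
        (fun F => F.card = Fintype.card κ), (∏ e ∈ F, α e) *
      ∑ f ∈ (Finset.univ : Finset (κ → ι)).filter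
        (fun f => Function.Injective f ∧ Finset.univ.image f = F),
        (∏ i, b (f i) i) * (Matrix.of fun i => b (f i)).det := by
  have h1 : (gram b α).det = ∑ f : κ → ι, (∏ i, α (f i) * b (f i) i) *
      (Matrix.of fun i => b (f i)).det := by
    have hrow : gram b α = fun i => ∑ e, (α e * b e i) • b e := by
      ext i j
      simp [gram, Finset.sum_apply, mul_assoc]
    rw [hrow]
    have h := MultilinearMap.map_sum (Matrix.detRowAlternating (n := κ) (R := ℝ)).toMultilinearMap
      (fun (i : κ) (e : ι) => (α e * b e i) • b e)
    refine h.trans (Finset.sum_congr rfl fun f _ => ?_)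
    exact (MultilinearMap.map_smul_univ _ _ _).trans rfl
  have h2 : ∀ f : κ → ι, ¬ Function.Injective f → (∏ i, α (f i) * b (f i) i) *
      (Matrix.of fun i => b (f i)).det = 0 := fun f hf => by
    rw [Function.Injective] at hf
    push Not at hf
    obtain ⟨i, j, hij, hne⟩ := hf
    rw [Matrix.det_zero_of_row_eq hne, mul_zero]
    ext k
    simp [hij]
  rw [h1, ← Finset.sum_filter_add_sum_filter_not _ (fun f => Function.Injective f),
    Finset.sum_eq_zero (s := Finset.univ.filter fun f => ¬ Function.Injective f)
      (fun f hf => h2 f (Finset.mem_filter.1 hf).2), add_zero,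
    ← Finset.sum_fiberwise_of_maps_to (g := fun f : κ → ι => Finset.univ.image f)
      (t := Finset.univ.filter (fun F => F.card = Fintype.card κ))
      (fun f hf => by
        simp [Finset.card_image_of_injective _ (Finset.mem_filter.1 hf).2])]
  refine Finset.sum_congr rfl fun F _ => ?_
  rw [Finset.mul_sum, Finset.filter_filter]
  refine Finset.sum_congr rfl fun f hf => ?_
  obtain ⟨-, hinj, rfl⟩ := Finset.mem_filter.1 hf
  rw [Finset.prod_image (fun _ _ _ _ h => hinj h), Finset.prod_mul_distrib]
  ring

/-- The Cauchy–Binet formula for weighted Gram matrices. -/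
lemma det_gram (b : ι → κ → ℝ) (α : ι → ℝ) :
    (gram b α).det = ∑ F ∈ (Finset.univ : Finset (Finset ι)).filter
        (fun F => F.card = Fintype.card κ), (∏ e ∈ F, α e) * (gram b (indic F)).det := by
  rw [det_gram_expand]
  refine Finset.sum_congr rfl fun F hF => congrArg _ ?_
  have hF' := (Finset.mem_filter.1 hF).2
  rw [det_gram_expand b (indic F), Finset.sum_eq_single F]
  · rw [Finset.prod_eq_one (fun e he => by simp [indic, he]), one_mul]
  · intro F' hF'' hne
    have hcard := (Finset.mem_filter.1 hF'').2
    have : ¬ F' ⊆ F := fun h => hne (Finset.eq_of_subset_of_card_le h (by omega))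
    obtain ⟨e, he, heF⟩ := Finset.not_subset.1 this
    rw [Finset.prod_eq_zero he (by simp [indic, heF]), zero_mul]
  · exact fun h => absurd hF h

lemma det_gram_eq_zero {b : ι → κ → ℝ} {F : Finset ι} {w : κ → ℝ} (hw : w ≠ 0)
    (h : ∀ e ∈ F, ∑ k, b e k * w k = 0) : (gram b (indic F)).det = 0 := by
  refine Matrix.exists_mulVec_eq_zero_iff.1 ⟨w, hw, ?_⟩
  ext i
  simp only [Matrix.mulVec, dotProduct, gram_indic_apply, Finset.sum_mul, Pi.zero_apply]
  rw [Finset.sum_comm]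
  refine Finset.sum_eq_zero fun e he => ?_
  simp only [mul_assoc]
  rw [← Finset.mul_sum, h e he, mul_zero]

lemma det_gram_eq_sq {b : ι → κ → ℝ} {F : Finset ι} (σ : κ ≃ F) :
    (gram b (indic F)).det = (Matrix.of fun i k => b (σ k) i).det ^ 2 := by
  have h : gram b (indic F) = (Matrix.of fun i k => b (σ k) i) *
      (Matrix.of fun i k => b (σ k) i).transpose := by
    ext i j
    rw [gram_indic_apply, Matrix.mul_apply, ← Finset.sum_coe_sort F, ← σ.sum_comp]
    rfl
  rw [h, Matrix.det_mul, Matrix.det_transpose, sq]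

/-- Vectors with integer entries which span the integer lattice have Gram determinant one. -/
lemma det_gram_eq_one {b : ι → κ → ℝ} {F : Finset ι} (hF : F.card = Fintype.card κ)
    (hint : ∀ e k, ∃ z : ℤ, b e k = z)
    (hspan : ∀ k, (Pi.single k 1 : κ → ℝ) ∈ Submodule.span ℤ (b '' F)) :
    (gram b (indic F)).det = 1 := by
  obtain ⟨σ⟩ : Nonempty (κ ≃ F) := Fintype.card_eq.1 (by simp [hF])
  choose z hz using hint
  have h1 : ∀ k, ∃ c : κ → ℤ, ∑ l, c l • b (σ l) = (Pi.single k 1 : κ → ℝ) := fun k => by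
    have h2 := hspan k
    have h3 : b '' (F : Set ι) = Set.range fun l => b (σ l) := by
      ext v
      constructor
      · rintro ⟨e, he, rfl⟩
        exact ⟨σ.symm ⟨e, he⟩, by simp⟩
      · rintro ⟨l, rfl⟩
        exact ⟨σ l, (σ l).2, rfl⟩
    rw [h3, Submodule.mem_span_range_iff_exists_fun] at h2
    exact h2
  choose c hc using h1
  let Z : Matrix κ κ ℤ := Matrix.of fun i k => z (σ k) i
  let C : Matrix κ κ ℤ := Matrix.of fun l k => c k l
  have hZC : Z * C = 1 := by
    ext i k
    have h4 := congrFun (hc k) i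
    rw [Finset.sum_apply] at h4
    rw [Matrix.mul_apply, Matrix.one_apply]
    have h5 : ((∑ l, Z i l * C l k : ℤ) : ℝ) = ((if i = k then 1 else 0 : ℤ) : ℝ) := by
      push_cast
      simp only [Z, C, Matrix.of_apply]
      simp only [Pi.single_apply] at h4
      rw [← h4]
      refine Finset.sum_congr rfl fun l _ => ?_
      rw [Pi.smul_apply, zsmul_eq_mul, hz, mul_comm]
    exact_mod_cast h5
  have hdet : IsUnit Z.det := by
    have h6 := congrArg Matrix.det hZC
    rw [Matrix.det_mul, Matrix.det_one] at h6
    exact IsUnit.of_mul_eq_one _ h6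
  have hZ : (Matrix.of fun i k => b (σ k) i) = Z.map (Int.castRingHom ℝ) := by
    ext i k
    simp [Z, hz]
  have h7 : (Z.map (Int.castRingHom ℝ)).det = ((Z.det : ℤ) : ℝ) :=
    (RingHom.map_det (Int.castRingHom ℝ) Z).symm
  rw [det_gram_eq_sq σ, hZ, h7]
  rcases Int.isUnit_iff.1 hdet with h | h <;> simp [h]

end GramDeterminant

namespace FeynmanGraph
variable {nV nE : ℕ} {G : FeynmanGraph nV nE}

lemma offRoots_single_mem_span_int {R : Finset (Fin nV)} {F : Finset (Fin nE)} {v r : Fin nV}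
    (hr : r ∈ R) (h : (G.edgeGraph F).Reachable v r) :
    offRoots R (Pi.single v 1) ∈ Submodule.span ℤ (G.incOff R '' F) := by
  have h1 : (offRoots R (Pi.single v 1) ∈ Submodule.span ℤ (G.incOff R '' F)) =
      (offRoots R (Pi.single r 1) ∈ Submodule.span ℤ (G.incOff R '' F)) := by
    refine eq_of_reachable
      (φ := fun v => offRoots R (Pi.single v 1) ∈ Submodule.span ℤ (G.incOff R '' F))
      (fun e he => propext ?_) h
    have h2 : offRoots R (Pi.single (G.ends e).1 1) - offRoots R (Pi.single (G.ends e).2 1) ∈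
        Submodule.span ℤ (G.incOff R '' F) := by
      rw [← map_sub]
      exact Submodule.subset_span ⟨e, he, rfl⟩
    exact ⟨fun h => by simpa using Submodule.sub_mem _ h h2,
      fun h => by simpa using Submodule.add_mem _ h2 h⟩
  rw [h1, offRoots_single_of_mem hr]
  exact Submodule.zero_mem _

lemma det_gram_of_isRootedForest {R : Finset (Fin nV)} {F : Finset (Fin nE)}
    (h : G.IsRootedForest R F) : (gram (G.incOff R) (indic F)).det = 1 := by
  refine det_gram_eq_one (by have := card_off R; have := h.1; omega) (fun e k => ?_) fun k => ?_
  · refine ⟨(if (k : Fin nV) = (G.ends e).1 then 1 else 0) -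
      (if (k : Fin nV) = (G.ends e).2 then 1 else 0), ?_⟩
    simp [incOff, offRoots, LinearMap.funLeft, inc, Pi.single_apply]
  · obtain ⟨r, hr, hreach⟩ := h.2 k
    rw [← offRoots_single]
    exact offRoots_single_mem_span_int hr hreach

lemma sum_incOff_add (e : Fin nE) (φ : Fin nV → ℝ) :
    ∑ k, G.incOff G.ext e k * φ k + ∑ r ∈ G.ext, G.inc e r * φ r
      = φ (G.ends e).1 - φ (G.ends e).2 := by
  rw [← sum_inc_mul, ← sum_off_add_sum G.ext]
  rfl

/-- The incidence vector of an edge, bordered by its pairing with the external positions. -/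
def border (G : FeynmanGraph nV nE) (x : Fin nV → ℝ) (e : Fin nE) : {v // v ∉ G.ext} ⊕ Unit → ℝ :=
  Sum.elim (G.incOff G.ext e) (fun _ => ∑ r ∈ G.ext, G.inc e r * x r)

/-- If a vertex is not connected to the external vertices, there is a nonzero function supported on
the internal vertices which is constant along the edges. -/
lemma exists_of_not_reachesExt {F : Finset (Fin nE)} {v : Fin nV} (hv : ¬ G.ReachesExt F v) :
    ∃ w : {v // v ∉ G.ext} → ℝ, w ≠ 0 ∧ ∀ e ∈ F, ∑ k, G.incOff G.ext e k * w k = 0 := by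
  have hvR : v ∉ G.ext := fun hr => hv ⟨v, hr, SimpleGraph.Reachable.refl _⟩
  let φ : Fin nV → ℝ := fun w => if (G.edgeGraph F).Reachable v w then 1 else 0
  refine ⟨fun k => φ k, fun h => ?_, fun e he => ?_⟩
  · have := congrFun h ⟨v, hvR⟩
    simp [φ] at this
  · rw [sum_incOff_mul G.ext e φ fun r hr => if_neg fun h => hv ⟨r, hr, h⟩]
    have h1 : (G.edgeGraph F).Reachable v (G.ends e).1 ↔ (G.edgeGraph F).Reachable v (G.ends e).2 :=
      ⟨fun h => h.trans (reachable_ends he), fun h => h.trans (reachable_ends he).symm⟩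
    simp [φ, h1]

/-- The matrix tree theorem: `Ψ̃` is the determinant of the reduced weighted Laplacian. -/
lemma psiTilde_eq_det (α : Fin nE → ℝ) : G.psiTilde α = (gram (G.incOff G.ext) α).det := by
  rw [psiTilde, dualForestPoly, det_gram]
  have hcard := card_off G.ext
  refine (Finset.sum_subset_zero_on_sdiff (fun F hF => ?_) (fun F hF => ?_) fun F hF => ?_)
  · have := (mem_forests_singlePart.1 hF).1
    simp only [Finset.mem_filter, Finset.mem_univ, true_and]
    omega
  · obtain ⟨h1, h2⟩ := Finset.mem_sdiff.1 hF
    have h3 := (Finset.mem_filter.1 h1).2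
    have h4 : ∃ v, ¬ G.ReachesExt F v := by
      by_contra! h
      exact h2 (mem_forests_singlePart.2 ⟨by omega, h⟩)
    obtain ⟨v, hv⟩ := h4
    obtain ⟨w, hw, hw'⟩ := exists_of_not_reachesExt hv
    rw [det_gram_eq_zero hw hw', mul_zero]
  · rw [det_gram_of_isRootedForest (mem_forests_singlePart.1 hF), mul_one]

/-- The vertices of a rooted forest inherit the values at the roots. -/
lemma exists_potential {R : Finset (Fin nV)} {F : Finset (Fin nE)} (x : Fin nV → ℝ)
    (h : ∀ v, ∃ r ∈ R, (G.edgeGraph F).Reachable v r)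
    (h' : ∀ r ∈ R, ∀ r' ∈ R, r ≠ r' → ¬ (G.edgeGraph F).Reachable r r') :
    ∃ φ : Fin nV → ℝ, (∀ e ∈ F, φ (G.ends e).1 = φ (G.ends e).2) ∧
      ∀ v, ∀ r ∈ R, (G.edgeGraph F).Reachable v r → φ v = x r := by
  choose ρ hρ hρ' using h
  have huniq : ∀ v, ∀ r ∈ R, (G.edgeGraph F).Reachable v r → ρ v = r := fun v r hr hv => by
    by_contra hne
    exact h' _ (hρ v) _ hr hne ((hρ' v).symm.trans hv)
  refine ⟨fun v => x (ρ v), fun e he => ?_, fun v r hr hv => by simp only [huniq v r hr hv]⟩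
  simp only [huniq _ _ (hρ (G.ends e).2) ((reachable_ends he).trans (hρ' _))]

lemma det_gram_border_of_mem {x : Fin nV → ℝ} {F : Finset (Fin nE)} {i j : Fin nV}
    (hi : i ∈ G.ext) (hj : j ∈ G.ext) (hij : i ≠ j) (hF : F ∈ G.forests (G.pairPart i j)) :
    (gram (G.border x) (indic F)).det = (x i - x j) ^ 2 := by
  obtain ⟨hroot, hreach⟩ := (mem_forests_pairPart hi hj hij).1 hF
  have hj' : j ∈ G.ext.erase i := Finset.mem_erase.2 ⟨hij.symm, hj⟩
  obtain ⟨φ, hφ, hφx⟩ := exists_potential x hroot.2 fun r hr r' hr' hne =>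
    hroot.not_reachable hr hr' hne
  let ρ : {v // v ∉ G.ext} ⊕ Unit → {v // v ∉ G.ext.erase i} :=
    Sum.elim (fun v => ⟨v, fun h => v.2 (Finset.mem_of_mem_erase h)⟩) (fun _ => ⟨i, by simp⟩)
  have hρ : Function.Bijective ρ := by
    constructor
    · rintro (⟨a, ha⟩ | a) (⟨b, hb⟩ | b) hab
      · simpa [ρ] using hab
      · have : a = i := by simpa [ρ] using hab
        exact absurd (this ▸ hi) ha
      · have : i = b := by simpa [ρ] using hab
        exact absurd (this ▸ hi) hb
      · rfl
    · rintro ⟨v, hv⟩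
      by_cases hvi : v = i
      · subst hvi
        exact ⟨Sum.inr (), rfl⟩
      · exact ⟨Sum.inl ⟨v, fun h => hv (Finset.mem_erase.2 ⟨hvi, h⟩)⟩, rfl⟩
  let z : Fin nE → {v // v ∉ G.ext} ⊕ Unit → ℝ := fun e k => G.incOff (G.ext.erase i) e (ρ k)
  have hz : (gram z (indic F)).det = 1 := by
    have h1 : gram z (indic F) = (gram (G.incOff (G.ext.erase i)) (indic F)).submatrix
        (Equiv.ofBijective ρ hρ) (Equiv.ofBijective ρ hρ) := rfl
    rw [h1, Matrix.det_submatrix_equiv_self, det_gram_of_isRootedForest hroot]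
  let T : Matrix ({v // v ∉ G.ext} ⊕ Unit) ({v // v ∉ G.ext} ⊕ Unit) ℝ :=
    Matrix.fromBlocks 1 0 (Matrix.of fun _ v => -φ v) (Matrix.of fun _ _ => x i - x j)
  have hT : T.det = x i - x j := by
    simp [T, Matrix.det_fromBlocks_zero₁₂]
  have hb : ∀ e ∈ F, G.border x e = T.mulVec (z e) := by
    intro e he
    ext k
    rcases k with k | k
    · simp [T, Matrix.mulVec, dotProduct, Fintype.sum_sum_type, Matrix.one_apply, border]
      rfl
    · have h1 := G.sum_incOff_add e φ
      rw [hφ e he, sub_self] at h1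
      have h2 : ∑ r ∈ G.ext, G.inc e r * x r
          = ∑ r ∈ G.ext, G.inc e r * φ r + G.inc e i * (x i - x j) := by
        have h3 : ∀ r ∈ G.ext.erase i, G.inc e r * x r = G.inc e r * φ r := fun r hr => by
          rw [hφx r r hr (SimpleGraph.Reachable.refl _)]
        rw [← Finset.add_sum_erase _ _ hi, ← Finset.add_sum_erase _ (fun r => G.inc e r * φ r) hi,
          Finset.sum_congr rfl h3, hφx i j hj' hreach]
        ring
      have h4 : T.mulVec (z e) (Sum.inr k)
          = -∑ k, G.incOff G.ext e k * φ k + G.inc e i * (x i - x j) := by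
        simp only [T, Matrix.mulVec, dotProduct, Fintype.sum_sum_type, Matrix.fromBlocks_apply₂₁,
          Matrix.fromBlocks_apply₂₂, Matrix.of_apply, Finset.univ_unique, Finset.sum_singleton]
        rw [← Finset.sum_neg_distrib]
        congr 1
        · exact Finset.sum_congr rfl fun v _ => by rw [neg_mul, mul_comm]; rfl
        · rw [mul_comm]; rfl
      rw [h4, border, Sum.elim_inr, h2]
      linarith
  have hgram : gram (G.border x) (indic F) = T * gram z (indic F) * T.transpose := by
    ext k l
    rw [gram_indic_apply, Matrix.mul_apply]
    simp only [Matrix.mul_apply, gram_indic_apply, Matrix.transpose_apply]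
    calc ∑ e ∈ F, G.border x e k * G.border x e l
        = ∑ e ∈ F, (∑ a, T k a * z e a) * ∑ b, T l b * z e b :=
          Finset.sum_congr rfl fun e he => by rw [hb e he]; rfl
      _ = ∑ b, (∑ a, T k a * ∑ e ∈ F, z e a * z e b) * T l b := by
          simp only [Finset.mul_sum, Finset.sum_mul]
          rw [Finset.sum_comm]
          refine (Finset.sum_congr rfl fun a _ => Finset.sum_comm).trans ?_
          refine Finset.sum_congr rfl fun b _ => Finset.sum_congr rfl fun a _ =>
            Finset.sum_congr rfl fun e _ => by ring
  rw [hgram, Matrix.det_mul, Matrix.det_mul, Matrix.det_transpose, hz, hT]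
  ring

lemma mem_forests_pairPart_comm {F : Finset (Fin nE)} {i j : Fin nV} :
    F ∈ G.forests (G.pairPart i j) ↔ F ∈ G.forests (G.pairPart j i) := by
  rw [pairPart, pairPart, Finset.pair_comm, Finset.erase_right_comm]

lemma linked_mem_of_mem_forests {F : Finset (Fin nE)} {i j i' j' : Fin nV} (hi : i ∈ G.ext)
    (hj : j ∈ G.ext) (hij : i ≠ j) (hF : F ∈ G.forests (G.pairPart i j)) (hi' : i' ∈ G.ext)
    (hj' : j' ∈ G.ext) (hij' : i' ≠ j') (h : (G.edgeGraph F).Reachable i' j') :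
    i = i' ∨ i = j' := by
  by_contra! hne
  obtain ⟨hroot, -⟩ := (mem_forests_pairPart hi hj hij).1 hF
  exact hroot.not_reachable (Finset.mem_erase.2 ⟨hne.1.symm, hi'⟩)
    (Finset.mem_erase.2 ⟨hne.2.symm, hj'⟩) hij' h

lemma det_gram_border_indic {F : Finset (Fin nE)} (x : Fin nV → ℝ)
    (hF : F.card = Fintype.card {v // v ∉ G.ext} + 1) :
    (gram (G.border x) (indic F)).det = ∑ i ∈ G.ext, ∑ j ∈ G.ext.filter (fun j => i < j),
      if F ∈ G.forests (G.pairPart i j) then (x i - x j) ^ 2 else 0 := by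
  have hcard := card_off G.ext
  by_cases hex : ∃ i ∈ G.ext, ∃ j ∈ G.ext, i < j ∧ F ∈ G.forests (G.pairPart i j)
  · obtain ⟨i, hi, j, hj, hij, hmem⟩ := hex
    have huniq : ∀ i' ∈ G.ext, ∀ j' ∈ G.ext, i' < j' → F ∈ G.forests (G.pairPart i' j') →
        i' = i ∧ j' = j := fun i' hi' j' hj' hij' hmem' => by
      have h := ((mem_forests_pairPart hi' hj' hij'.ne).1 hmem').2
      have h1 := linked_mem_of_mem_forests hi hj hij.ne hmem hi' hj' hij'.ne h
      have h2 := linked_mem_of_mem_forests hj hi hij.ne' (mem_forests_pairPart_comm.1 hmem)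
        hi' hj' hij'.ne h
      rcases h1 with rfl | rfl <;> rcases h2 with rfl | rfl
      · exact absurd hij (lt_irrefl _)
      · exact ⟨rfl, rfl⟩
      · exact absurd (hij.trans hij') (lt_irrefl _)
      · exact absurd hij (lt_irrefl _)
    rw [det_gram_border_of_mem hi hj hij.ne hmem, Finset.sum_eq_single_of_mem i hi,
      Finset.sum_eq_single_of_mem j (Finset.mem_filter.2 ⟨hj, hij⟩), if_pos hmem]
    · intro j' hj' hne
      rw [if_neg]
      intro h
      obtain ⟨hj'', hij'⟩ := Finset.mem_filter.1 hj'
      exact hne (huniq i hi j' hj'' hij' h).2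
    · intro i' hi' hne
      refine Finset.sum_eq_zero fun j' hj' => ?_
      rw [if_neg]
      intro h
      obtain ⟨hj'', hij'⟩ := Finset.mem_filter.1 hj'
      exact hne (huniq i' hi' j' hj'' hij' h).1
  · rw [Finset.sum_eq_zero fun i hi => Finset.sum_eq_zero fun j hj => if_neg fun h => hex
      ⟨i, hi, j, (Finset.mem_filter.1 hj).1, (Finset.mem_filter.1 hj).2, h⟩]
    by_cases hr : ∀ v, G.ReachesExt F v
    · have hnl : ∀ r ∈ G.ext, ∀ r' ∈ G.ext, r ≠ r' → ¬ (G.edgeGraph F).Reachable r r' := by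
        intro i hi j hj hij hreach
        have hcard' := Finset.card_erase_add_one hi
        have hmem : F ∈ G.forests (G.pairPart i j) := by
          refine (mem_forests_pairPart hi hj hij).2 ⟨⟨by omega, fun v => ?_⟩, hreach⟩
          obtain ⟨r, hr, hv⟩ := hr v
          by_cases hri : r = i
          · exact ⟨j, Finset.mem_erase.2 ⟨hij.symm, hj⟩, hv.trans (hri ▸ hreach)⟩
          · exact ⟨r, Finset.mem_erase.2 ⟨hri, hr⟩, hv⟩
        rcases lt_or_gt_of_ne hij with h | h
        · exact hex ⟨i, hi, j, hj, h, hmem⟩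
        · exact hex ⟨j, hj, i, hi, h, mem_forests_pairPart_comm.1 hmem⟩
      obtain ⟨φ, hφ, hφx⟩ := exists_potential x hr hnl
      refine det_gram_eq_zero (w := Sum.elim (fun k => φ k) (fun _ => 1)) (fun h => ?_)
        fun e he => ?_
      · simpa using congrFun h (Sum.inr ())
      · have h1 := G.sum_incOff_add e φ
        rw [hφ e he, sub_self] at h1
        rw [Fintype.sum_sum_type, ← h1]
        simp only [border, Sum.elim_inl, Sum.elim_inr, Finset.univ_unique, Finset.sum_singleton,
          mul_one]
        congr 1
        exact Finset.sum_congr rfl fun r hr => by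
          rw [hφx r r hr (SimpleGraph.Reachable.refl _)]
    · push Not at hr
      obtain ⟨v, hv⟩ := hr
      obtain ⟨w, hw, hw'⟩ := exists_of_not_reachesExt hv
      refine det_gram_eq_zero (w := Sum.elim w 0) (fun h => hw ?_) fun e he => ?_
      · ext k
        exact congrFun h (Sum.inl k)
      · rw [Fintype.sum_sum_type]
        simpa [border] using hw' e he

/-- The bordered matrix tree theorem. -/
lemma phi_eq_det (x : Fin nV → ℝ) (α : Fin nE → ℝ) :
    ∑ i ∈ G.ext, ∑ j ∈ G.ext.filter (fun j => i < j),
      (x i - x j) ^ 2 * G.dualForestPoly (G.pairPart i j) α = (gram (G.border x) α).det := by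
  rw [det_gram]
  have h1 : ∀ F ∈ (Finset.univ : Finset (Finset (Fin nE))).filter
      (fun F => F.card = Fintype.card ({v // v ∉ G.ext} ⊕ Unit)),
      (∏ e ∈ F, α e) * (gram (G.border x) (indic F)).det
        = ∑ i ∈ G.ext, ∑ j ∈ G.ext.filter (fun j => i < j),
          if F ∈ G.forests (G.pairPart i j) then (x i - x j) ^ 2 * ∏ e ∈ F, α e else 0 := by
    intro F hF
    have hF' := (Finset.mem_filter.1 hF).2
    rw [Fintype.card_sum, Fintype.card_unit] at hF'
    rw [det_gram_border_indic x hF', Finset.mul_sum]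
    refine Finset.sum_congr rfl fun i _ => ?_
    rw [Finset.mul_sum]
    refine Finset.sum_congr rfl fun j _ => ?_
    split_ifs <;> ring
  rw [Finset.sum_congr rfl h1, Finset.sum_comm]
  refine Finset.sum_congr rfl fun i hi => ?_
  rw [Finset.sum_comm]
  refine Finset.sum_congr rfl fun j hj => ?_
  obtain ⟨hj, hij⟩ := Finset.mem_filter.1 hj
  rw [dualForestPoly, Finset.mul_sum, ← Finset.sum_filter]
  refine Finset.sum_congr ?_ fun _ _ => rfl
  ext F
  simp only [Finset.mem_filter, Finset.mem_univ, true_and, Fintype.card_sum, Fintype.card_unit]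
  refine ⟨fun h => ⟨?_, h⟩, fun h => h.2⟩
  have h2 := ((mem_forests_pairPart hi hj hij.ne).1 h).1.1
  have h3 := Finset.card_erase_add_one hi
  have h4 := card_off G.ext
  omega

end FeynmanGraph

section GaussianIntegral

variable {ι κ κ' : Type*} [Fintype ι] [Fintype κ]

lemma gram_mulVec (T : Matrix κ' κ ℝ) (b : ι → κ → ℝ) (α : ι → ℝ) :
    gram (fun e => T.mulVec (b e)) α = T * gram b α * T.transpose := by
  ext k l
  simp only [Matrix.mul_apply, Matrix.transpose_apply, gram, Matrix.of_apply, Matrix.mulVec,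
    dotProduct, Finset.mul_sum, Finset.sum_mul]
  rw [Finset.sum_comm]
  refine (Finset.sum_congr rfl fun a _ => Finset.sum_comm).trans ?_
  exact Finset.sum_congr rfl fun b _ => Finset.sum_congr rfl fun a _ =>
    Finset.sum_congr rfl fun e _ => by ring

lemma gram_mulVec_apply (b : ι → κ → ℝ) (α : ι → ℝ) (y : κ → ℝ) (k : κ) :
    (gram b α).mulVec y k = ∑ e, α e * b e k * ∑ l, b e l * y l := by
  simp only [Matrix.mulVec, dotProduct, gram, Matrix.of_apply, Finset.mul_sum, Finset.sum_mul]
  rw [Finset.sum_comm]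
  exact Finset.sum_congr rfl fun e _ => Finset.sum_congr rfl fun a _ => by ring

lemma dotProduct_gram_mulVec (b : ι → κ → ℝ) (α : ι → ℝ) (y w : κ → ℝ) :
    y ⬝ᵥ (gram b α).mulVec w = ∑ e, α e * (∑ l, b e l * y l) * ∑ l, b e l * w l := by
  simp only [dotProduct, gram_mulVec_apply, Finset.mul_sum (s := (Finset.univ : Finset ι))]
  rw [Finset.sum_comm]
  refine Finset.sum_congr rfl fun e _ => ?_
  rw [mul_right_comm, Finset.mul_sum]
  exact Finset.sum_congr rfl fun k _ => by ring

open scoped MatrixOrder in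
/-- A weighted Gram matrix with nonnegative weights has a square root. -/
lemma exists_gram_eq_transpose_mul_self (b : ι → κ → ℝ) {α : ι → ℝ} (hα : ∀ e, 0 ≤ α e) :
    ∃ S : Matrix κ κ ℝ, gram b α = S.transpose * S := by
  have h : (gram b α).PosSemidef := by
    refine .of_dotProduct_mulVec_nonneg ?_ fun y => ?_
    · ext i j
      simp [gram, mul_comm]
    · simp only [star_trivial, dotProduct_gram_mulVec, mul_assoc]
      exact Finset.sum_nonneg fun e _ => mul_nonneg (hα e) (mul_self_nonneg _)
  obtain ⟨S, hS⟩ := CStarAlgebra.nonneg_iff_eq_star_mul_self.mp h.nonneg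
  exact ⟨S, hS⟩

variable [DecidableEq κ]

lemma exists_complete_square (b : ι → κ → ℝ) (c α : ι → ℝ) (h : (gram b α).det ≠ 0) :
    ∃ y₀ : κ → ℝ, ∀ y : κ → ℝ, ∑ e, α e * (∑ k, b e k * (y k + y₀ k) + c e) ^ 2
      = ∑ e, α e * (∑ k, b e k * y k) ^ 2 +
        (gram (fun e => Sum.elim (b e) (fun _ : Unit => c e)) α).det / (gram b α).det := by
  let v : κ → ℝ := fun k => ∑ e, α e * b e k * c e
  let y₀ : κ → ℝ := -(gram b α)⁻¹.mulVec v
  have hy₀ : ∀ k, ∑ e, α e * b e k * (∑ l, b e l * y₀ l + c e) = 0 := fun k => by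
    have h1 : (gram b α).mulVec y₀ = -v := by
      rw [Matrix.mulVec_neg, Matrix.mulVec_mulVec, Matrix.mul_nonsing_inv _ (isUnit_iff_ne_zero.2 h),
        Matrix.one_mulVec]
    have h2 := congrFun h1 k
    rw [gram_mulVec_apply] at h2
    simp only [mul_add, Finset.sum_add_distrib, h2, v, Pi.neg_apply]
    ring
  let T : Matrix (κ ⊕ Unit) (κ ⊕ Unit) ℝ :=
    Matrix.fromBlocks 1 0 (Matrix.of fun _ k => y₀ k) 1
  have hT : T.det = 1 := by simp [T]
  let q : ℝ := ∑ e, α e * (∑ k, b e k * y₀ k + c e) ^ 2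
  have hblock : gram (fun e => T.mulVec (Sum.elim (b e) (fun _ : Unit => c e))) α
      = Matrix.fromBlocks (gram b α) 0 0 (Matrix.of fun _ _ => q) := by
    have hl : ∀ e k, T.mulVec (Sum.elim (b e) (fun _ : Unit => c e)) (Sum.inl k) = b e k :=
      fun e k => by
        simp [T, Matrix.mulVec, dotProduct, Fintype.sum_sum_type, Matrix.one_apply]
    have hr : ∀ e k, T.mulVec (Sum.elim (b e) (fun _ : Unit => c e)) (Sum.inr k)
        = ∑ k, b e k * y₀ k + c e := fun e k => by
      simp [T, Matrix.mulVec, dotProduct, Fintype.sum_sum_type, mul_comm]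
    ext k l
    rcases k with k | k <;> rcases l with l | l
    · simp [gram, hl]
    · simp only [gram, Matrix.of_apply, hl, hr, Matrix.fromBlocks_apply₁₂, Matrix.zero_apply]
      simpa only [mul_assoc] using hy₀ k
    · simp only [gram, Matrix.of_apply, hl, hr, Matrix.fromBlocks_apply₂₁, Matrix.zero_apply]
      rw [← hy₀ l]
      exact Finset.sum_congr rfl fun e _ => by ring
    · simp [gram, hr, q, sq]
  have hq : (gram (fun e => Sum.elim (b e) (fun _ : Unit => c e)) α).det / (gram b α).det = q := by
    have h1 := congrArg Matrix.det hblock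
    rw [gram_mulVec, Matrix.det_mul, Matrix.det_mul, Matrix.det_transpose, hT, one_mul, mul_one,
      Matrix.det_fromBlocks_zero₁₂] at h1
    rw [h1]
    simp [h]
  refine ⟨y₀, fun y => ?_⟩
  rw [hq]
  have hcross : ∑ e, α e * (∑ k, b e k * y k) * (∑ k, b e k * y₀ k + c e) = 0 := by
    have h1 : ∀ e, α e * (∑ k, b e k * y k) * (∑ k, b e k * y₀ k + c e)
        = ∑ k, y k * (α e * b e k * (∑ k, b e k * y₀ k + c e)) := fun e => by
      rw [Finset.mul_sum, Finset.sum_mul]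
      exact Finset.sum_congr rfl fun k _ => by ring
    rw [Finset.sum_congr rfl fun e _ => h1 e, Finset.sum_comm]
    exact Finset.sum_eq_zero fun k _ => by rw [← Finset.mul_sum, hy₀ k, mul_zero]
  have h2 : ∀ e, α e * (∑ k, b e k * (y k + y₀ k) + c e) ^ 2 = α e * (∑ k, b e k * y k) ^ 2 +
      2 * (α e * (∑ k, b e k * y k) * (∑ k, b e k * y₀ k + c e)) +
      α e * (∑ k, b e k * y₀ k + c e) ^ 2 := fun e => by
    simp only [mul_add, Finset.sum_add_distrib]
    ring
  rw [Finset.sum_congr rfl fun e _ => h2 e, Finset.sum_add_distrib, Finset.sum_add_distrib,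
    ← Finset.mul_sum, hcross]
  ring

/-- The Gaussian integral of a sum of squares of affine functions. -/
lemma integral_exp_neg_sum_sq (b : ι → κ → ℝ) (c : ι → ℝ) {α : ι → ℝ} (hα : ∀ e, 0 ≤ α e)
    (h : 0 < (gram b α).det) :
    ∫ y : κ → ℝ, Real.exp (-∑ e, α e * (∑ k, b e k * y k + c e) ^ 2)
      = Real.sqrt Real.pi ^ Fintype.card κ * (Real.sqrt (gram b α).det)⁻¹ * Real.exp
        (-((gram (fun e => Sum.elim (b e) (fun _ : Unit => c e)) α).det / (gram b α).det)) := by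
  obtain ⟨y₀, hy₀⟩ := exists_complete_square b c α h.ne'
  obtain ⟨S, hS⟩ := exists_gram_eq_transpose_mul_self b hα
  have hdet : (gram b α).det = S.det ^ 2 := by
    rw [hS, Matrix.det_mul, Matrix.det_transpose, sq]
  have hS0 : S.det ≠ 0 := fun h0 => by simp [hdet, h0] at h
  have hsq : ∀ y : κ → ℝ, ∑ e, α e * (∑ k, b e k * y k) ^ 2 = ∑ k, (Matrix.toLin' S y k) ^ 2 := fun y => by
    have h1 := dotProduct_gram_mulVec b α y y
    rw [hS, ← Matrix.mulVec_mulVec, Matrix.dotProduct_mulVec, Matrix.vecMul_transpose] at h1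
    simp only [sq, Matrix.toLin'_apply]
    rw [show ∑ k, S.mulVec y k * S.mulVec y k = _ from h1]
    exact Finset.sum_congr rfl fun e _ => by ring
  rw [← integral_add_right_eq_self _ y₀]
  simp only [Pi.add_apply, hy₀, neg_add, Real.exp_add, hsq]
  rw [integral_mul_const]
  congr 1
  have hmap := Real.map_matrix_volume_pi_eq_smul_volume_pi hS0
  have hcont : Continuous (Matrix.toLin' S) := LinearMap.continuous_of_finiteDimensional _
  have h3 : ∫ y : κ → ℝ, Real.exp (-∑ k, (Matrix.toLin' S y k) ^ 2)
      = ∫ y, Real.exp (-∑ k, y k ^ 2) ∂(Measure.map (Matrix.toLin' S) volume) := by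
    rw [integral_map hcont.measurable.aemeasurable]
    exact (by fun_prop : Continuous fun y : κ → ℝ => Real.exp (-∑ k, y k ^ 2)).aestronglyMeasurable
  have h4 : ∫ y : κ → ℝ, Real.exp (-∑ k, y k ^ 2) = Real.sqrt Real.pi ^ Fintype.card κ := by
    have h5 := integral_fintype_prod_volume_eq_pow (ι := κ) (𝕜 := ℝ)
      (fun t : ℝ => Real.exp (-1 * t ^ 2))
    rw [integral_gaussian, div_one] at h5
    rw [← h5]
    congr 1
    ext y
    rw [← Real.exp_sum, ← Finset.sum_neg_distrib]
    simp
  rw [h3, hmap, integral_smul_measure, h4, hdet, Real.sqrt_sq_eq_abs, abs_inv,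
    ENNReal.toReal_ofReal (by positivity), smul_eq_mul, mul_comm]

end GaussianIntegral

section Swap

variable {κ δ : Type*} [Fintype κ] [Fintype δ]

/-- Exchanging the two arguments of a function preserves the Lebesgue measure. -/
lemma measurePreserving_swap :
    MeasurePreserving (fun (y : κ → δ → ℝ) (i : δ) (k : κ) => y k i) volume volume := by
  have hmeas : Measurable fun (y : κ → δ → ℝ) (i : δ) (k : κ) => y k i := by fun_prop
  refine ⟨hmeas, ?_⟩
  symm
  refine Measure.pi_eq_generateFrom
    (C := fun _ => Set.pi Set.univ '' Set.pi Set.univ fun _ : κ => {s : Set ℝ | MeasurableSet s})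
    (fun _ => generateFrom_pi) (fun _ => isPiSystem_pi)
    (fun _ => Measure.FiniteSpanningSetsIn.pi fun _ => Measure.toFiniteSpanningSetsIn _)
    fun s hs => ?_
  choose t ht hts using hs
  obtain rfl : (fun i => Set.pi Set.univ (t i)) = s := funext hts
  have ht' : ∀ i k, MeasurableSet (t i k) := fun i k => ht i k trivial
  rw [Measure.map_apply hmeas (MeasurableSet.univ_pi fun i => MeasurableSet.univ_pi (ht' i))]
  have h1 : (fun (y : κ → δ → ℝ) (i : δ) (k : κ) => y k i) ⁻¹'
      (Set.pi Set.univ fun i => Set.pi Set.univ (t i))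
      = Set.pi Set.univ fun k => Set.pi Set.univ fun i => t i k := by
    ext y
    simp only [Set.mem_preimage, Set.mem_pi, Set.mem_univ, true_imp_iff]
    exact forall_comm
  rw [h1, volume_pi_pi]
  simp only [volume_pi_pi]
  rw [Finset.prod_comm]
  exact Finset.prod_congr rfl fun i _ => (volume_pi_pi _).symm

end Swap

/-- The Gamma integral, as a Lebesgue integral of a nonnegative function. -/
lemma lintegral_rpow_mul_exp_neg_mul {a r : ℝ} (ha : 0 < a) (hr : 0 < r) :
    ∫⁻ t in Set.Ioi (0 : ℝ), ENNReal.ofReal (t ^ (a - 1) * Real.exp (-(r * t)))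
      = ENNReal.ofReal (Real.Gamma a * r ^ (-a)) := by
  have h := Real.integral_rpow_mul_exp_neg_mul_Ioi ha hr
  have hpos : 0 < (1 / r) ^ a * Real.Gamma a :=
    mul_pos (Real.rpow_pos_of_pos (by positivity) _) (Real.Gamma_pos_of_pos ha)
  rw [← ofReal_integral_eq_lintegral_ofReal, h, one_div, Real.inv_rpow hr.le, Real.rpow_neg hr.le,
    mul_comm]
  · exact Integrable.of_integral_ne_zero (by rw [h]; exact hpos.ne')
  · refine (ae_restrict_iff' measurableSet_Ioi).2 (Filter.Eventually.of_forall fun t ht => ?_)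
    exact mul_nonneg (Real.rpow_nonneg (le_of_lt ht) _) (Real.exp_pos _).le

namespace FeynmanGraph
variable {nV nE d : ℕ} {G : FeynmanGraph nV nE}

/-- The squared length of an edge. -/
def edgeSq (G : FeynmanGraph nV nE) (x : Fin nV → EuclideanSpace ℝ (Fin d))
    (y : {v : Fin nV // v ∉ G.ext} → EuclideanSpace ℝ (Fin d)) (e : Fin nE) : ℝ :=
  ‖G.assemble x y (G.ends e).1 - G.assemble x y (G.ends e).2‖ ^ 2

lemma edgeSq_nonneg (x : Fin nV → EuclideanSpace ℝ (Fin d))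
    (y : {v : Fin nV // v ∉ G.ext} → EuclideanSpace ℝ (Fin d)) (e : Fin nE) :
    0 ≤ G.edgeSq x y e := sq_nonneg _

lemma continuous_assemble (x : Fin nV → EuclideanSpace ℝ (Fin d)) (v : Fin nV) :
    Continuous fun y => G.assemble x y v := by
  by_cases h : v ∉ G.ext
  · simp only [assemble, dif_pos h]
    exact continuous_apply _
  · simp only [assemble, dif_neg h]
    exact continuous_const

lemma continuous_edgeSq (x : Fin nV → EuclideanSpace ℝ (Fin d)) (e : Fin nE) :
    Continuous fun y => G.edgeSq x y e :=
  ((continuous_assemble x _).sub (continuous_assemble x _)).norm.pow 2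

lemma edgeSq_eq (x : Fin nV → EuclideanSpace ℝ (Fin d))
    (y : {v : Fin nV // v ∉ G.ext} → EuclideanSpace ℝ (Fin d)) (e : Fin nE) :
    G.edgeSq x y e = ∑ i, (∑ k, G.incOff G.ext e k * y k i + ∑ r ∈ G.ext, G.inc e r * x r i) ^ 2 := by
  rw [edgeSq, EuclideanSpace.real_norm_sq_eq]
  refine Finset.sum_congr rfl fun i _ => ?_
  rw [PiLp.sub_apply, ← G.sum_incOff_add e (fun v => G.assemble x y v i)]
  congr 2
  · exact Finset.sum_congr rfl fun k _ => by simp [assemble, k.2]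
  · exact Finset.sum_congr rfl fun r hr => by simp [assemble, hr]

lemma phiTilde_eq_sum_det (x : Fin nV → EuclideanSpace ℝ (Fin d)) (α : Fin nE → ℝ) :
    G.phiTilde x α = ∑ i, (gram (G.border fun v => x v i) α).det := by
  simp only [← phi_eq_det, phiTilde]
  rw [Finset.sum_comm]
  refine Finset.sum_congr rfl fun a _ => ?_
  rw [Finset.sum_comm]
  refine Finset.sum_congr rfl fun b _ => ?_
  rw [EuclideanSpace.real_norm_sq_eq, Finset.sum_mul]
  rfl

lemma gram_smul {ι κ : Type*} [Fintype ι] (b : ι → κ → ℝ) (t : ℝ) (α : ι → ℝ) :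
    gram b (t • α) = t • gram b α := by
  ext i j
  simp [gram, Finset.mul_sum, mul_assoc]

lemma psiTilde_smul (t : ℝ) (α : Fin nE → ℝ) :
    G.psiTilde (t • α) = t ^ Fintype.card {v // v ∉ G.ext} * G.psiTilde α := by
  rw [psiTilde_eq_det, psiTilde_eq_det, gram_smul, Matrix.det_smul]

lemma phiTilde_smul (x : Fin nV → EuclideanSpace ℝ (Fin d)) (t : ℝ) (α : Fin nE → ℝ) :
    G.phiTilde x (t • α) = t ^ (Fintype.card {v // v ∉ G.ext} + 1) * G.phiTilde x α := by
  simp only [phiTilde_eq_sum_det, gram_smul, Matrix.det_smul, Finset.mul_sum, Fintype.card_sum,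
    Fintype.card_unit]

/-- The Gaussian integral over the positions of the internal vertices. -/
lemma integral_exp_neg_edgeSq (x : Fin nV → EuclideanSpace ℝ (Fin d)) {α : Fin nE → ℝ}
    (hα : ∀ e, 0 ≤ α e) (hψ : 0 < G.psiTilde α) :
    ∫ y, Real.exp (-∑ e, α e * G.edgeSq x y e)
      = (Real.sqrt Real.pi ^ Fintype.card {v // v ∉ G.ext} * (Real.sqrt (G.psiTilde α))⁻¹) ^ d *
        Real.exp (-(G.phiTilde x α / G.psiTilde α)) := by
  let T : ({v : Fin nV // v ∉ G.ext} → EuclideanSpace ℝ (Fin d)) →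
      Fin d → {v : Fin nV // v ∉ G.ext} → ℝ := fun y i k => y k i
  have hT : MeasurePreserving T volume volume :=
    measurePreserving_swap.comp (volume_preserving_pi fun _ => PiLp.volume_preserving_ofLp (Fin d))
  let g : Fin d → ({v : Fin nV // v ∉ G.ext} → ℝ) → ℝ := fun i z => Real.exp
    (-∑ e, α e * (∑ k, G.incOff G.ext e k * z k + ∑ r ∈ G.ext, G.inc e r * x r i) ^ 2)
  have h1 : ∀ y, Real.exp (-∑ e, α e * G.edgeSq x y e) = ∏ i, g i (T y i) := fun y => by
    simp only [g, T, ← Real.exp_sum, edgeSq_eq, Finset.mul_sum]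
    rw [Finset.sum_comm, Finset.sum_neg_distrib]
  have h2 : ∫ y, ∏ i, g i (T y i) = ∫ z : Fin d → {v : Fin nV // v ∉ G.ext} → ℝ, ∏ i, g i (z i) := by
    rw [← hT.map_eq, integral_map hT.measurable.aemeasurable]
    refine Continuous.aestronglyMeasurable ?_
    simp only [g]
    fun_prop
  simp only [h1]
  rw [h2, integral_fintype_prod_volume_eq_prod]
  have hψ' : 0 < (gram (G.incOff G.ext) α).det := psiTilde_eq_det α ▸ hψ
  have h3 : ∀ i, ∫ z, g i z = (Real.sqrt Real.pi ^ Fintype.card {v // v ∉ G.ext} *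
      (Real.sqrt (G.psiTilde α))⁻¹) *
        Real.exp (-((gram (G.border fun v => x v i) α).det / G.psiTilde α)) := fun i => by
    rw [psiTilde_eq_det]
    exact integral_exp_neg_sum_sq _ _ hα hψ'
  rw [Finset.prod_congr rfl fun i _ => h3 i, Finset.prod_mul_distrib, Finset.prod_const,
    Finset.card_univ, Fintype.card_fin, ← Real.exp_sum, Finset.sum_neg_distrib, ← Finset.sum_div,
    phiTilde_eq_sum_det]

lemma lintegral_exp_neg_edgeSq (x : Fin nV → EuclideanSpace ℝ (Fin d)) {α : Fin nE → ℝ}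
    (hα : ∀ e, 0 ≤ α e) (hψ : 0 < G.psiTilde α) :
    ∫⁻ y, ENNReal.ofReal (Real.exp (-∑ e, α e * G.edgeSq x y e))
      = ENNReal.ofReal (Real.pi ^ ((d : ℝ) / 2 * (G.intVerts.card : ℝ)) *
        G.psiTilde α ^ (-((d : ℝ) / 2)) * Real.exp (-(G.phiTilde x α / G.psiTilde α))) := by
  have h := integral_exp_neg_edgeSq x hα hψ
  rw [← ofReal_integral_eq_lintegral_ofReal
    (Integrable.of_integral_ne_zero (by rw [h]; positivity))
    (Filter.Eventually.of_forall fun y => (Real.exp_pos _).le), h]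
  have hcard : G.intVerts.card = Fintype.card {v // v ∉ G.ext} := by
    rw [intVerts, Fintype.card_subtype]
  congr 2
  rw [mul_pow, inv_pow, Real.sqrt_eq_rpow, Real.sqrt_eq_rpow, ← Real.rpow_mul_natCast hψ.le,
    Real.rpow_neg hψ.le, ← pow_mul, ← Real.rpow_mul_natCast Real.pi_pos.le, hcard]
  congr 2
  · push_cast
    ring_nf
  · ring_nf

/-- The integral of a power of a positive combination of the squared edge lengths. -/
lemma lintegral_rpow_edgeSq (x : Fin nV → EuclideanSpace ℝ (Fin d)) {α : Fin nE → ℝ}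
    (hα : ∀ e, 0 < α e) (hψ : 0 < G.psiTilde α) (hφ : 0 < G.phiTilde x α) (hM : 0 < G.Mdeg d)
    (hS : ∀ y, 0 < ∑ e, α e * G.edgeSq x y e) {p : ℝ}
    (hp : p = G.Mdeg d + (d : ℝ) / 2 * (G.intVerts.card : ℝ)) :
    ENNReal.ofReal (Real.Gamma p) * ∫⁻ y, ENNReal.ofReal ((∑ e, α e * G.edgeSq x y e) ^ (-p))
      = ENNReal.ofReal (Real.pi ^ ((d : ℝ) / 2 * (G.intVerts.card : ℝ)) * Real.Gamma (G.Mdeg d) *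
        (G.phiTilde x α ^ (-G.Mdeg d) * G.psiTilde α ^ (-((d : ℝ) / 2 - G.Mdeg d)))) := by
  have hp0 : 0 < p := by rw [hp]; positivity
  have hcard : G.intVerts.card = Fintype.card {v // v ∉ G.ext} := by
    rw [intVerts, Fintype.card_subtype]
  have h1 : ∀ y, ENNReal.ofReal (Real.Gamma p) *
      ENNReal.ofReal ((∑ e, α e * G.edgeSq x y e) ^ (-p))
      = ∫⁻ t in Set.Ioi (0 : ℝ), ENNReal.ofReal (t ^ (p - 1)) *
        ENNReal.ofReal (Real.exp (-∑ e, (t • α) e * G.edgeSq x y e)) := fun y => by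
    rw [← ENNReal.ofReal_mul (Real.Gamma_pos_of_pos hp0).le,
      ← lintegral_rpow_mul_exp_neg_mul hp0 (hS y)]
    refine setLIntegral_congr_fun measurableSet_Ioi fun t ht => ?_
    rw [ENNReal.ofReal_mul (Real.rpow_nonneg (le_of_lt ht) _)]
    congr 4
    rw [Finset.sum_mul]
    exact Finset.sum_congr rfl fun e _ => by simp; ring
  have h2 : ∀ t ∈ Set.Ioi (0 : ℝ), ∫⁻ y, ENNReal.ofReal (t ^ (p - 1)) *
      ENNReal.ofReal (Real.exp (-∑ e, (t • α) e * G.edgeSq x y e))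
      = ENNReal.ofReal (Real.pi ^ ((d : ℝ) / 2 * (G.intVerts.card : ℝ)) *
        G.psiTilde α ^ (-((d : ℝ) / 2))) * ENNReal.ofReal (t ^ (G.Mdeg d - 1) *
          Real.exp (-(G.phiTilde x α / G.psiTilde α * t))) := fun t ht => by
    have ht' : 0 < t := ht
    have hψt : 0 < G.psiTilde (t • α) := by rw [psiTilde_smul]; positivity
    rw [lintegral_const_mul', lintegral_exp_neg_edgeSq x _ hψt, ← ENNReal.ofReal_mul (by positivity),
      ← ENNReal.ofReal_mul (by positivity)]
    · congr 1
      rw [psiTilde_smul, phiTilde_smul, Real.mul_rpow (by positivity) hψ.le, ← Real.rpow_natCast_mul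
        ht'.le, hp]
      have h3 : t ^ (Fintype.card {v // v ∉ G.ext} + 1) * G.phiTilde x α /
          (t ^ Fintype.card {v // v ∉ G.ext} * G.psiTilde α)
          = G.phiTilde x α / G.psiTilde α * t := by
        rw [pow_succ]
        field_simp
      have h4 : t ^ (G.Mdeg d - 1) = t ^ (G.Mdeg d + (d : ℝ) / 2 * (G.intVerts.card : ℝ) - 1) *
          t ^ ((Fintype.card {v // v ∉ G.ext} : ℝ) * (-((d : ℝ) / 2))) := by
        rw [← Real.rpow_add ht', hcard]
        congr 1
        ring
      rw [h3, h4]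
      ring
    · exact fun e => by simpa using mul_nonneg ht'.le (hα e).le
    · exact ENNReal.ofReal_ne_top
  rw [← lintegral_const_mul' _ _ ENNReal.ofReal_ne_top, lintegral_congr h1, lintegral_lintegral_swap,
    setLIntegral_congr_fun measurableSet_Ioi h2, lintegral_const_mul' _ _ ENNReal.ofReal_ne_top,
    lintegral_rpow_mul_exp_neg_mul hM (by positivity), ← ENNReal.ofReal_mul (by positivity)]
  · congr 1
    rw [Real.div_rpow hφ.le hψ.le, Real.rpow_neg hψ.le (G.Mdeg d), div_inv_eq_mul,
      show -((d : ℝ) / 2 - G.Mdeg d) = -((d : ℝ) / 2) + G.Mdeg d by ring, Real.rpow_add hψ]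
    ring
  · simp only [Function.uncurry_def]
    refine Measurable.aemeasurable (Measurable.fun_mul ?_ ?_)
    · exact (measurable_snd.pow_const _).ennreal_ofReal
    · refine (Continuous.measurable ?_).ennreal_ofReal
      refine Real.continuous_exp.comp (continuous_finsetSum _ fun e _ => ?_).neg
      refine Continuous.mul ?_ ((continuous_edgeSq x e).comp continuous_fst)
      simp only [Pi.smul_apply, smul_eq_mul]
      exact continuous_snd.mul continuous_const

end FeynmanGraph

section Moments

variable {Y ι : Type*} [Fintype ι] {A : Y → ι → ℝ} {p : ℝ}

/-- The integrand of `moment`. -/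
def momentIntegrand (A : Y → ι → ℝ) (p : ℝ) (n : ι → ℕ) (α : ι → ℝ) (y : Y) : ℝ :=
  (∏ e, A y e ^ n e) * (∑ e, α e * A y e) ^ (-(p + ((∑ e, n e : ℕ) : ℝ)))

lemma momentIntegrand_nonneg (hA0 : ∀ y e, 0 ≤ A y e) (n : ι → ℕ) {α : ι → ℝ}
    (hα : ∀ e, 0 < α e) (y : Y) : 0 ≤ momentIntegrand A p n α y :=
  mul_nonneg (Finset.prod_nonneg fun e _ => pow_nonneg (hA0 y e) _)
    (Real.rpow_nonneg (Finset.sum_nonneg fun e _ => mul_nonneg (hα e).le (hA0 y e)) _)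

lemma sum_mul_pos (hA0 : ∀ y e, 0 ≤ A y e) (hA1 : ∀ y, ∃ e, A y e ≠ 0) {α : ι → ℝ}
    (hα : ∀ e, 0 < α e) (y : Y) : 0 < ∑ e, α e * A y e := by
  obtain ⟨e, he⟩ := hA1 y
  exact Finset.sum_pos' (fun e _ => mul_nonneg (hα e).le (hA0 y e))
    ⟨e, Finset.mem_univ _, mul_pos (hα e) ((hA0 y e).lt_of_ne' he)⟩

lemma momentIntegrand_le (hp : 0 < p) (hA0 : ∀ y e, 0 ≤ A y e) (hA1 : ∀ y, ∃ e, A y e ≠ 0)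
    (n : ι → ℕ) {γ β : ι → ℝ} (hγ : ∀ e, 0 < γ e) (hβ : ∀ e, γ e ≤ β e) (y : Y) :
    momentIntegrand A p n β y ≤ (∏ e, (γ e)⁻¹ ^ n e) * momentIntegrand A p 0 γ y := by
  have hβ0 : ∀ e, 0 < β e := fun e => (hγ e).trans_le (hβ e)
  set S := ∑ e, β e * A y e with hS
  have hS0 : 0 < S := sum_mul_pos hA0 hA1 hβ0 y
  have hT0 : 0 < ∑ e, γ e * A y e := sum_mul_pos hA0 hA1 hγ y
  have hTS : ∑ e, γ e * A y e ≤ S :=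
    Finset.sum_le_sum fun e _ => mul_le_mul_of_nonneg_right (hβ e) (hA0 y e)
  have h1 : ∀ e, A y e ≤ (γ e)⁻¹ * S := fun e => by
    rw [inv_mul_eq_div, le_div_iff₀ (hγ e), mul_comm]
    exact (Finset.single_le_sum (f := fun e => γ e * A y e)
      (fun e _ => mul_nonneg (hγ e).le (hA0 y e)) (Finset.mem_univ e)).trans hTS
  have h2 : ∏ e, A y e ^ n e ≤ (∏ e, (γ e)⁻¹ ^ n e) * S ^ (∑ e, n e) := by
    rw [← Finset.prod_pow_eq_pow_sum, ← Finset.prod_mul_distrib]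
    refine Finset.prod_le_prod (fun e _ => pow_nonneg (hA0 y e) _) fun e _ => ?_
    rw [← mul_pow]
    exact pow_le_pow_left₀ (hA0 y e) (h1 e) _
  have h3 : S ^ (∑ e, n e) * S ^ (-(p + ((∑ e, n e : ℕ) : ℝ))) = S ^ (-p) := by
    rw [← Real.rpow_natCast, ← Real.rpow_add hS0]
    congr 1
    ring
  have h4 : S ^ (-p) ≤ (∑ e, γ e * A y e) ^ (-p) :=
    Real.rpow_le_rpow_of_nonpos hT0 hTS (by linarith)
  have hP : 0 ≤ ∏ e, (γ e)⁻¹ ^ n e :=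
    Finset.prod_nonneg fun e _ => pow_nonneg (inv_nonneg.2 (hγ e).le) _
  calc momentIntegrand A p n β y
      ≤ (∏ e, (γ e)⁻¹ ^ n e) * S ^ (∑ e, n e) * S ^ (-(p + ((∑ e, n e : ℕ) : ℝ))) :=
        mul_le_mul_of_nonneg_right h2 (Real.rpow_nonneg hS0.le _)
    _ = (∏ e, (γ e)⁻¹ ^ n e) * S ^ (-p) := by rw [mul_assoc, h3]
    _ ≤ (∏ e, (γ e)⁻¹ ^ n e) * (∑ e, γ e * A y e) ^ (-p) := mul_le_mul_of_nonneg_left h4 hP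
    _ = _ := by simp [momentIntegrand]

lemma hasDerivAt_momentIntegrand [DecidableEq ι] (hA0 : ∀ y e, 0 ≤ A y e) (hA1 : ∀ y, ∃ e, A y e ≠ 0) (n : ι → ℕ)
    {α : ι → ℝ} (hα : ∀ e, 0 < α e) (e : ι) {t : ℝ} (ht : 0 < t) (y : Y) :
    HasDerivAt (fun t => momentIntegrand A p n (Function.update α e t) y)
      (-(p + ((∑ e, n e : ℕ) : ℝ)) *
        momentIntegrand A p (n + Pi.single e 1) (Function.update α e t) y) t := by
  have hupd : ∀ i, 0 < Function.update α e t i := fun i => by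
    by_cases h : i = e
    · subst h; simpa using ht
    · simpa [h] using hα i
  have hS0 := sum_mul_pos hA0 hA1 hupd y
  have h1 : HasDerivAt (fun t => ∑ i, Function.update α e t i * A y i) (A y e) t := by
    have h2 : HasDerivAt (fun t => ∑ i, Function.update α e t i * A y i)
        (∑ i, (Pi.single e 1 : ι → ℝ) i * A y i) t := by
      refine HasDerivAt.fun_sum fun i _ => HasDerivAt.mul_const ?_ _
      exact hasDerivAt_pi.1 (hasDerivAt_update α e t) i
    simpa [Pi.single_apply] using h2
  have h3 := (h1.rpow_const (p := -(p + ((∑ e, n e : ℕ) : ℝ))) (Or.inl hS0.ne')).const_mul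
    (∏ i, A y i ^ n i)
  refine h3.congr_deriv ?_
  have h4 : ∏ i, A y i ^ (n + Pi.single e 1 : ι → ℕ) i = (∏ i, A y i ^ n i) * A y e := by
    simp only [Pi.add_apply, pow_add, Finset.prod_mul_distrib]
    congr 1
    rw [Finset.prod_eq_single e] <;> simp +contextual
  have h5 : ∑ i, (n + Pi.single e 1 : ι → ℕ) i = ∑ i, n i + 1 := by
    simp [Finset.sum_add_distrib]
  rw [momentIntegrand, h4, h5]
  push_cast
  rw [show -(p + (∑ i, (n i : ℝ) + 1)) = -(p + ∑ i, (n i : ℝ)) - 1 by ring]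
  ring

variable [MeasurableSpace Y] {μ : Measure Y}

/-- The integral of a monomial in the `A e`, divided by a power of `∑ e, α e * A e` which lowers the
degree to `-p`. -/
def moment (μ : Measure Y) (A : Y → ι → ℝ) (p : ℝ) (n : ι → ℕ) (α : ι → ℝ) : ℝ :=
  ∫ y, momentIntegrand A p n α y ∂μ

lemma measurable_momentIntegrand (hA : ∀ e, Measurable fun y => A y e) (n : ι → ℕ) (α : ι → ℝ) :
    Measurable (momentIntegrand A p n α) :=
  (Finset.measurable_fun_prod _ fun e _ => (hA e).pow_const _).mul
    ((Finset.measurable_fun_sum _ fun e _ => (hA e).const_mul _).pow_const _)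

lemma integrable_momentIntegrand (hp : 0 < p) (hA : ∀ e, Measurable fun y => A y e)
    (hA0 : ∀ y e, 0 ≤ A y e) (hA1 : ∀ y, ∃ e, A y e ≠ 0) (n : ι → ℕ) {α : ι → ℝ}
    (hα : ∀ e, 0 < α e) (hint : Integrable (momentIntegrand A p 0 α) μ) :
    Integrable (momentIntegrand A p n α) μ := by
  refine (hint.const_mul (∏ e, (α e)⁻¹ ^ n e)).mono'
    (measurable_momentIntegrand hA n α).aestronglyMeasurable (Filter.Eventually.of_forall fun y => ?_)
  rw [Real.norm_of_nonneg (momentIntegrand_nonneg hA0 n hα y)]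
  exact momentIntegrand_le hp hA0 hA1 n hα (fun _ => le_rfl) y

lemma hasDerivAt_moment [DecidableEq ι] (hp : 0 < p) (hA : ∀ e, Measurable fun y => A y e)
    (hA0 : ∀ y e, 0 ≤ A y e) (hA1 : ∀ y, ∃ e, A y e ≠ 0)
    (hint : ∀ α : ι → ℝ, (∀ e, 0 < α e) → Integrable (momentIntegrand A p 0 α) μ) (n : ι → ℕ)
    {α : ι → ℝ} (hα : ∀ e, 0 < α e) (e : ι) :
    HasDerivAt (fun t => moment μ A p n (Function.update α e t))
      (-(p + ((∑ e, n e : ℕ) : ℝ)) * moment μ A p (n + Pi.single e 1) α) (α e) := by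
  let γ : ι → ℝ := Function.update α e (α e / 2)
  have hγ : ∀ i, 0 < γ i := fun i => by
    by_cases h : i = e
    · subst h; simpa [γ] using hα i
    · simpa [γ, h] using hα i
  have hball : ∀ t ∈ Metric.ball (α e) (α e / 2), α e / 2 ≤ t := fun t ht => by
    rw [Metric.mem_ball, Real.dist_eq, abs_lt] at ht
    linarith [ht.1]
  have hγt : ∀ t ∈ Metric.ball (α e) (α e / 2), ∀ i, γ i ≤ Function.update α e t i :=
    fun t ht i => by
      by_cases h : i = e
      · subst h; simpa [γ] using hball t ht
      · simp [γ, h]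
  have h := hasDerivAt_integral_of_dominated_loc_of_deriv_le (μ := μ)
    (F := fun t y => momentIntegrand A p n (Function.update α e t) y)
    (F' := fun t y => -(p + ((∑ e, n e : ℕ) : ℝ)) *
        momentIntegrand A p (n + Pi.single e 1) (Function.update α e t) y)
    (x₀ := α e) (s := Metric.ball (α e) (α e / 2))
    (bound := fun y => (p + ((∑ e, n e : ℕ) : ℝ)) *
      ((∏ i, (γ i)⁻¹ ^ (n + Pi.single e 1 : ι → ℕ) i) * momentIntegrand A p 0 γ y))
    (Metric.ball_mem_nhds _ (by linarith [hα e]))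
    (Filter.Eventually.of_forall fun t => (measurable_momentIntegrand hA n _).aestronglyMeasurable)
    ?_ ?_ ?_ ?_ ?_
  · have h2 := h.2
    rw [integral_const_mul, Function.update_eq_self] at h2
    exact h2
  · rw [Function.update_eq_self]
    exact integrable_momentIntegrand hp hA hA0 hA1 n hα (hint α hα)
  · exact ((measurable_momentIntegrand hA _ _).const_mul _).aestronglyMeasurable
  · refine Filter.Eventually.of_forall fun y t ht => ?_
    have hpos : 0 ≤ p + ((∑ e, n e : ℕ) : ℝ) := by positivity
    rw [norm_mul, norm_neg, Real.norm_of_nonneg hpos, Real.norm_of_nonneg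
      (momentIntegrand_nonneg hA0 _ (fun i => (hγ i).trans_le (hγt t ht i)) y)]
    exact mul_le_mul_of_nonneg_left (momentIntegrand_le hp hA0 hA1 _ hγ (hγt t ht) y) hpos
  · exact ((hint γ hγ).const_mul _).const_mul _
  · exact Filter.Eventually.of_forall fun y t ht => hasDerivAt_momentIntegrand hA0 hA1 n hα e
      (lt_of_lt_of_le (half_pos (hα e)) (hball t ht)) y

end Moments

section MultiDerivative

variable {Y : Type*} [MeasurableSpace Y] {μ : Measure Y} {m : ℕ} {A : Y → Fin (m + 1) → ℝ} {p : ℝ}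

/-- The function `(-1) ^ |n| * Γ(p + |n|) * moment n`, whose partial derivatives are of the same
form. -/
def momentGamma (μ : Measure Y) (A : Y → Fin (m + 1) → ℝ) (p : ℝ) (n : Fin (m + 1) → ℕ)
    (α : Fin (m + 1) → ℝ) : ℝ :=
  (-1) ^ (∑ e, n e) * Real.Gamma (p + ((∑ e, n e : ℕ) : ℝ)) * moment μ A p n α

lemma pderivEC_momentGamma (hp : 0 < p) (hA : ∀ e, Measurable fun y => A y e)
    (hA0 : ∀ y e, 0 ≤ A y e) (hA1 : ∀ y, ∃ e, A y e ≠ 0)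
    (hint : ∀ α : Fin (m + 1) → ℝ, (∀ e, 0 < α e) → Integrable (momentIntegrand A p 0 α) μ)
    {g : (Fin (m + 1) → ℝ) → ℂ} {k : Fin (m + 1) → ℕ}
    (hg : ∀ α, (∀ e, 0 < α e) → g α = (momentGamma μ A p k α : ℂ)) (e : Fin (m + 1))
    {α : Fin (m + 1) → ℝ} (hα : ∀ e, 0 < α e) :
    pderivEC e g α = (momentGamma μ A p (k + Pi.single e 1) α : ℂ) := by
  have h1 := (hasDerivAt_moment hp hA hA0 hA1 hint k hα e).const_mul
    ((-1) ^ (∑ e, k e) * Real.Gamma (p + ((∑ e, k e : ℕ) : ℝ)))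
  have h2 := h1.ofReal_comp
  have h3 : (fun t => g (Function.update α e t)) =ᶠ[nhds (α e)]
      fun t => ((((-1) ^ (∑ e, k e) * Real.Gamma (p + ((∑ e, k e : ℕ) : ℝ))) *
        moment μ A p k (Function.update α e t) : ℝ) : ℂ) := by
    filter_upwards [lt_mem_nhds (hα e)] with t ht
    refine hg _ fun i => ?_
    by_cases h : i = e
    · subst h; simpa using ht
    · simpa [h] using hα i
  rw [pderivEC, (h2.congr_of_eventuallyEq h3).deriv, momentGamma]
  have h5 : ∑ i, (k + Pi.single e 1 : Fin (m + 1) → ℕ) i = ∑ i, k i + 1 := by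
    simp [Finset.sum_add_distrib]
  have h6 : Real.Gamma (p + ((∑ i, k i + 1 : ℕ) : ℝ))
      = (p + ((∑ i, k i : ℕ) : ℝ)) * Real.Gamma (p + ((∑ i, k i : ℕ) : ℝ)) := by
    rw [← Real.Gamma_add_one (by positivity)]
    congr 1
    push_cast
    ring
  rw [h5, h6, pow_succ]
  congr 1
  ring

lemma iterate_pderivEC_momentGamma (hp : 0 < p) (hA : ∀ e, Measurable fun y => A y e)
    (hA0 : ∀ y e, 0 ≤ A y e) (hA1 : ∀ y, ∃ e, A y e ≠ 0)
    (hint : ∀ α : Fin (m + 1) → ℝ, (∀ e, 0 < α e) → Integrable (momentIntegrand A p 0 α) μ)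
    {g : (Fin (m + 1) → ℝ) → ℂ} {k : Fin (m + 1) → ℕ}
    (hg : ∀ α, (∀ e, 0 < α e) → g α = (momentGamma μ A p k α : ℂ)) (e : Fin (m + 1)) (j : ℕ)
    {α : Fin (m + 1) → ℝ} (hα : ∀ e, 0 < α e) :
    (pderivEC e)^[j] g α = (momentGamma μ A p (k + Pi.single e j) α : ℂ) := by
  induction j generalizing α with
  | zero => simpa using hg α hα
  | succ j ih =>
    have h1 : k + Pi.single e (j + 1) = k + Pi.single e j + Pi.single e 1 := by
      rw [add_assoc, ← Pi.single_add]
    rw [Function.iterate_succ_apply', h1]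
    exact pderivEC_momentGamma hp hA hA0 hA1 hint (fun α hα => ih hα) e hα

lemma multiDerivC_momentGamma (hp : 0 < p) (hA : ∀ e, Measurable fun y => A y e)
    (hA0 : ∀ y e, 0 ≤ A y e) (hA1 : ∀ y, ∃ e, A y e ≠ 0)
    (hint : ∀ α : Fin (m + 1) → ℝ, (∀ e, 0 < α e) → Integrable (momentIntegrand A p 0 α) μ)
    {f : (Fin (m + 1) → ℝ) → ℂ}
    (hf : ∀ α, (∀ e, 0 < α e) → f α = (momentGamma μ A p 0 α : ℂ)) (n : Fin (m + 1) → ℕ)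
    {α : Fin (m + 1) → ℝ} (hα : ∀ e, 0 < α e) :
    multiDerivC n f α = (momentGamma μ A p n α : ℂ) := by
  have hfold : ∀ (l : List (Fin (m + 1))) (α : Fin (m + 1) → ℝ), (∀ e, 0 < α e) →
      l.foldr (fun e g => (pderivEC e)^[n e] g) f α
        = (momentGamma μ A p (l.map fun e => Pi.single e (n e)).sum α : ℂ) := by
    intro l
    induction l with
    | nil => exact hf
    | cons e l ih =>
      intro α hα
      rw [List.foldr_cons, List.map_cons, List.sum_cons, add_comm (Pi.single e (n e) : Fin (m + 1) → ℕ)]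
      exact iterate_pderivEC_momentGamma hp hA hA0 hA1 hint ih e (n e) hα
  rw [multiDerivC, hfold _ α hα, Finset.sum_map_toList, Finset.univ_sum_single]

end MultiDerivative

lemma lintegral_orthant_prod_rpow_mul_exp {ι : Type*} [Fintype ι] {a r : ι → ℝ}
    (ha : ∀ e, 0 < a e) (hr : ∀ e, 0 < r e) :
    ∫⁻ β in {β : ι → ℝ | ∀ e, 0 < β e},
        ENNReal.ofReal (∏ e, β e ^ (a e - 1) * Real.exp (-(r e * β e)))
      = ENNReal.ofReal (∏ e, Real.Gamma (a e) * r e ^ (-a e)) := by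
  have h1 : {β : ι → ℝ | ∀ e, 0 < β e} = Set.univ.pi fun _ => Set.Ioi 0 := by
    ext; simp
  have hint : ∀ e, ∫ b in Set.Ioi (0 : ℝ), b ^ (a e - 1) * Real.exp (-(r e * b))
      = Real.Gamma (a e) * r e ^ (-a e) := fun e => by
    rw [Real.integral_rpow_mul_exp_neg_mul_Ioi (ha e) (hr e), one_div, Real.inv_rpow (hr e).le,
      Real.rpow_neg (hr e).le, mul_comm]
  have hpos : ∀ e, 0 < Real.Gamma (a e) * r e ^ (-a e) := fun e =>
    mul_pos (Real.Gamma_pos_of_pos (ha e)) (Real.rpow_pos_of_pos (hr e) _)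
  rw [← ofReal_integral_eq_lintegral_ofReal]
  · rw [h1, volume_pi, Measure.restrict_pi_pi]
    rw [integral_fintype_prod_eq_prod (fun e b => b ^ (a e - 1) * Real.exp (-(r e * b)))]
    rw [Finset.prod_congr rfl fun e _ => hint e]
  · rw [h1, volume_pi, Measure.restrict_pi_pi]
    exact Integrable.fintype_prod (f := fun e b => b ^ (a e - 1) * Real.exp (-(r e * b)))
      fun e => Integrable.of_integral_ne_zero (by rw [hint]; exact (hpos e).ne')
  · refine (ae_restrict_iff' measurableSet_orthant).2 (Filter.Eventually.of_forall fun β hβ => ?_)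
    exact Finset.prod_nonneg fun e _ =>
      mul_nonneg (Real.rpow_nonneg (hβ e).le _) (Real.exp_pos _).le

/-- Feynman's parametrization of a product of powers, in the chart in which the first parameter
is `1`. -/
lemma lintegral_feynman {m : ℕ} {a A : Fin (m + 1) → ℝ} (ha : ∀ e, 0 < a e) (hA : ∀ e, 0 < A e) :
    ENNReal.ofReal (Real.Gamma (∑ e, a e)) * ∫⁻ β in {β : {e : Fin (m + 1) // e ≠ 0} → ℝ |
        ∀ e, 0 < β e}, ENNReal.ofReal ((∏ e, chart β e ^ (a e - 1)) *
          (∑ e, chart β e * A e) ^ (-∑ e, a e))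
      = ENNReal.ofReal (∏ e, Real.Gamma (a e) * A e ^ (-a e)) := by
  have hsum : 0 < ∑ e, a e := Finset.sum_pos (fun e _ => ha e) Finset.univ_nonempty
  have h1 : ∀ β ∈ {β : {e : Fin (m + 1) // e ≠ 0} → ℝ | ∀ e, 0 < β e},
      ENNReal.ofReal (Real.Gamma (∑ e, a e)) * ENNReal.ofReal ((∏ e, chart β e ^ (a e - 1)) *
          (∑ e, chart β e * A e) ^ (-∑ e, a e))
      = ∫⁻ t in Set.Ioi (0 : ℝ), ENNReal.ofReal (∏ e, chart β e ^ (a e - 1)) *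
        ENNReal.ofReal (t ^ (∑ e, a e - 1) * Real.exp (-((∑ e, chart β e * A e) * t))) := by
    intro β hβ
    have hc := chart_pos hβ
    have hS : 0 < ∑ e, chart β e * A e :=
      Finset.sum_pos (fun e _ => mul_pos (hc e) (hA e)) Finset.univ_nonempty
    have hP : 0 ≤ ∏ e, chart β e ^ (a e - 1) :=
      Finset.prod_nonneg fun e _ => Real.rpow_nonneg (hc e).le _
    rw [lintegral_const_mul' _ _ ENNReal.ofReal_ne_top, lintegral_rpow_mul_exp_neg_mul hsum hS,
      ← ENNReal.ofReal_mul (Real.Gamma_pos_of_pos hsum).le, ← ENNReal.ofReal_mul hP]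
    congr 1
    ring
  have h2 : ∀ t ∈ Set.Ioi (0 : ℝ), ∫⁻ β in {β : {e : Fin (m + 1) // e ≠ 0} → ℝ | ∀ e, 0 < β e},
      ENNReal.ofReal (∏ e, chart β e ^ (a e - 1)) *
        ENNReal.ofReal (t ^ (∑ e, a e - 1) * Real.exp (-((∑ e, chart β e * A e) * t)))
      = ENNReal.ofReal (∏ e : {e : Fin (m + 1) // e ≠ 0}, Real.Gamma (a e) * A e ^ (-a e)) *
        ENNReal.ofReal (t ^ (a 0 - 1) * Real.exp (-(A 0 * t))) := by
    intro t ht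
    have ht : 0 < t := ht
    have h3 : ∀ β ∈ {β : {e : Fin (m + 1) // e ≠ 0} → ℝ | ∀ e, 0 < β e},
        ENNReal.ofReal (∏ e, chart β e ^ (a e - 1)) *
          ENNReal.ofReal (t ^ (∑ e, a e - 1) * Real.exp (-((∑ e, chart β e * A e) * t)))
        = ENNReal.ofReal (t ^ (∑ e, a e - 1) * Real.exp (-(A 0 * t))) *
          ENNReal.ofReal (∏ e : {e : Fin (m + 1) // e ≠ 0},
            β e ^ (a e - 1) * Real.exp (-((A e * t) * β e))) := by
      intro β hβ
      rw [← ENNReal.ofReal_mul (Finset.prod_nonneg fun e _ =>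
        Real.rpow_nonneg (chart_pos hβ e).le _), ← ENNReal.ofReal_mul (by positivity)]
      congr 1
      have h4 : Real.exp (-((∑ e, chart β e * A e) * t)) = Real.exp (-(A 0 * t)) *
          ∏ e : {e : Fin (m + 1) // e ≠ 0}, Real.exp (-((A e * t) * β e)) := by
        have := prod_chart β (fun e b => Real.exp (-((A e * t) * b)))
        rw [mul_one] at this
        rw [← this, ← Real.exp_sum, Finset.sum_neg_distrib, Finset.sum_mul]
        congr 2
        exact Finset.sum_congr rfl fun e _ => by ring
      have h5 := prod_chart β (fun e b => b ^ (a e - 1))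
      simp only [Real.one_rpow, one_mul] at h5
      rw [h4, h5, Finset.prod_mul_distrib]
      ring
    have hQ : 0 ≤ ∏ e : {e : Fin (m + 1) // e ≠ 0}, Real.Gamma (a e) * A e ^ (-a e) :=
      Finset.prod_nonneg fun e _ => mul_nonneg (Real.Gamma_pos_of_pos (ha e)).le
        (Real.rpow_nonneg (hA e).le _)
    rw [setLIntegral_congr_fun measurableSet_orthant h3, lintegral_const_mul' _ _
      ENNReal.ofReal_ne_top, lintegral_orthant_prod_rpow_mul_exp
      (fun e : {e : Fin (m + 1) // e ≠ 0} => ha e) (fun e => mul_pos (hA e) ht), ← ENNReal.ofReal_mul (by positivity),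
      ← ENNReal.ofReal_mul hQ]
    congr 1
    have h6 : ∏ e : {e : Fin (m + 1) // e ≠ 0}, Real.Gamma (a e) * (A e * t) ^ (-a e)
        = (∏ e : {e : Fin (m + 1) // e ≠ 0}, Real.Gamma (a e) * A e ^ (-a e)) *
          t ^ (-∑ e : {e : Fin (m + 1) // e ≠ 0}, a e) := by
      rw [← Finset.sum_neg_distrib, Real.rpow_sum_of_pos ht, ← Finset.prod_mul_distrib]
      exact Finset.prod_congr rfl fun e _ => by rw [Real.mul_rpow (hA e).le ht.le, mul_assoc]
    have h7 : t ^ (∑ e, a e - 1) * t ^ (-∑ e : {e : Fin (m + 1) // e ≠ 0}, a e)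
        = t ^ (a 0 - 1) := by
      rw [← Real.rpow_add ht, Fintype.sum_eq_add_sum_subtype_ne a 0]
      congr 1
      ring
    rw [h6, ← h7]
    ring
  rw [← lintegral_const_mul' _ _ ENNReal.ofReal_ne_top,
    setLIntegral_congr_fun measurableSet_orthant h1, lintegral_lintegral_swap,
    setLIntegral_congr_fun measurableSet_Ioi h2, lintegral_const_mul' _ _ ENNReal.ofReal_ne_top,
    lintegral_rpow_mul_exp_neg_mul (ha 0) (hA 0), mul_comm, ← ENNReal.ofReal_mul
      (mul_nonneg (Real.Gamma_pos_of_pos (ha 0)).le (Real.rpow_nonneg (hA 0).le _)),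
    Fintype.prod_eq_mul_prod_subtype_ne (fun e => Real.Gamma (a e) * A e ^ (-a e)) 0]
  simp only [Function.uncurry_def]
  have hc : ∀ e, Measurable fun q : ({e : Fin (m + 1) // e ≠ 0} → ℝ) × ℝ => chart q.1 e :=
    fun e => ((continuous_apply e).comp (continuous_chart.comp continuous_fst)).measurable
  refine Measurable.aemeasurable (Measurable.fun_mul ?_ ?_)
  · exact (Finset.measurable_fun_prod _ fun e _ => (hc e).pow_const _).ennreal_ofReal
  · refine (Measurable.fun_mul (measurable_snd.pow_const _) ?_).ennreal_ofReal
    exact Real.measurable_exp.comp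
      ((Finset.measurable_fun_sum _ fun e _ => (hc e).mul_const _).mul measurable_snd).neg

namespace FeynmanGraph
variable {nV nE d : ℕ} {G : FeynmanGraph nV nE}

lemma assemble_sub {E : Type*} [AddGroup E] (x : Fin nV → E) (y z : {v : Fin nV // v ∉ G.ext} → E)
    (v : Fin nV) : G.assemble 0 (y - z) v = G.assemble x y v - G.assemble x z v := by
  by_cases h : v ∉ G.ext <;> simp [assemble, h]

/-- The coincidence set of the endpoints of an edge is a null set. -/
lemma volume_edgeSq_eq_zero (hd : 0 < d) {x : Fin nV → EuclideanSpace ℝ (Fin d)}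
    (hx : ∀ v ∈ G.ext, ∀ w ∈ G.ext, v ≠ w → x v ≠ x w) (e : Fin nE) :
    volume {y | G.edgeSq x y e = 0} = 0 := by
  set u := (G.ends e).1 with hu
  set w := (G.ends e).2 with hw
  have huw : u ≠ w := G.ends_ne e
  have hset : {y | G.edgeSq x y e = 0} = {y | G.assemble x y u = G.assemble x y w} := by
    ext y
    simp [edgeSq, sub_eq_zero, hu, hw]
  rw [hset]
  rcases Set.eq_empty_or_nonempty {y | G.assemble x y u = G.assemble x y w} with h0 | ⟨z, hz⟩
  · rw [h0, measure_empty]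
  let W : Submodule ℝ ({v : Fin nV // v ∉ G.ext} → EuclideanSpace ℝ (Fin d)) :=
    LinearMap.ker (
      ({ toFun := fun y => G.assemble 0 y u - G.assemble 0 y w
         map_add' := fun y y' => by
          by_cases h : u ∉ G.ext <;> by_cases h' : w ∉ G.ext <;> simp [assemble, h, h'] <;> abel
         map_smul' := fun c y => by
          by_cases h : u ∉ G.ext <;> by_cases h' : w ∉ G.ext <;>
            simp [assemble, h, h', smul_sub] } :
        ({v : Fin nV // v ∉ G.ext} → EuclideanSpace ℝ (Fin d)) →ₗ[ℝ] EuclideanSpace ℝ (Fin d)))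
  have hmem : ∀ y, y ∈ W ↔ G.assemble 0 y u = G.assemble 0 y w := fun y => by
    simp [W, sub_eq_zero]
  have hW : W ≠ ⊤ := by
    intro h
    have htop : ∀ y, G.assemble 0 y u = G.assemble 0 y w := fun y =>
      (hmem y).1 (h ▸ Submodule.mem_top)
    let b : EuclideanSpace ℝ (Fin d) := EuclideanSpace.single ⟨0, hd⟩ 1
    have hb : b ≠ 0 := by simp [b]
    by_cases hu' : u ∉ G.ext
    · have := htop (Pi.single ⟨u, hu'⟩ b)
      by_cases hw' : w ∉ G.ext
      · simp [assemble, hu', hw', huw.symm, hb] at this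
      · simp [assemble, hu', hw', hb] at this
    · by_cases hw' : w ∉ G.ext
      · have := htop (Pi.single ⟨w, hw'⟩ b)
        simp [assemble, hu', hw', hb.symm] at this
      · have hz' : G.assemble x z u = G.assemble x z w := hz
        simp only [assemble, dif_neg hu', dif_neg hw'] at hz'
        exact hx u (not_not.1 hu') w (not_not.1 hw') huw hz'
  have hsub : {y | G.assemble x y u = G.assemble x y w} ⊆ (fun y => y + -z) ⁻¹' (W : Set _) := by
    intro y hy
    have hy' : G.assemble x y u = G.assemble x y w := hy
    have hz' : G.assemble x z u = G.assemble x z w := hz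
    rw [Set.mem_preimage, SetLike.mem_coe, hmem, ← sub_eq_add_neg, assemble_sub x, assemble_sub x,
      hy', hz']
  refine measure_mono_null hsub ?_
  rw [measure_preimage_add_right]
  exact Measure.addHaar_submodule _ W hW

lemma exists_edgeSq_ne_zero (hconn : G.ExtLinked Finset.univ)
    {x : Fin nV → EuclideanSpace ℝ (Fin d)}
    (hx : ∀ v ∈ G.ext, ∀ w ∈ G.ext, v ≠ w → x v ≠ x w)
    (y : {v : Fin nV // v ∉ G.ext} → EuclideanSpace ℝ (Fin d)) : ∃ e, G.edgeSq x y e ≠ 0 := by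
  by_contra! h
  obtain ⟨i, hi, j, hj, hij, hr⟩ := hconn
  have h1 : G.assemble x y i = G.assemble x y j :=
    eq_of_reachable (fun e _ => by simpa [edgeSq, sub_eq_zero] using h e) hr
  simp only [assemble, hi, hj, not_true_eq_false, dite_false] at h1
  exact hx i hi j hj hij h1

end FeynmanGraph

namespace FeynmanGraph

variable {nV m : ℕ} {G : FeynmanGraph nV (m + 1)} {d : ℕ}

lemma phiTildeS_eq_phiTilde {x : Fin nV → EuclideanSpace ℝ (Fin d)} {s : Fin nV → Fin nV → ℂ}
    (hs : ∀ i ∈ G.ext, ∀ j ∈ G.ext, i < j → s i j = ((‖x i - x j‖ ^ 2 : ℝ) : ℂ))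
    (α : Fin (m + 1) → ℝ) : G.phiTildeS s α = (G.phiTilde x α : ℂ) := by
  rw [phiTildeS, phiTilde, Complex.ofReal_sum]
  refine Finset.sum_congr rfl fun i hi => ?_
  rw [Complex.ofReal_sum]
  refine Finset.sum_congr rfl fun j hj => ?_
  rw [Finset.mem_filter] at hj
  rw [hs i hi j hj.1 hj.2, Complex.ofReal_mul]

lemma mem_extDom_of_eq {x : Fin nV → EuclideanSpace ℝ (Fin d)} {s : Fin nV → Fin nV → ℂ}
    (hx : ∀ v ∈ G.ext, ∀ w ∈ G.ext, v ≠ w → x v ≠ x w)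
    (hs : ∀ i ∈ G.ext, ∀ j ∈ G.ext, i < j → s i j = ((‖x i - x j‖ ^ 2 : ℝ) : ℂ)) :
    s ∈ G.extDom := by
  intro i hi j hj hij
  rw [hs i hi j hj hij, Complex.ofReal_re]
  exact pow_pos (norm_pos_iff.2 (sub_ne_zero.2 (hx i hi j hj hij.ne))) 2

/-- Feynman parametrization of the position space integral. -/
lemma prod_Gamma_mul_lintegral (hd : 0 < d) {n : Fin (m + 1) → ℕ}
    (hn : ∀ e, 0 < (n e : ℝ) + lam d * G.ν e) {x : Fin nV → EuclideanSpace ℝ (Fin d)}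
    (hx : ∀ v ∈ G.ext, ∀ w ∈ G.ext, v ≠ w → x v ≠ x w) {p : ℝ} (hp : p = lam d * ∑ e, G.ν e) :
    ENNReal.ofReal (∏ e, Real.Gamma ((n e : ℝ) + lam d * G.ν e)) *
      ∫⁻ y, ENNReal.ofReal (∏ e,
        ‖G.assemble x y (G.ends e).1 - G.assemble x y (G.ends e).2‖ ^ (-(2 * lam d * G.ν e)))
      = ENNReal.ofReal (Real.Gamma (p + ((∑ e, n e : ℕ) : ℝ))) *
        ∫⁻ β in {β : {e : Fin (m + 1) // e ≠ 0} → ℝ | ∀ e, 0 < β e},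
          ENNReal.ofReal (∏ e, chart β e ^ ((n e : ℝ) + lam d * G.ν e - 1)) *
            ∫⁻ y, ENNReal.ofReal (momentIntegrand (G.edgeSq x) p n (chart β) y) := by
  set a : Fin (m + 1) → ℝ := fun e => (n e : ℝ) + lam d * G.ν e with ha
  have hsum : ∑ e, a e = p + ((∑ e, n e : ℕ) : ℝ) := by
    rw [ha, Finset.sum_add_distrib, hp, Finset.mul_sum]
    push_cast
    ring
  have hGa : 0 ≤ ∏ e, Real.Gamma (a e) :=
    Finset.prod_nonneg fun e _ => (Real.Gamma_pos_of_pos (hn e)).le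
  have hae : ∀ᵐ y, ∀ e, 0 < G.edgeSq x y e := by
    rw [ae_all_iff]
    intro e
    have h := volume_edgeSq_eq_zero hd hx e
    filter_upwards [compl_mem_ae_iff.2 h] with y hy
    exact (edgeSq_nonneg x y e).lt_of_ne' hy
  have h1 : ∀ᵐ y, ENNReal.ofReal (∏ e, Real.Gamma (a e)) * ENNReal.ofReal (∏ e,
        ‖G.assemble x y (G.ends e).1 - G.assemble x y (G.ends e).2‖ ^ (-(2 * lam d * G.ν e)))
      = ∫⁻ β in {β : {e : Fin (m + 1) // e ≠ 0} → ℝ | ∀ e, 0 < β e},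
        ENNReal.ofReal (Real.Gamma (∑ e, a e)) *
          (ENNReal.ofReal (∏ e, chart β e ^ (a e - 1)) *
            ENNReal.ofReal (momentIntegrand (G.edgeSq x) p n (chart β) y)) := by
    filter_upwards [hae] with y hy
    have h2 : ∀ e, ‖G.assemble x y (G.ends e).1 - G.assemble x y (G.ends e).2‖ ^
        (-(2 * lam d * G.ν e)) = G.edgeSq x y e ^ n e * G.edgeSq x y e ^ (-a e) := fun e => by
      rw [← Real.rpow_natCast, ← Real.rpow_add (hy e), edgeSq, ← Real.rpow_natCast_mul
        (norm_nonneg _)]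
      congr 1
      simp only [ha]
      push_cast
      ring
    have hP : 0 ≤ ∏ e, G.edgeSq x y e ^ n e :=
      Finset.prod_nonneg fun e _ => pow_nonneg (hy e).le _
    rw [← ENNReal.ofReal_mul hGa, Finset.prod_congr rfl fun e _ => h2 e, Finset.prod_mul_distrib,
      mul_left_comm, ← Finset.prod_mul_distrib, ENNReal.ofReal_mul hP,
      ← lintegral_feynman hn hy, mul_left_comm, ← lintegral_const_mul' _ _ ENNReal.ofReal_ne_top,
      lintegral_const_mul' (ENNReal.ofReal (Real.Gamma (∑ e, a e))) _ ENNReal.ofReal_ne_top]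
    congr 1
    refine setLIntegral_congr_fun measurableSet_orthant fun β hβ => ?_
    have hW : 0 ≤ ∏ e, chart β e ^ (a e - 1) :=
      Finset.prod_nonneg fun e _ => Real.rpow_nonneg (chart_pos hβ e).le _
    rw [← ENNReal.ofReal_mul hP, ← ENNReal.ofReal_mul hW, momentIntegrand, ← hsum]
    congr 1
    ring
  rw [← lintegral_const_mul' _ _ ENNReal.ofReal_ne_top, lintegral_congr_ae h1,
    lintegral_lintegral_swap, ← hsum, ← lintegral_const_mul' _ _ ENNReal.ofReal_ne_top]
  · refine lintegral_congr fun β => ?_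
    rw [lintegral_const_mul' _ _ ENNReal.ofReal_ne_top, lintegral_const_mul' _ _
      ENNReal.ofReal_ne_top]
  · simp only [Function.uncurry_def]
    have hc : ∀ e, Measurable fun q : ({v : Fin nV // v ∉ G.ext} → EuclideanSpace ℝ (Fin d)) ×
        ({e : Fin (m + 1) // e ≠ 0} → ℝ) => chart q.2 e :=
      fun e => ((continuous_apply e).comp (continuous_chart.comp continuous_snd)).measurable
    have hq : ∀ e, Measurable fun q : ({v : Fin nV // v ∉ G.ext} → EuclideanSpace ℝ (Fin d)) ×
        ({e : Fin (m + 1) // e ≠ 0} → ℝ) => G.edgeSq x q.1 e :=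
      fun e => ((continuous_edgeSq x e).comp continuous_fst).measurable
    refine Measurable.aemeasurable (Measurable.const_mul (Measurable.fun_mul ?_ ?_) _)
    · exact (Finset.measurable_fun_prod _ fun e _ => (hc e).pow_const _).ennreal_ofReal
    · refine Measurable.ennreal_ofReal (Measurable.fun_mul ?_ ?_)
      · exact Finset.measurable_fun_prod _ fun e _ => (hq e).pow_const _
      · exact (Finset.measurable_fun_sum _ fun e _ => (hc e).mul (hq e)).pow_const _

section

lemma psiTilde_pos_and_phiTilde_pos {n : Fin (m + 1) → ℕ} (hUV : G.UVConvergent d) (hIR : G.IRConvergent d)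
    (hM : 0 < G.Mdeg d) (hn : ∀ e, 0 < (n e : ℝ) + lam d * G.ν e)
    (hcomp : ∀ v : Fin nV, ∃ w ∈ G.ext, (G.edgeGraph Finset.univ).Reachable v w)
    (hconn : G.ExtLinked Finset.univ) {x : Fin nV → EuclideanSpace ℝ (Fin d)}
    (hx : ∀ v ∈ G.ext, ∀ w ∈ G.ext, v ≠ w → x v ≠ x w)
    {α : Fin (m + 1) → ℝ} (hα : ∀ e, 0 < α e) :
    0 < G.psiTilde α ∧ 0 < G.phiTilde x α := by
  let s : Fin nV → Fin nV → ℂ := fun i j => ((‖x i - x j‖ ^ 2 : ℝ) : ℂ)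
  have hs : ∀ i ∈ G.ext, ∀ j ∈ G.ext, i < j → s i j = ((‖x i - x j‖ ^ 2 : ℝ) : ℂ) :=
    fun _ _ _ _ _ => rfl
  obtain ⟨h1, h2⟩ := mem_kernelDom hUV hIR hM hn hcomp hconn (mem_extDom_of_eq hx hs) hα
  rw [phiC_ofReal, phiTildeS_eq_phiTilde hs, Complex.ofReal_re] at h1
  rw [forestC_ofReal, Complex.ofReal_re] at h2
  exact ⟨h2, h1⟩

lemma lintegral_momentIntegrand_zero {n : Fin (m + 1) → ℕ} (hUV : G.UVConvergent d) (hIR : G.IRConvergent d)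
    (hM : 0 < G.Mdeg d) (hn : ∀ e, 0 < (n e : ℝ) + lam d * G.ν e)
    (hcomp : ∀ v : Fin nV, ∃ w ∈ G.ext, (G.edgeGraph Finset.univ).Reachable v w)
    (hconn : G.ExtLinked Finset.univ) {x : Fin nV → EuclideanSpace ℝ (Fin d)}
    (hx : ∀ v ∈ G.ext, ∀ w ∈ G.ext, v ≠ w → x v ≠ x w)
    {α : Fin (m + 1) → ℝ} (hα : ∀ e, 0 < α e) {p : ℝ}
    (hp : p = G.Mdeg d + (d : ℝ) / 2 * (G.intVerts.card : ℝ)) :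
    ∫⁻ y, ENNReal.ofReal (momentIntegrand (G.edgeSq x) p 0 α y)
      = ENNReal.ofReal ((Real.Gamma p)⁻¹ * (Real.pi ^ ((d : ℝ) / 2 * (G.intVerts.card : ℝ)) *
        Real.Gamma (G.Mdeg d) *
        (G.phiTilde x α ^ (-G.Mdeg d) * G.psiTilde α ^ (-((d : ℝ) / 2 - G.Mdeg d))))) := by
  obtain ⟨hψ, hφ⟩ := psiTilde_pos_and_phiTilde_pos hUV hIR hM hn hcomp hconn hx hα
  have hp0 : 0 < p := by rw [hp]; positivity
  have hΓ := Real.Gamma_pos_of_pos hp0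
  have h := lintegral_rpow_edgeSq x hα hψ hφ hM
    (sum_mul_pos (edgeSq_nonneg x) (exists_edgeSq_ne_zero hconn hx) hα) hp
  have h1 : ∀ y, momentIntegrand (G.edgeSq x) p 0 α y = (∑ e, α e * G.edgeSq x y e) ^ (-p) :=
    fun y => by simp [momentIntegrand]
  simp only [h1]
  rw [ENNReal.ofReal_mul (inv_nonneg.2 hΓ.le), ← h, ← mul_assoc, ← ENNReal.ofReal_mul
    (inv_nonneg.2 hΓ.le), inv_mul_cancel₀ hΓ.ne', ENNReal.ofReal_one, one_mul]

lemma integrable_momentIntegrand_edgeSq {n : Fin (m + 1) → ℕ} (hUV : G.UVConvergent d) (hIR : G.IRConvergent d)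
    (hM : 0 < G.Mdeg d) (hn : ∀ e, 0 < (n e : ℝ) + lam d * G.ν e)
    (hcomp : ∀ v : Fin nV, ∃ w ∈ G.ext, (G.edgeGraph Finset.univ).Reachable v w)
    (hconn : G.ExtLinked Finset.univ) {x : Fin nV → EuclideanSpace ℝ (Fin d)}
    (hx : ∀ v ∈ G.ext, ∀ w ∈ G.ext, v ≠ w → x v ≠ x w)
    (k : Fin (m + 1) → ℕ) {α : Fin (m + 1) → ℝ}
    (hα : ∀ e, 0 < α e) {p : ℝ} (hp : p = G.Mdeg d + (d : ℝ) / 2 * (G.intVerts.card : ℝ)) :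
    Integrable (momentIntegrand (G.edgeSq x) p k α) := by
  have hp0 : 0 < p := by rw [hp]; positivity
  have hA : ∀ e, Measurable fun y => G.edgeSq x y e := fun e => (continuous_edgeSq x e).measurable
  refine integrable_momentIntegrand hp0 hA (edgeSq_nonneg x) (exists_edgeSq_ne_zero hconn hx) k hα
    ⟨(measurable_momentIntegrand hA 0 α).aestronglyMeasurable, ?_⟩
  rw [hasFiniteIntegral_iff_ofReal (Filter.Eventually.of_forall
    (momentIntegrand_nonneg (edgeSq_nonneg x) 0 hα)),
    lintegral_momentIntegrand_zero hUV hIR hM hn hcomp hconn hx hα hp]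
  exact ENNReal.ofReal_lt_top

/-- The dual parametric integrand is, up to a sign, an integral of a nonnegative function over the
internal positions. -/
lemma dualIntegrandC_eq_moment {n : Fin (m + 1) → ℕ} (hUV : G.UVConvergent d) (hIR : G.IRConvergent d)
    (hM : 0 < G.Mdeg d) (hn : ∀ e, 0 < (n e : ℝ) + lam d * G.ν e)
    (hcomp : ∀ v : Fin nV, ∃ w ∈ G.ext, (G.edgeGraph Finset.univ).Reachable v w)
    (hconn : G.ExtLinked Finset.univ) {x : Fin nV → EuclideanSpace ℝ (Fin d)}
    (hx : ∀ v ∈ G.ext, ∀ w ∈ G.ext, v ≠ w → x v ≠ x w)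
    {s : Fin nV → Fin nV → ℂ}
    (hs : ∀ i ∈ G.ext, ∀ j ∈ G.ext, i < j → s i j = ((‖x i - x j‖ ^ 2 : ℝ) : ℂ)) {p : ℝ}
    (hp : p = G.Mdeg d + (d : ℝ) / 2 * (G.intVerts.card : ℝ))
    {β : {e : Fin (m + 1) // e ≠ 0} → ℝ} (hβ : ∀ e, 0 < β e) :
    dualIntegrandC d G n s β = (((-1) ^ (∑ e, n e) *
      ((Real.pi ^ ((d : ℝ) / 2 * (G.intVerts.card : ℝ)) * Real.Gamma (G.Mdeg d))⁻¹ *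
        (Real.Gamma (p + ((∑ e, n e : ℕ) : ℝ)) *
          ((∏ e, chart β e ^ ((n e : ℝ) + lam d * G.ν e - 1)) *
            moment volume (G.edgeSq x) p n (chart β)))) : ℝ) : ℂ) := by
  set c : ℝ := Real.pi ^ ((d : ℝ) / 2 * (G.intVerts.card : ℝ)) * Real.Gamma (G.Mdeg d) with hc
  have hp0 : 0 < p := by rw [hp]; positivity
  have hΓ := Real.Gamma_pos_of_pos hp0
  have hc0 : 0 < c := mul_pos (by positivity) (Real.Gamma_pos_of_pos hM)
  have hA : ∀ e, Measurable fun y => G.edgeSq x y e := fun e => (continuous_edgeSq x e).measurable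
  have hmom : ∀ k α, moment (ENNReal.ofReal c⁻¹ • volume) (G.edgeSq x) p k α
      = c⁻¹ * moment volume (G.edgeSq x) p k α := fun k α => by
    rw [moment, moment, integral_smul_measure, ENNReal.toReal_ofReal (inv_nonneg.2 hc0.le),
      smul_eq_mul]
  have hf : ∀ α : Fin (m + 1) → ℝ, (∀ e, 0 < α e) →
      G.phiTildeS s α ^ (-(G.Mdeg d : ℂ)) *
        ((G.psiTilde α : ℝ) : ℂ) ^ (-((((d : ℝ) / 2 - G.Mdeg d : ℝ)) : ℂ))
      = (momentGamma (ENNReal.ofReal c⁻¹ • volume) (G.edgeSq x) p 0 α : ℂ) := fun α hα => by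
    obtain ⟨hψ, hφ⟩ := psiTilde_pos_and_phiTilde_pos hUV hIR hM hn hcomp hconn hx hα
    rw [phiTildeS_eq_phiTilde hs, ← Complex.ofReal_neg, ← Complex.ofReal_neg,
      ← Complex.ofReal_cpow hφ.le, ← Complex.ofReal_cpow hψ.le, ← Complex.ofReal_mul, momentGamma,
      hmom, moment, integral_eq_lintegral_of_nonneg_ae (Filter.Eventually.of_forall
        (momentIntegrand_nonneg (edgeSq_nonneg x) 0 hα))
        (measurable_momentIntegrand hA 0 α).aestronglyMeasurable,
      lintegral_momentIntegrand_zero hUV hIR hM hn hcomp hconn hx hα hp, ← hc,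
      ENNReal.toReal_ofReal (by positivity)]
    congr 1
    simp only [Pi.zero_apply, Finset.sum_const_zero, pow_zero, Nat.cast_zero, add_zero, one_mul]
    field_simp
  rw [dualIntegrandC, multiDerivC_momentGamma hp0 hA (edgeSq_nonneg x)
    (exists_edgeSq_ne_zero hconn hx) (fun α hα => (integrable_momentIntegrand_edgeSq hUV hIR hM hn
      hcomp hconn hx 0 hα hp).smul_measure ENNReal.ofReal_ne_top) hf n (chart_pos hβ), momentGamma,
    hmom, ← Complex.ofReal_mul]
  congr 1
  ring

/-- At real squared distances, the continuation is the position space integral. -/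
lemma posIntegral_eq_Fcont {n : Fin (m + 1) → ℕ} (hUV : G.UVConvergent d) (hIR : G.IRConvergent d)
    (hM : 0 < G.Mdeg d) (hn : ∀ e, 0 < (n e : ℝ) + lam d * G.ν e)
    (hcomp : ∀ v : Fin nV, ∃ w ∈ G.ext, (G.edgeGraph Finset.univ).Reachable v w)
    (hconn : G.ExtLinked Finset.univ) {x : Fin nV → EuclideanSpace ℝ (Fin d)}
    (hx : ∀ v ∈ G.ext, ∀ w ∈ G.ext, v ≠ w → x v ≠ x w)
    (hd : 0 < d) {s : Fin nV → Fin nV → ℂ}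
    (hs : ∀ i ∈ G.ext, ∀ j ∈ G.ext, i < j → s i j = ((‖x i - x j‖ ^ 2 : ℝ) : ℂ)) :
    G.posIntegral d x ≠ ⊤ ∧ Fcont d G n s = (((G.posIntegral d x).toReal : ℝ) : ℂ) := by
  obtain ⟨p, hp⟩ : ∃ p, p = G.Mdeg d + (d : ℝ) / 2 * (G.intVerts.card : ℝ) := ⟨_, rfl⟩
  have hp' : p = lam d * ∑ e, G.ν e := by rw [hp, Mdeg]; ring
  have hp0 : 0 < p := by rw [hp]; positivity
  set π' : ℝ := Real.pi ^ ((d : ℝ) / 2 * (G.intVerts.card : ℝ)) with hπ'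
  have hπ0 : 0 < π' := by positivity
  have hΓM := Real.Gamma_pos_of_pos hM
  set Ω := {β : {e : Fin (m + 1) // e ≠ 0} → ℝ | ∀ e, 0 < β e} with hΩ
  set Q : ℝ := ∏ e, Real.Gamma ((n e : ℝ) + lam d * G.ν e) with hQ
  have hQ0 : 0 < Q := Finset.prod_pos fun e _ => Real.Gamma_pos_of_pos (hn e)
  set w : ({e : Fin (m + 1) // e ≠ 0} → ℝ) → ℝ :=
    fun β => ∏ e, chart β e ^ ((n e : ℝ) + lam d * G.ν e - 1) with hw
  have hw0 : ∀ β ∈ Ω, 0 ≤ w β := fun β hβ =>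
    Finset.prod_nonneg fun e _ => Real.rpow_nonneg (chart_pos hβ e).le _
  set g : ℝ := Real.Gamma (p + ((∑ e, n e : ℕ) : ℝ)) with hg
  have hg0 : 0 < g := Real.Gamma_pos_of_pos (by positivity)
  let h : ({e : Fin (m + 1) // e ≠ 0} → ℝ) → ℝ :=
    fun β => g * (w β * moment volume (G.edgeSq x) p n (chart β))
  have hmom : ∀ β ∈ Ω, 0 ≤ moment volume (G.edgeSq x) p n (chart β) := fun β hβ =>
    integral_nonneg (momentIntegrand_nonneg (edgeSq_nonneg x) n (chart_pos hβ))
  have hh0 : ∀ β ∈ Ω, 0 ≤ h β := fun β hβ =>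
    mul_nonneg hg0.le (mul_nonneg (hw0 β hβ) (hmom β hβ))
  have hdual : ∀ β ∈ Ω, dualIntegrandC d G n s β
      = (((-1) ^ (∑ e, n e) * (π' * Real.Gamma (G.Mdeg d))⁻¹ : ℝ) : ℂ) * (h β : ℂ) :=
    fun β hβ => by
      rw [dualIntegrandC_eq_moment hUV hIR hM hn hcomp hconn hx hs hp hβ, ← Complex.ofReal_mul,
        mul_assoc]
  have hsign : ((-1 : ℝ) ^ (∑ e, n e)) * (-1) ^ (∑ e, n e) = 1 := by
    rw [← mul_pow]; simp
  have hk : ((-1) ^ (∑ e, n e) * (π' * Real.Gamma (G.Mdeg d))⁻¹ : ℝ) ≠ 0 :=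
    mul_ne_zero (pow_ne_zero _ (by norm_num)) (inv_ne_zero (mul_pos hπ0 hΓM).ne')
  have hint : IntegrableOn h Ω := by
    have h1 := integrableOn_dualIntegrandC hUV hIR hM hn hcomp hconn (mem_extDom_of_eq hx hs)
    have h2 := (integrableOn_congr_fun hdual measurableSet_orthant).1 h1
    have h3 : IntegrableOn (fun β => (h β : ℂ)) Ω :=
      (integrable_const_mul_iff (Ne.isUnit (Complex.ofReal_ne_zero.2 hk)) _).1 h2
    simpa [IntegrableOn] using h3.re
  have hF : Fcont d G n s = (((∫ β in Ω, h β) / (Q * π') : ℝ) : ℂ) := by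
    rw [Fcont, setIntegral_congr_fun measurableSet_orthant hdual, integral_const_mul,
      integral_complex_ofReal, ← Complex.ofReal_mul, ← Complex.ofReal_mul]
    congr 1
    rw [← hQ]
    have : (-1 : ℝ) ^ (∑ e, n e) * Real.Gamma (G.Mdeg d) / Q *
        ((-1) ^ (∑ e, n e) * (π' * Real.Gamma (G.Mdeg d))⁻¹ * ∫ β in Ω, h β)
        = ((-1) ^ (∑ e, n e) * (-1) ^ (∑ e, n e)) * ((∫ β in Ω, h β) / (Q * π')) := by
      field_simp
    rw [this, hsign, one_mul]
  have hlin : ENNReal.ofReal Q * ∫⁻ y, ENNReal.ofReal (∏ e,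
        ‖G.assemble x y (G.ends e).1 - G.assemble x y (G.ends e).2‖ ^ (-(2 * lam d * G.ν e)))
      = ENNReal.ofReal (∫ β in Ω, h β) := by
    rw [prod_Gamma_mul_lintegral hd hn hx hp', ofReal_integral_eq_lintegral_ofReal hint
      ((ae_restrict_iff' measurableSet_orthant).2 (Filter.Eventually.of_forall hh0)),
      ← lintegral_const_mul' _ _ ENNReal.ofReal_ne_top]
    refine setLIntegral_congr_fun measurableSet_orthant fun β hβ => ?_
    simp only [h]
    rw [ENNReal.ofReal_mul hg0.le, ENNReal.ofReal_mul (hw0 β hβ), moment,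
      ofReal_integral_eq_lintegral_ofReal (integrable_momentIntegrand_edgeSq hUV hIR hM hn hcomp
        hconn hx n (chart_pos hβ) hp) (Filter.Eventually.of_forall
        (momentIntegrand_nonneg (edgeSq_nonneg x) n (chart_pos hβ)))]
  have hI0 : 0 ≤ ∫ β in Ω, h β := setIntegral_nonneg measurableSet_orthant hh0
  have hpos : G.posIntegral d x = ENNReal.ofReal ((∫ β in Ω, h β) / (Q * π')) := by
    rw [posIntegral, ← hπ', ← div_div, ENNReal.ofReal_div_of_pos hπ0, ENNReal.ofReal_div_of_pos hQ0,
      ← hlin, mul_comm (ENNReal.ofReal Q), ENNReal.mul_div_cancel_right (ENNReal.ofReal_pos.2 hQ0).ne'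
        ENNReal.ofReal_ne_top]
  rw [hpos]
  exact ⟨ENNReal.ofReal_ne_top, by rw [hF, ENNReal.toReal_ofReal (by positivity)]⟩

end

end FeynmanGraph

/-- Analytic continuation of the graphical function in the squared
distances: on the domain `Ω = {s : Re s_{ij} > 0}` the dual parametric integral
converges absolutely, `F` is holomorphic on `Ω`, and whenever
`s_{ij} = ‖x_i - x_j‖²` for pairwise distinct external positions `x`, the value
`F(s)` equals the (finite) position-space Feynman integral `f_G(x)`. -/
theorem analytic_continuation {d nV m : ℕ} (hd : 2 < d)
    (G : FeynmanGraph nV (m + 1))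
    (hUV : G.UVConvergent d) (hIR : G.IRConvergent d)
    (hM : 0 < G.Mdeg d)
    (hcomp : ∀ v : Fin nV, ∃ w ∈ G.ext, (G.edgeGraph Finset.univ).Reachable v w)
    (hconn : ∃ i ∈ G.ext, ∃ j ∈ G.ext, i ≠ j ∧ (G.edgeGraph Finset.univ).Reachable i j)
    (n : Fin (m + 1) → ℕ) (hn : ∀ e, 0 < (n e : ℝ) + lam d * G.ν e) :
    (∀ s ∈ {s : Fin nV → Fin nV → ℂ | ∀ i ∈ G.ext, ∀ j ∈ G.ext, i < j → 0 < (s i j).re},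
      IntegrableOn (dualIntegrandC d G n s)
        {β : {e : Fin (m + 1) // e ≠ 0} → ℝ | ∀ e, 0 < β e} volume) ∧
    DifferentiableOn ℂ (Fcont d G n)
      {s : Fin nV → Fin nV → ℂ | ∀ i ∈ G.ext, ∀ j ∈ G.ext, i < j → 0 < (s i j).re} ∧
    ∀ x : Fin nV → EuclideanSpace ℝ (Fin d),
      (∀ v ∈ G.ext, ∀ w ∈ G.ext, v ≠ w → x v ≠ x w) →
      ∀ s : Fin nV → Fin nV → ℂ,
        (∀ i ∈ G.ext, ∀ j ∈ G.ext, i < j → s i j = ((‖x i - x j‖ ^ 2 : ℝ) : ℂ)) →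
        G.posIntegral d x ≠ ⊤ ∧ Fcont d G n s = (((G.posIntegral d x).toReal : ℝ) : ℂ) := by
  have hlink : G.ExtLinked Finset.univ := hconn
  exact ⟨fun s hs => FeynmanGraph.integrableOn_dualIntegrandC hUV hIR hM hn hcomp hlink hs,
    FeynmanGraph.differentiableOn_Fcont hUV hIR hM hn hcomp hlink,
    fun x hx s hs => FeynmanGraph.posIntegral_eq_Fcont hUV hIR hM hn hcomp hlink hx
      (zero_lt_two.trans hd) hs⟩
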